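/- Let n ∈ ℕ, k ∈ {1,…,n}, and let β > (n−1)/2 be an integer or half-integer. (a) If 2β − n is odd, then 𝐉̃_{n,k}(β) is a rational number. (b) If 2β − n is even, then there exist rational numbers q_0, q_2, q_4, … such that 𝐉̃_{n,k}(β) = q_0 + q_2·π^{−2} + q_4·π^{−4} + … + q_{n−k−1}·π^{−(n−k−1)} if n−k is odd, and 𝐉̃_{n,k}(β) = q_0 + q_2·π^{−2} + q_4·π^{−4} + … + q_{n−k}·π^{−(n−k)} if n−k is even. -/

import Mathlib

open MeasureTheory Real

noncomputable section

/-- The uniform probability measure on the unit sphere of `ℝ^m`. -/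
def sphereUnif (m : ℕ) : Measure (Metric.sphere (0 : EuclideanSpace ℝ (Fin m)) 1) :=
  ((volume : Measure (EuclideanSpace ℝ (Fin m))).toSphere Set.univ)⁻¹ •
    (volume : Measure (EuclideanSpace ℝ (Fin m))).toSphere

/-- The internal angle of a set `P ⊆ ℝ^m` at a reference point `g₀` (a point in the
relative interior of the face of interest): the normalized spherical Lebesgue measure of
the set of directions `u` on the unit sphere with `g₀ + ε • u ∈ P` for some `ε > 0`. -/
def internalAngle {m : ℕ} (g₀ : EuclideanSpace ℝ (Fin m))
    (P : Set (EuclideanSpace ℝ (Fin m))) : ℝ :=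
  (sphereUnif m {u : Metric.sphere (0 : EuclideanSpace ℝ (Fin m)) 1 |
    ∃ ε : ℝ, 0 < ε ∧ g₀ + ε • (u : EuclideanSpace ℝ (Fin m)) ∈ P}).toReal

/-- The beta' density `f̃_{d,β}` on `ℝ^d`. -/
def betaPrimeDensity (d : ℕ) (β : ℝ) (x : EuclideanSpace ℝ (Fin d)) : ℝ :=
  (Real.Gamma β / (Real.pi ^ ((d : ℝ) / 2) * Real.Gamma (β - (d : ℝ) / 2))) *
    (1 + ‖x‖ ^ 2) ^ (-β)

/-- The beta' distribution on `ℝ^d` with parameter `β > d/2`. -/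
def betaPrimeMeasure (d : ℕ) (β : ℝ) : Measure (EuclideanSpace ℝ (Fin d)) :=
  volume.withDensity fun x => ENNReal.ofReal (betaPrimeDensity d β x)

/-- `Jt n k β`: the expected internal angle of the beta' simplex `[X̃_1,…,X̃_n]` at its
face `[X̃_1,…,X̃_k]`; the reference point in the relative interior of the face is its
centroid. -/
def Jt (n k : ℕ) (β : ℝ) : ℝ :=
  ∫ X : Fin n → EuclideanSpace ℝ (Fin (n - 1)),
    internalAngle
      ((k : ℝ)⁻¹ • ∑ i ∈ Finset.univ.filter (fun i : Fin n => (i : ℕ) < k), X i)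
      (convexHull ℝ (Set.range X))
    ∂(Measure.pi fun _ : Fin n => betaPrimeMeasure (n - 1) β)

/-- `Jtb n k β = binom(n,k) * Jt n k β`, the expected internal angle sum `𝐉̃_{n,k}(β)`. -/
def Jtb (n k : ℕ) (β : ℝ) : ℝ := (n.choose k : ℝ) * Jt n k β

theorem integrableOn_pow_mul_exp_neg_mul (l : ℕ) {a : ℝ} (ha : 0 < a) :
    IntegrableOn (fun x : ℝ => x ^ l * exp (-(a * x))) (Set.Ioi 0) := by
  have h := integrableOn_rpow_mul_exp_neg_mul_rpow (p := 1) (s := l) (b := a)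
    (by have : (0 : ℝ) ≤ l := l.cast_nonneg
        linarith) one_pos ha
  refine h.congr_fun (fun x hx => ?_) measurableSet_Ioi
  simp [Real.rpow_natCast]

theorem integral_pow_mul_exp_neg_mul (l : ℕ) {a : ℝ} (ha : 0 < a) :
    ∫ x in Set.Ioi (0 : ℝ), x ^ l * exp (-(a * x)) = l.factorial / a ^ (l + 1) := by
  have h := Real.integral_rpow_mul_exp_neg_mul_Ioi (a := l + 1) (r := a) (by positivity) ha
  rw [Real.Gamma_nat_eq_factorial] at h
  have e : ∀ x : ℝ, x ^ ((l : ℝ) + 1 - 1) = x ^ l := fun x => by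
    rw [add_sub_cancel_right, Real.rpow_natCast]
  simp only [e] at h
  rw [h]
  have : (l : ℝ) + 1 = ((l + 1 : ℕ) : ℝ) := by push_cast; ring
  rw [this, Real.rpow_natCast, one_div, inv_pow, div_eq_inv_mul]

theorem hasSum_integral_pow_mul_exp (l : ℕ) (a : ℕ → ℝ) (ha0 : a 0 = 0)
    (hs : Summable fun n : ℕ => |a n| / (n : ℝ) ^ (l + 1)) :
    HasSum (fun n : ℕ => a n * (l.factorial / (n : ℝ) ^ (l + 1)))
      (∫ x in Set.Ioi (0 : ℝ), ∑' n : ℕ, a n * (x ^ l * exp (-(n * x)))) := by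
  have key : ∀ n : ℕ, a n * ∫ x in Set.Ioi (0 : ℝ), x ^ l * exp (-(n * x)) =
      a n * (l.factorial / (n : ℝ) ^ (l + 1)) := by
    intro n
    rcases Nat.eq_zero_or_pos n with rfl | hn
    · simp [ha0]
    · rw [integral_pow_mul_exp_neg_mul l (by exact_mod_cast hn)]
  have := hasSum_integral_of_summable_integral_norm (μ := volume.restrict (Set.Ioi (0 : ℝ)))
    (F := fun (n : ℕ) (x : ℝ) => a n * (x ^ l * exp (-(n * x)))) ?_ ?_
  · simp only [integral_const_mul, key] at this
    exact this
  · intro n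
    rcases Nat.eq_zero_or_pos n with rfl | hn
    · simp [ha0]
    · exact (integrableOn_pow_mul_exp_neg_mul l (by exact_mod_cast hn)).const_mul _
  · have e : ∀ n : ℕ, ∫ x in Set.Ioi (0 : ℝ), ‖a n * (x ^ l * exp (-(n * x)))‖ =
        l.factorial * (|a n| / (n : ℝ) ^ (l + 1)) := by
      intro n
      have : ∀ x ∈ Set.Ioi (0 : ℝ), ‖a n * (x ^ l * exp (-(n * x)))‖ =
          |a n| * (x ^ l * exp (-(n * x))) := by
        intro x hx
        have hx' : (0 : ℝ) < x := hx
        rw [norm_mul, Real.norm_eq_abs, Real.norm_of_nonneg (by positivity)]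
      rw [setIntegral_congr_fun measurableSet_Ioi this, integral_const_mul]
      rcases Nat.eq_zero_or_pos n with rfl | hn
      · simp [ha0]
      · rw [integral_pow_mul_exp_neg_mul l (by exact_mod_cast hn)]; ring
    simp only [e]
    exact hs.mul_left _

theorem tsum_sin_mul_exp {x : ℝ} (hx : 0 < x) :
    ∑' n : ℕ, sin (2 * π * n * (1 / 4)) * exp (-(n * x)) = (2 * cosh x)⁻¹ := by
  have hr : ‖Complex.I * (exp (-x) : ℝ)‖ < 1 := by
    rw [norm_mul, Complex.norm_I, one_mul, Complex.norm_real, Real.norm_of_nonneg (exp_pos _).le]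
    exact Real.exp_lt_one_iff.2 (by linarith)
  have h := Complex.hasSum_im (hasSum_geometric_of_norm_lt_one hr)
  have e : ∀ n : ℕ, ((Complex.I * (exp (-x) : ℝ)) ^ n).im =
      sin (2 * π * n * (1 / 4)) * exp (-(n * x)) := by
    intro n
    have h1 : Complex.I * (exp (-x) : ℝ) = Complex.exp (((π / 2 : ℝ) : ℂ) * Complex.I + ((-x : ℝ) : ℂ)) := by
      rw [Complex.exp_add, Complex.ofReal_exp]
      congr 1
      push_cast
      rw [Complex.exp_pi_div_two_mul_I]
    rw [h1, ← Complex.exp_nat_mul]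
    rw [Complex.exp_im]
    simp only [Complex.mul_re, Complex.mul_im, Complex.add_re, Complex.add_im, Complex.natCast_re,
      Complex.natCast_im, Complex.ofReal_re, Complex.ofReal_im, Complex.I_re, Complex.I_im]
    rw [mul_comm]
    congr 1
    · congr 1; ring
    · congr 1; ring
  simp only [e] at h
  rw [h.tsum_eq, Complex.inv_im, Complex.normSq_apply]
  simp only [Complex.sub_im, Complex.one_im, Complex.mul_im, Complex.I_re, Complex.I_im,
    Complex.ofReal_re, Complex.ofReal_im, Complex.sub_re, Complex.one_re, Complex.mul_re]
  have h2 : exp (-x) * exp x = 1 := by rw [← exp_add]; simp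
  have := exp_pos x
  have := exp_pos (-x)
  have h3 : exp x = (exp (-x))⁻¹ := by rw [← exp_neg]; simp
  rw [cosh_eq, h3]
  have hE := exp_pos (-x)
  generalize exp (-x) = E at hE
  have : 1 + E ^ 2 ≠ 0 := by positivity
  simp only [zero_mul, mul_zero, one_mul, sub_zero, zero_add, zero_sub, mul_neg, neg_mul,
    neg_neg]
  field_simp

theorem tsum_cos_mul_exp {x : ℝ} (hx : 0 < x) :
    ∑' n : ℕ, n * cos (2 * π * n * (1 / 2)) * exp (-(n * (2 * x))) = -((4 * cosh x ^ 2)⁻¹) := by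
  have hr : ‖-exp (-(2 * x))‖ < 1 := by
    rw [norm_neg, Real.norm_of_nonneg (exp_pos _).le]
    exact Real.exp_lt_one_iff.2 (by linarith)
  have h := hasSum_coe_mul_geometric_of_norm_lt_one hr
  have e : ∀ n : ℕ, (n : ℝ) * (-exp (-(2 * x))) ^ n =
      n * cos (2 * π * n * (1 / 2)) * exp (-(n * (2 * x))) := by
    intro n
    have : (2 * π * n * (1 / 2)) = n * π := by ring
    rw [this, Real.cos_nat_mul_pi, neg_pow, ← exp_nat_mul]
    rw [mul_assoc]
    congr 3
    ring
  simp only [e] at h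
  rw [h.tsum_eq, cosh_eq]
  have h2 : exp (-(2 * x)) = exp (-x) ^ 2 := by rw [← exp_nat_mul]; congr 1; push_cast; ring
  have h3 : exp x = (exp (-x))⁻¹ := by rw [← exp_neg]; simp
  rw [h2, h3, sub_neg_eq_add]
  have hE := exp_pos (-x)
  generalize exp (-x) = E at hE
  have : 1 + E ^ 2 ≠ 0 := by positivity
  field_simp
  ring

/-- The moments `∫ x^l sinh^p x / cosh^q x dx`. -/
def hypMoment (l p q : ℕ) : ℝ := ∫ x : ℝ, x ^ l * sinh x ^ p / cosh x ^ q

/-- Rational combinations of `π^e, π^(e+2), …` with exponents at most `e + N`. -/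
def piSpan (e N : ℕ) : Submodule ℚ ℝ :=
  Submodule.span ℚ {y : ℝ | ∃ i : ℕ, 2 * i ≤ N ∧ y = π ^ (2 * i + e)}

theorem piSpan_mono (e : ℕ) {N M : ℕ} (h : N ≤ M) : piSpan e N ≤ piSpan e M :=
  Submodule.span_mono fun _ ⟨i, hi, hy⟩ => ⟨i, hi.trans h, hy⟩

theorem ratCast_mul_mem {V : Submodule ℚ ℝ} (q : ℚ) {y : ℝ} (hy : y ∈ V) : (q : ℝ) * y ∈ V := by
  have := V.smul_mem q hy
  rwa [Rat.smul_def] at this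

theorem ratCast_mul_pi_pow_mem (e : ℕ) {i N : ℕ} (hi : 2 * i ≤ N) (q : ℚ) :
    (q : ℝ) * π ^ (2 * i + e) ∈ piSpan e N :=
  ratCast_mul_mem q (Submodule.subset_span ⟨i, hi, rfl⟩)

theorem integrable_pow_mul_exp_neg_abs (l : ℕ) :
    Integrable fun x : ℝ => x ^ l * exp (-|x|) := by
  have h : IntegrableOn (fun x : ℝ => x ^ l * exp (-|x|)) (Set.Ioi 0) := by
    refine (integrableOn_pow_mul_exp_neg_mul l one_pos).congr_fun (fun x hx => ?_)
      measurableSet_Ioi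
    simp only [one_mul, abs_of_pos (show (0 : ℝ) < x from hx)]
  have h' : IntegrableOn (fun x : ℝ => x ^ l * exp (-|x|)) (Set.Iic 0) := by
    have h0 : IntegrableOn (fun x : ℝ => x ^ l * exp (-|x|)) (Set.Ici (-0)) := by
      rw [neg_zero]
      exact h.congr_set_ae Ioi_ae_eq_Ici.symm
    have := h0.comp_neg_Iic
    refine (Integrable.const_mul this ((-1) ^ l)).congr (Filter.Eventually.of_forall fun x => ?_)
    simp only [abs_neg]
    rw [← mul_assoc, ← mul_pow]
    simp
  rw [← integrableOn_univ, ← Set.Iic_union_Ioi (a := (0 : ℝ))]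
  exact h'.union h

theorem abs_sinh_le_cosh (x : ℝ) : |sinh x| ≤ cosh x :=
  abs_le_of_sq_le_sq (by rw [sinh_sq]; linarith) (cosh_pos x).le

theorem exp_abs_le_two_mul_cosh (x : ℝ) : exp |x| ≤ 2 * cosh x := by
  rw [← cosh_abs, cosh_eq]
  have := exp_pos (-|x|)
  linarith

theorem integrable_hypMoment (l : ℕ) {p q : ℕ} (h : p < q) :
    Integrable fun x : ℝ => x ^ l * sinh x ^ p / cosh x ^ q := by
  refine ((integrable_pow_mul_exp_neg_abs l).const_mul 2).mono ?_ ?_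
  · refine Continuous.aestronglyMeasurable ?_
    exact (by fun_prop : Continuous fun x : ℝ => x ^ l * sinh x ^ p).div (by fun_prop)
      fun x => pow_ne_zero _ (cosh_pos x).ne'
  · refine Filter.Eventually.of_forall fun x => ?_
    rw [norm_div, norm_mul, norm_mul, norm_mul, norm_pow, norm_pow, norm_pow,
      Real.norm_of_nonneg (exp_pos _).le, Real.norm_of_nonneg (cosh_pos x).le,
      Real.norm_of_nonneg (two_pos.le), Real.norm_eq_abs, Real.norm_eq_abs]
    have hc := cosh_pos x
    have h1 : |sinh x| ^ p ≤ cosh x ^ (q - 1) :=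
      (pow_le_pow_left₀ (abs_nonneg _) (abs_sinh_le_cosh x) p).trans
        (pow_le_pow_right₀ (one_le_cosh x) (by omega))
    have h2 : (cosh x)⁻¹ ≤ 2 * exp (-|x|) := by
      rw [exp_neg, inv_le_iff_one_le_mul₀ hc]
      have := exp_abs_le_two_mul_cosh x
      have h3 := exp_pos |x|
      field_simp
      linarith
    calc |x| ^ l * |sinh x| ^ p / cosh x ^ q
        ≤ |x| ^ l * cosh x ^ (q - 1) / cosh x ^ q := by gcongr
      _ = |x| ^ l * (cosh x)⁻¹ := by
          obtain ⟨t, rfl⟩ : ∃ t, q = t + 1 := ⟨q - 1, by omega⟩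
          rw [Nat.add_sub_cancel]
          have : cosh x ≠ 0 := hc.ne'
          rw [pow_succ]
          field_simp
      _ ≤ |x| ^ l * (2 * exp (-|x|)) := by gcongr
      _ = 2 * (|x| ^ l * exp (-|x|)) := by ring

theorem integral_eq_two_mul_Ioi {f : ℝ → ℝ} (hf : ∀ x, f (-x) = f x) :
    ∫ x, f x = 2 * ∫ x in Set.Ioi (0 : ℝ), f x := by
  rw [← integral_comp_abs]
  congr 1 with x
  rcases abs_choice x with h | h <;> rw [h]
  rw [hf]

theorem eval_bernoulli_rat (k : ℕ) (x : ℚ) :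
    (Polynomial.map (algebraMap ℚ ℝ) (Polynomial.bernoulli k)).eval (x : ℝ) =
      (((Polynomial.bernoulli k).eval x : ℚ) : ℝ) := by
  have : (x : ℝ) = algebraMap ℚ ℝ x := rfl
  rw [this, Polynomial.eval_map, Polynomial.eval₂_at_apply]
  rfl

theorem summable_bounded_div_pow {a : ℕ → ℝ} (ha : ∀ n, |a n| ≤ 1) {k : ℕ} (hk : 1 < k) :
    Summable fun n : ℕ => |a n| / (n : ℝ) ^ k := by
  refine Summable.of_nonneg_of_le (fun n => by positivity) (fun n => ?_)
    (Real.summable_one_div_nat_pow.2 hk)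
  gcongr
  exact ha n

theorem hypMoment_even_zero_one (j : ℕ) : hypMoment (2 * j) 0 1 ∈ piSpan 1 (2 * j) := by
  rcases Nat.eq_zero_or_pos j with rfl | hj
  · have hd : ∀ x : ℝ, HasDerivAt (fun x => arctan (sinh x)) (x ^ (2 * 0) * sinh x ^ 0 / cosh x ^ 1) x := by
      intro x
      have := (hasDerivAt_arctan (sinh x)).comp x (hasDerivAt_sinh x)
      refine this.congr_deriv ?_
      rw [← cosh_sq']
      have := cosh_pos x
      field_simp
      simp
    have h := integral_of_hasDerivAt_of_tendsto hd (integrable_hypMoment (2 * 0) one_pos)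
      (m := -(π / 2)) (n := π / 2)
      ((tendsto_arctan_atBot.mono_right nhdsWithin_le_nhds).comp sinhOrderIso.tendsto_atBot)
      ((tendsto_arctan_atTop.mono_right nhdsWithin_le_nhds).comp sinhOrderIso.tendsto_atTop)
    rw [hypMoment, h]
    convert ratCast_mul_pi_pow_mem 1 (i := 0) (N := 2 * 0) le_rfl 1 using 1
    push_cast; ring
  · have h1 := hasSum_one_div_nat_pow_mul_sin hj.ne' (x := 1 / 4) (by constructor <;> norm_num)
    have h2 := hasSum_integral_pow_mul_exp (2 * j) (fun n => sin (2 * π * n * (1 / 4)))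
      (by simp) (summable_bounded_div_pow (fun n => abs_sin_le_one _) (by omega))
    have h3 := (h1.mul_left (((2 * j).factorial : ℝ))).unique
      (h2.congr_fun fun n => by ring)
    have h4 : ∀ x ∈ Set.Ioi (0 : ℝ), ∑' n : ℕ, sin (2 * π * n * (1 / 4)) * (x ^ (2 * j) * exp (-(n * x)))
        = 2⁻¹ * (x ^ (2 * j) * sinh x ^ 0 / cosh x ^ 1) := by
      intro x hx
      have : ∀ n : ℕ, sin (2 * π * n * (1 / 4)) * (x ^ (2 * j) * exp (-(n * x))) =
        x ^ (2 * j) * (sin (2 * π * n * (1 / 4)) * exp (-(n * x))) := fun n => by ring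
      simp only [this]
      rw [tsum_mul_left, tsum_sin_mul_exp hx]
      have := cosh_pos x
      field_simp
    rw [setIntegral_congr_fun measurableSet_Ioi h4, integral_const_mul] at h3
    have h5 : hypMoment (2 * j) 0 1 = 4 * (2⁻¹ * ∫ x in Set.Ioi (0 : ℝ), x ^ (2 * j) * sinh x ^ 0 / cosh x ^ 1) := by
      rw [hypMoment, integral_eq_two_mul_Ioi]
      · ring
      · intro x; simp [Even.neg_pow (even_two_mul j)]
    rw [h5, ← h3]
    have h6 := eval_bernoulli_rat (2 * j + 1) (1 / 4)
    push_cast at h6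
    rw [h6]
    convert ratCast_mul_pi_pow_mem 1 (i := j) (N := 2 * j) le_rfl
      (4 * ((2 * j).factorial * ((-1) ^ (j + 1) * 2 ^ (2 * j + 1) / 2 / (2 * j + 1).factorial *
        (Polynomial.bernoulli (2 * j + 1)).eval (1 / 4)))) using 1
    push_cast
    ring

theorem hypMoment_even_zero_two (j : ℕ) : hypMoment (2 * j) 0 2 ∈ piSpan 0 (2 * j) := by
  rcases Nat.eq_zero_or_pos j with rfl | hj
  · have hd : ∀ x : ℝ, HasDerivAt (fun x => sinh x / cosh x) (x ^ (2 * 0) * sinh x ^ 0 / cosh x ^ 2) x := by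
      intro x
      have hc := cosh_pos x
      refine ((hasDerivAt_sinh x).div (hasDerivAt_cosh x) hc.ne').congr_deriv ?_
      rw [← sq, ← sq, cosh_sq_sub_sinh_sq]
      simp
    have ht : Filter.Tendsto (fun x => sinh x / cosh x) Filter.atTop (nhds 1) := by
      have h0 : Filter.Tendsto (fun x : ℝ => exp (-(2 * x))) Filter.atTop (nhds 0) := by
        refine tendsto_exp_neg_atTop_nhds_zero.comp ?_
        exact Filter.tendsto_id.const_mul_atTop two_pos
      have h1 : Filter.Tendsto (fun x : ℝ => (1 - exp (-(2 * x))) / (1 + exp (-(2 * x))))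
          Filter.atTop (nhds ((1 - 0) / (1 + 0))) :=
        (h0.const_sub 1).div (h0.const_add 1) (by norm_num)
      simp only [sub_zero, add_zero, div_one] at h1
      refine h1.congr fun x => ?_
      have h2 : exp (-(2 * x)) = (exp x)⁻¹ ^ 2 := by
        rw [← exp_neg, ← exp_nat_mul]; congr 1; push_cast; ring
      rw [sinh_eq, cosh_eq, h2, exp_neg]
      have hE := exp_pos x
      generalize exp x = E at hE
      field_simp
    have hb : Filter.Tendsto (fun x => sinh x / cosh x) Filter.atBot (nhds (-1)) := by
      have := (ht.comp Filter.tendsto_neg_atBot_atTop).neg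
      refine this.congr fun x => ?_
      simp [neg_div]
    have h := integral_of_hasDerivAt_of_tendsto hd (integrable_hypMoment (2 * 0) two_pos) hb ht
    rw [hypMoment, h]
    convert ratCast_mul_pi_pow_mem 0 (i := 0) (N := 2 * 0) le_rfl 2 using 1
    norm_num
  · have h1 := hasSum_one_div_nat_pow_mul_cos hj.ne' (x := 1 / 2) (by constructor <;> norm_num)
    have hs : Summable fun n : ℕ => |(n : ℝ) * cos (2 * π * n * (1 / 2))| / (n : ℝ) ^ (2 * j + 1) := by
      refine (summable_bounded_div_pow (a := fun n : ℕ => cos (2 * π * n * (1 / 2))) (fun n => abs_cos_le_one _)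
        (k := 2 * j) (by omega)).congr fun n => ?_
      rcases Nat.eq_zero_or_pos n with rfl | hn
      · simp [hj.ne']
      · have : (0 : ℝ) < n := by exact_mod_cast hn
        rw [abs_mul, abs_of_pos this, pow_succ]
        field_simp
    have h2 := hasSum_integral_pow_mul_exp (2 * j) (fun n => n * cos (2 * π * n * (1 / 2)))
      (by simp) hs
    have h3 := (h1.mul_left (((2 * j).factorial : ℝ))).unique
      (h2.congr_fun fun n => by
        rcases Nat.eq_zero_or_pos n with rfl | hn
        · simp [hj.ne']
        · have : (0 : ℝ) < n := by exact_mod_cast hn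
          rw [pow_succ]
          field_simp)
    have h4 : ∀ x ∈ Set.Ioi (0 : ℝ), ∑' n : ℕ, (n * cos (2 * π * n * (1 / 2))) * (x ^ (2 * j) * exp (-(n * x)))
        = -(4⁻¹ * (x ^ (2 * j) * sinh (2⁻¹ * x) ^ 0 / cosh (2⁻¹ * x) ^ 2)) := by
      intro x hx
      have : ∀ n : ℕ, (n * cos (2 * π * n * (1 / 2))) * (x ^ (2 * j) * exp (-(n * x))) =
        x ^ (2 * j) * (n * cos (2 * π * n * (1 / 2)) * exp (-(n * (2 * (2⁻¹ * x))))) := fun n => by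
          rw [mul_inv_cancel_left₀ two_ne_zero]
          ring
      simp only [this]
      rw [tsum_mul_left, tsum_cos_mul_exp (mul_pos (by norm_num) hx)]
      have := cosh_pos (2⁻¹ * x)
      field_simp
    rw [setIntegral_congr_fun measurableSet_Ioi h4, integral_neg, integral_const_mul] at h3
    have h5 : hypMoment (2 * j) 0 2 = -(4 * 2⁻¹ ^ (2 * j)) * -(4⁻¹ * ∫ x in Set.Ioi (0 : ℝ), x ^ (2 * j) * sinh (2⁻¹ * x) ^ 0 / cosh (2⁻¹ * x) ^ 2) := by
      rw [hypMoment, integral_eq_two_mul_Ioi]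
      · have := integral_comp_mul_left_Ioi (fun x : ℝ => x ^ (2 * j) * sinh x ^ 0 / cosh x ^ 2) 0 (b := 2⁻¹) (by norm_num)
        rw [mul_zero, smul_eq_mul, inv_inv] at this
        rw [← this, neg_mul_neg, mul_assoc, ← integral_const_mul, ← integral_const_mul,
          ← integral_const_mul]
        congr 1 with x
        rw [mul_pow]
        ring
      · intro x; simp [Even.neg_pow (even_two_mul j)]
    rw [h5, ← h3]
    have h6 := eval_bernoulli_rat (2 * j) (1 / 2)
    push_cast at h6
    rw [h6]
    convert ratCast_mul_pi_pow_mem 0 (i := j) (N := 2 * j) le_rfl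
      (-(4 * 2⁻¹ ^ (2 * j)) * ((2 * j).factorial * ((-1) ^ (j + 1) * 2 ^ (2 * j) / 2 / (2 * j).factorial *
        (Polynomial.bernoulli (2 * j)).eval (1 / 2)))) using 1
    push_cast
    ring

theorem hypMoment_one_succ (l : ℕ) {q : ℕ} (hq : 0 < q) :
    (q : ℝ) * hypMoment l 1 (q + 1) = l * hypMoment (l - 1) 0 q := by
  have hd : ∀ x : ℝ, HasDerivAt (fun x : ℝ => x ^ l * sinh x ^ 0 / cosh x ^ q)
      (l * (x ^ (l - 1) * sinh x ^ 0 / cosh x ^ q) -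
        q * (x ^ l * sinh x ^ 1 / cosh x ^ (q + 1))) x := by
    intro x
    have hc := cosh_pos x
    have h := (hasDerivAt_pow l x).div ((hasDerivAt_cosh x).pow q) (pow_ne_zero _ hc.ne')
    simp only [pow_zero, mul_one]
    refine h.congr_deriv ?_
    obtain ⟨t, rfl⟩ : ∃ t, q = t + 1 := ⟨q - 1, by omega⟩
    simp only [Nat.add_sub_cancel]
    simp only [Pi.pow_apply]
    field_simp
    ring
  have i1 := (integrable_hypMoment (l - 1) hq).const_mul (l : ℝ)
  have i2 := (integrable_hypMoment l (show 1 < q + 1 by omega)).const_mul (q : ℝ)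
  have := integral_eq_zero_of_hasDerivAt_of_integrable hd (i1.sub i2) (integrable_hypMoment l hq)
  rw [integral_sub i1 i2, integral_const_mul, integral_const_mul] at this
  simp only [hypMoment]
  linarith

theorem hypMoment_two_add_two (l : ℕ) {q : ℕ} (hq : 0 < q) :
    ((q : ℝ) + 1) * hypMoment l 2 (q + 2) = l * hypMoment (l - 1) 1 (q + 1) + hypMoment l 0 q := by
  have hd : ∀ x : ℝ, HasDerivAt (fun x : ℝ => x ^ l * sinh x ^ 1 / cosh x ^ (q + 1))
      (l * (x ^ (l - 1) * sinh x ^ 1 / cosh x ^ (q + 1)) + x ^ l * sinh x ^ 0 / cosh x ^ q -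
        (q + 1) * (x ^ l * sinh x ^ 2 / cosh x ^ (q + 2))) x := by
    intro x
    have hc := cosh_pos x
    have h := ((hasDerivAt_pow l x).mul (hasDerivAt_sinh x)).div
      ((hasDerivAt_cosh x).pow (q + 1)) (pow_ne_zero _ hc.ne')
    simp only [pow_zero, mul_one, pow_one]
    refine h.congr_deriv ?_
    simp only [Nat.add_sub_cancel, Pi.pow_apply, Pi.mul_apply]
    push_cast
    field_simp
    ring
  have i1 := (integrable_hypMoment (l - 1) (show 1 < q + 1 by omega)).const_mul (l : ℝ)
  have i2 := (integrable_hypMoment l (show 2 < q + 2 by omega)).const_mul ((q : ℝ) + 1)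
  have i3 := integrable_hypMoment l hq
  have := integral_eq_zero_of_hasDerivAt_of_integrable hd ((i1.add i3).sub i2)
    (integrable_hypMoment l (show 1 < q + 1 by omega))
  have e1 := integral_sub (i1.add i3) i2
  have e2 := integral_add i1 i3
  simp only [Pi.add_apply] at e1 e2
  rw [e1, e2, integral_const_mul, integral_const_mul] at this
  simp only [hypMoment]
  linarith

theorem hypMoment_add_two (l : ℕ) {p q : ℕ} (h : p < q) :
    hypMoment l (p + 2) (q + 2) = hypMoment l p q - hypMoment l p (q + 2) := by
  rw [hypMoment, hypMoment, hypMoment, ← integral_sub (integrable_hypMoment l h)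
    (integrable_hypMoment l (by omega))]
  congr 1 with x
  have hc := cosh_pos x
  rw [pow_add (sinh x), sinh_sq]
  field_simp
  ring

theorem hypMoment_zero_mem (q : ℕ) (hq : 0 < q) (j : ℕ) :
    hypMoment (2 * j) 0 q ∈ piSpan (q % 2) (2 * j) := by
  induction q using Nat.twoStepInduction generalizing j with
  | zero => exact absurd hq (lt_irrefl 0)
  | one => exact hypMoment_even_zero_one j
  | more q ih _ =>
    rcases Nat.eq_zero_or_pos q with rfl | hq
    · exact hypMoment_even_zero_two j
    · rw [Nat.add_mod_right]
      have ih := fun j => ih hq j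
      have h1 := hypMoment_add_two (2 * j) hq
      have h2 := hypMoment_two_add_two (2 * j) hq
      have h3 := hypMoment_one_succ (2 * j - 1) hq
      have hq' : (q : ℝ) ≠ 0 := by positivity
      have hq1 : (q : ℝ) + 1 ≠ 0 := by positivity
      have e : hypMoment (2 * j) 0 (q + 2) =
          (((q : ℚ) / (q + 1) : ℚ) : ℝ) * hypMoment (2 * j) 0 q -
          ((((2 * j : ℕ) : ℚ) * ((2 * j - 1 : ℕ) : ℚ) / (q * (q + 1)) : ℚ) : ℝ) *
            hypMoment (2 * (j - 1)) 0 q := by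
        rw [show 2 * (j - 1) = 2 * j - 1 - 1 by omega]
        rw [zero_add] at h1
        push_cast at h2 ⊢
        field_simp
        linear_combination (q * (q + 1) : ℝ) * h1 - q * h2 - 2 * (j : ℝ) * h3
      rw [e]
      exact sub_mem (ratCast_mul_mem _ (ih j))
        (ratCast_mul_mem _ (piSpan_mono _ (by omega) (ih (j - 1))))

theorem hypMoment_mem {l p q : ℕ} (hlp : Even (l + p)) (h : p < q) :
    hypMoment l p q ∈ piSpan ((p + q) % 2) l := by
  induction p using Nat.twoStepInduction generalizing q with
  | zero =>
    obtain ⟨j, hj⟩ := hlp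
    obtain rfl : l = 2 * j := by omega
    rw [zero_add]
    exact hypMoment_zero_mem q h j
  | one =>
    obtain ⟨q, rfl⟩ : ∃ t, q = t + 1 := ⟨q - 1, by omega⟩
    have hq : 0 < q := by omega
    have hq' : (q : ℝ) ≠ 0 := by positivity
    obtain ⟨j, hj⟩ := hlp
    have h3 := hypMoment_one_succ l hq
    have e : hypMoment l 1 (q + 1) = (((l : ℚ) / q : ℚ) : ℝ) * hypMoment (2 * (j - 1)) 0 q := by
      rw [show 2 * (j - 1) = l - 1 by omega]
      push_cast
      field_simp
      linarith
    rw [e, show (1 + (q + 1)) % 2 = q % 2 by omega]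
    exact ratCast_mul_mem _ (piSpan_mono _ (by omega) (hypMoment_zero_mem q hq (j - 1)))
  | more p ih _ =>
    obtain ⟨q, rfl⟩ : ∃ t, q = t + 2 := ⟨q - 2, by omega⟩
    have hlp' : Even (l + p) := by
      rw [← add_assoc] at hlp
      exact (Nat.even_add.1 hlp).2 even_two
    rw [hypMoment_add_two l (by omega)]
    have h1 := ih hlp' (q := q) (by omega)
    have h2 := ih hlp' (q := q + 2) (by omega)
    rw [show (p + (q + 2)) % 2 = (p + q) % 2 by omega] at h2
    rw [show (p + 2 + (q + 2)) % 2 = (p + q) % 2 by omega]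
    exact sub_mem h1 h2

/-- The primitive of `cosh ^ a` that vanishes at the origin. -/
def coshPrimitive : ℕ → ℝ → ℝ
  | 0, x => x
  | 1, x => sinh x
  | a + 2, x => ((a + 1) * coshPrimitive a x + sinh x * cosh x ^ (a + 1)) / (a + 2)

theorem coshPrimitive_zero (a : ℕ) : coshPrimitive a 0 = 0 := by
  induction a using Nat.twoStepInduction with
  | zero => rfl
  | one => simp [coshPrimitive]
  | more a ih _ => simp [coshPrimitive, ih]

theorem hasDerivAt_coshPrimitive (a : ℕ) (x : ℝ) :
    HasDerivAt (coshPrimitive a) (cosh x ^ a) x := by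
  induction a using Nat.twoStepInduction with
  | zero => simpa [coshPrimitive] using hasDerivAt_id' x
  | one => simpa [coshPrimitive] using hasDerivAt_sinh x
  | more a ih _ =>
    have h := ((ih.const_mul ((a : ℝ) + 1)).add ((hasDerivAt_sinh x).mul
      ((hasDerivAt_cosh x).pow (a + 1)))).div_const ((a : ℝ) + 2)
    refine HasDerivAt.congr_deriv (f := coshPrimitive (a + 2)) h ?_
    simp only [Nat.add_sub_cancel, Pi.pow_apply]
    push_cast
    have := sinh_sq x
    field_simp
    linear_combination ((a : ℝ) + 1) * cosh x ^ a * this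

/-- The rational span of the monomials `x^l sinh^p cosh^r` that occur in the `j`-th power of
`coshPrimitive a`. -/
def hypSpan (a j : ℕ) : Submodule ℚ (ℝ → ℝ) :=
  Submodule.span ℚ {f | ∃ l p r : ℕ, l + p = j ∧ l ≤ (a + 1) % 2 * j ∧ p + r ≤ a * j ∧
    (p + r) % 2 = (a * j) % 2 ∧ f = fun x => x ^ l * sinh x ^ p * cosh x ^ r}

theorem mul_mem_hypSpan {a j : ℕ} {f g : ℝ → ℝ} (hf : f ∈ hypSpan a j) (hg : g ∈ hypSpan a 1) :
    f * g ∈ hypSpan a (j + 1) := by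
  induction hf using Submodule.span_induction with
  | zero => rw [zero_mul]; exact zero_mem _
  | add f₁ f₂ _ _ h₁ h₂ => rw [add_mul]; exact add_mem h₁ h₂
  | smul c f _ h => rw [smul_mul_assoc]; exact Submodule.smul_mem _ c h
  | mem f hf =>
    induction hg using Submodule.span_induction with
    | zero => rw [mul_zero]; exact zero_mem _
    | add f₁ f₂ _ _ h₁ h₂ => rw [mul_add]; exact add_mem h₁ h₂
    | smul c g _ h => rw [mul_smul_comm]; exact Submodule.smul_mem _ c h
    | mem g hg =>
      obtain ⟨l, p, r, h1, h2, h3, h4, rfl⟩ := hf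
      obtain ⟨l', p', r', h1', h2', h3', h4', rfl⟩ := hg
      refine Submodule.subset_span ⟨l + l', p + p', r + r', by omega, ?_, ?_, ?_, ?_⟩
      · rw [mul_add]; omega
      · rw [mul_add]; omega
      · rw [mul_add]; omega
      · ext x
        simp only [Pi.mul_apply]
        ring

theorem hypSpan_mono_add_two (a : ℕ) : hypSpan a 1 ≤ hypSpan (a + 2) 1 := by
  refine Submodule.span_mono ?_
  rintro f ⟨l, p, r, h1, h2, h3, h4, h5⟩
  exact ⟨l, p, r, h1, by omega, by omega, by omega, h5⟩

theorem coshPrimitive_mem (a : ℕ) : coshPrimitive a ∈ hypSpan a 1 := by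
  induction a using Nat.twoStepInduction with
  | zero => exact Submodule.subset_span ⟨1, 0, 0, by simp, by simp, by simp, by simp, by ext; simp [coshPrimitive]⟩
  | one => exact Submodule.subset_span ⟨0, 1, 0, by simp, by simp, by simp, by simp, by ext; simp [coshPrimitive]⟩
  | more a ih _ =>
    have h : (fun x => x ^ 0 * sinh x ^ 1 * cosh x ^ (a + 1)) ∈ hypSpan (a + 2) 1 :=
      Submodule.subset_span ⟨0, 1, a + 1, by simp, by simp, by omega, by omega, rfl⟩
    have e : coshPrimitive (a + 2) = (((a : ℚ) + 1) / (a + 2)) • coshPrimitive a +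
        (1 / ((a : ℚ) + 2)) • fun x => x ^ 0 * sinh x ^ 1 * cosh x ^ (a + 1) := by
      ext x
      simp only [coshPrimitive, Pi.add_apply, Pi.smul_apply, Rat.smul_def]
      push_cast
      field_simp
    rw [e]
    exact add_mem (Submodule.smul_mem _ _ (hypSpan_mono_add_two a ih)) (Submodule.smul_mem _ _ h)

theorem coshPrimitive_pow_mem (a j : ℕ) : coshPrimitive a ^ j ∈ hypSpan a j := by
  induction j with
  | zero =>
    exact Submodule.subset_span ⟨0, 0, 0, by simp, by simp, by simp, by simp, by ext; simp⟩
  | succ j ih => rw [pow_succ]; exact mul_mem_hypSpan ih (coshPrimitive_mem a)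

theorem integral_mem_of_mem_hypSpan {a j q : ℕ} (hq : a * j < q) {f : ℝ → ℝ}
    (hf : f ∈ hypSpan a j) :
    Integrable (fun x => f x / cosh x ^ q) ∧
      (Even j → ∫ x, f x / cosh x ^ q ∈ piSpan (q % 2) ((a + 1) % 2 * j)) := by
  induction hf using Submodule.span_induction with
  | zero => simp
  | add f g _ _ hf hg =>
    have e : (fun x => (f + g) x / cosh x ^ q) = 
        (fun x => f x / cosh x ^ q) + fun x => g x / cosh x ^ q := by
      ext x; simp [add_div]
    rw [e]
    refine ⟨hf.1.add hg.1, fun hj => ?_⟩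
    rw [integral_add' hf.1 hg.1]
    exact add_mem (hf.2 hj) (hg.2 hj)
  | smul c f _ hf =>
    have e : (fun x => (c • f) x / cosh x ^ q) = fun x => (c : ℝ) * (f x / cosh x ^ q) := by
      ext x; simp [Rat.smul_def, mul_div_assoc]
    rw [e]
    refine ⟨hf.1.const_mul _, fun hj => ?_⟩
    rw [integral_const_mul]
    exact ratCast_mul_mem _ (hf.2 hj)
  | mem f hf =>
    obtain ⟨l, p, r, h1, h2, h3, h4, rfl⟩ := hf
    have e : (fun x => x ^ l * sinh x ^ p * cosh x ^ r / cosh x ^ q) =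
        fun x => x ^ l * sinh x ^ p / cosh x ^ (q - r) := by
      ext x
      have hc := cosh_pos x
      obtain ⟨t, rfl⟩ : ∃ t, q = t + r := ⟨q - r, by omega⟩
      rw [Nat.add_sub_cancel, pow_add]
      field_simp
    simp only [e]
    refine ⟨integrable_hypMoment l (by omega), fun hj => ?_⟩
    have h := hypMoment_mem (l := l) (p := p) (q := q - r) (by rwa [h1]) (by omega)
    have : (a * j) % 2 = 0 := Nat.even_iff.1 (hj.mul_left a)
    rw [show (p + (q - r)) % 2 = q % 2 by omega] at h
    exact piSpan_mono _ h2 h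

/-- Rational combinations of `1, π^(-2), …` with exponents at least `-N`. -/
def negPiSpan (N : ℕ) : Submodule ℚ ℝ :=
  Submodule.span ℚ {y : ℝ | ∃ i : ℕ, 2 * i ≤ N ∧ y = π ^ (-(2 * (i : ℤ)))}

theorem exists_sum_of_mem_negPiSpan {N : ℕ} {y : ℝ} (hy : y ∈ negPiSpan N) :
    ∃ q : ℕ → ℚ, y = ∑ j ∈ Finset.range (N / 2 + 1), (q j : ℝ) * π ^ (-(2 * (j : ℤ))) := by
  induction hy using Submodule.span_induction with
  | zero => exact ⟨0, by simp⟩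
  | add y z _ _ hy hz =>
    obtain ⟨q, hq⟩ := hy
    obtain ⟨r, hr⟩ := hz
    exact ⟨q + r, by rw [hq, hr, ← Finset.sum_add_distrib]; simp [add_mul]⟩
  | smul c y _ hy =>
    obtain ⟨q, hq⟩ := hy
    exact ⟨c • q, by rw [hq, Rat.smul_def, Finset.mul_sum]; simp [mul_assoc]⟩
  | mem y hy =>
    obtain ⟨i, hi, rfl⟩ := hy
    refine ⟨Pi.single i 1, ?_⟩
    rw [Finset.sum_eq_single_of_mem i (Finset.mem_range.2 (by omega))]
    · simp
    · intro j _ hj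
      simp [hj]

theorem mul_zpow_mem_negPiSpan {e N M : ℕ} (hN : Even N) (hNM : N ≤ M) {y : ℝ}
    (hy : y ∈ piSpan e N) : y * (π ^ N)⁻¹ * (π ^ e)⁻¹ ∈ negPiSpan M := by
  induction hy using Submodule.span_induction with
  | zero => simp
  | add y z _ _ hy hz => rw [add_mul, add_mul]; exact add_mem hy hz
  | smul c y _ hy => rw [smul_mul_assoc, smul_mul_assoc]; exact Submodule.smul_mem _ _ hy
  | mem y hy =>
    obtain ⟨i, hi, rfl⟩ := hy
    obtain ⟨t, rfl⟩ := hN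
    refine Submodule.subset_span ⟨t - i, by omega, ?_⟩
    obtain ⟨s, rfl⟩ : ∃ s, t = i + s := ⟨t - i, by omega⟩
    have hpi := pi_pos
    rw [Nat.add_sub_cancel_left, zpow_neg, show (2 * (s : ℤ)) = ((2 * s : ℕ) : ℤ) by push_cast; rfl,
      zpow_natCast]
    field_simp
    ring

theorem exists_integral_inv_cosh {q : ℕ} (hq : 0 < q) :
    ∃ z : ℚ, z ≠ 0 ∧ ∫ x : ℝ, (cosh x ^ q)⁻¹ = z * π ^ (q % 2) := by
  have h := hypMoment_mem (l := 0) (p := 0) (q := q) (by simp) hq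
  have e : hypMoment 0 0 q = ∫ x : ℝ, (cosh x ^ q)⁻¹ := by simp [hypMoment]
  have hpos : 0 < ∫ x : ℝ, (cosh x ^ q)⁻¹ := by
    have hi := integrable_hypMoment 0 hq
    simp only [pow_zero, mul_one, one_div] at hi
    rw [integral_pos_iff_support_of_nonneg (fun x => by have := cosh_pos x; positivity) hi]
    have : Function.support (fun x : ℝ => (cosh x ^ q)⁻¹) = Set.univ := by
      ext x; simp [(cosh_pos x).ne']
    simp [this]
  have hset : {y : ℝ | ∃ i : ℕ, 2 * i ≤ 0 ∧ y = π ^ (2 * i + (0 + q) % 2)} = {π ^ (q % 2)} := by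
    ext y; simp
  rw [e, piSpan, hset, Submodule.mem_span_singleton] at h
  obtain ⟨z, hz⟩ := h
  rw [Rat.smul_def] at hz
  refine ⟨z, ?_, hz.symm⟩
  rintro rfl
  rw [Rat.cast_zero, zero_mul] at hz
  exact hpos.ne hz

theorem re_integral_mem {a n N : ℕ} (hn : 2 ≤ n) (hN : N < n) {γ : ℝ} {g : ℚ}
    (hg : γ * π ^ ((a + 1) % 2) = g) {J : ℝ}
    (hJ : (J * ∫ x : ℝ, (cosh x ^ ((a + 1) * n - 1))⁻¹ : ℂ) =
      ∫ x : ℝ, (1 / 2 + Complex.I * (γ * coshPrimitive a x : ℝ)) ^ N *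
        ((cosh x ^ ((a + 1) * n - 1))⁻¹ : ℝ)) :
    J ∈ negPiSpan ((a + 1) % 2 * N) := by
  set q := (a + 1) * n - 1 with hq
  have hq0 : 0 < q := by
    have : 1 * 2 ≤ (a + 1) * n := Nat.mul_le_mul (by omega) hn
    omega
  have hjq : ∀ j ∈ Finset.range (N + 1), a * j < q := by
    intro j hj
    have h1 : j ≤ n - 1 := by have := Finset.mem_range.1 hj; omega
    have h2 : a * j ≤ a * (n - 1) := Nat.mul_le_mul_left _ h1
    have h3 : (a + 1) * n = a * (n - 1) + a + n := by
      obtain ⟨t, rfl⟩ : ∃ t, n = t + 1 := ⟨n - 1, by omega⟩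
      rw [Nat.add_sub_cancel]; ring
    omega
  obtain ⟨z, hz0, hz⟩ := exists_integral_inv_cosh hq0
  set ε := (a + 1) % 2 with hε
  have key : ∀ x : ℝ, (1 / 2 + Complex.I * (γ * coshPrimitive a x : ℝ)) ^ N * ((cosh x ^ q)⁻¹ : ℝ) =
      ∑ j ∈ Finset.range (N + 1), (Complex.I ^ j * (γ ^ j * (N.choose j * (1 / 2) ^ (N - j)) : ℝ)) *
        (((coshPrimitive a ^ j) x / cosh x ^ q : ℝ) : ℂ) := by
    intro x
    rw [add_comm, add_pow, Finset.sum_mul]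
    refine Finset.sum_congr rfl fun j _ => ?_
    push_cast [Pi.pow_apply]
    ring
  have hint := fun j hj => integral_mem_of_mem_hypSpan (hjq j hj) (coshPrimitive_pow_mem a j)
  simp only [key] at hJ
  rw [integral_finsetSum _ fun j hj => ((hint j hj).1.ofReal).const_mul _] at hJ
  simp only [integral_const_mul, integral_complex_ofReal] at hJ
  have hre := congrArg Complex.re hJ
  rw [← Complex.ofReal_mul, Complex.ofReal_re, hz, Complex.re_sum] at hre
  have hpi := pi_pos
  have hγ : γ = g * (π ^ ε)⁻¹ := by rw [← hg]; field_simp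
  have hzr : (z : ℝ) ≠ 0 := by exact_mod_cast hz0
  have hJ' : J = ∑ j ∈ Finset.range (N + 1), (Complex.I ^ j).re *
      (((g ^ j * (N.choose j * (1 / 2) ^ (N - j)) * z⁻¹ : ℚ) : ℝ) *
        ((∫ x, (coshPrimitive a ^ j) x / cosh x ^ q) * (π ^ (ε * j))⁻¹ * (π ^ (q % 2))⁻¹)) := by
    have : J = J * (z * π ^ (q % 2)) * ((z : ℝ)⁻¹ * (π ^ (q % 2))⁻¹) := by field_simp
    rw [this, hre, Finset.sum_mul]
    refine Finset.sum_congr rfl fun j _ => ?_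
    rw [Complex.re_mul_ofReal, Complex.re_mul_ofReal, hγ, mul_pow, inv_pow, ← pow_mul]
    push_cast
    ring
  rw [hJ']
  refine sum_mem fun j hj => ?_
  have hjN : j ≤ N := by have := Finset.mem_range.1 hj; omega
  rcases Nat.even_or_odd j with he | ho
  · obtain ⟨t, rfl⟩ := he
    have : (Complex.I ^ (t + t)).re = (((-1) ^ t : ℚ) : ℝ) := by
      rw [← two_mul, pow_mul, Complex.I_sq]
      have : ((-1 : ℂ)) ^ t = (((-1) ^ t : ℝ) : ℂ) := by push_cast; rfl
      rw [this, Complex.ofReal_re]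
      push_cast; rfl
    rw [this]
    refine ratCast_mul_mem _ (ratCast_mul_mem _ ?_)
    exact mul_zpow_mem_negPiSpan ((Even.add_self t).mul_left _)
      (Nat.mul_le_mul_left _ hjN) ((hint _ hj).2 (Even.add_self t))
  · obtain ⟨t, rfl⟩ := ho
    have : (Complex.I ^ (2 * t + 1)).re = 0 := by
      rw [pow_succ, pow_mul, Complex.I_sq]
      have : ((-1 : ℂ)) ^ t = (((-1) ^ t : ℝ) : ℂ) := by push_cast; rfl
      rw [this, Complex.re_ofReal_mul, Complex.I_re, mul_zero]
    rw [this, zero_mul]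
    exact zero_mem _

/-- The moments `∫_0^∞ r^a e^{-r²/2} dr` of the half-line Gaussian. -/
def gaussMoment (a : ℕ) : ℝ := ∫ r in Set.Ioi (0 : ℝ), r ^ a * exp (-r ^ 2 / 2)

theorem integrable_rpow_mul_gauss {s : ℝ} (hs : -1 < s) :
    IntegrableOn (fun r : ℝ => r ^ s * exp (-r ^ 2 / 2)) (Set.Ioi 0) := by
  refine (integrableOn_rpow_mul_exp_neg_mul_sq (b := 1 / 2) (by norm_num) hs).congr_fun
    (fun r _ => ?_) measurableSet_Ioi
  simp only
  congr 2; ring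

theorem integrable_pow_mul_gauss (a : ℕ) :
    IntegrableOn (fun r : ℝ => r ^ a * exp (-r ^ 2 / 2)) (Set.Ioi 0) := by
  simpa only [rpow_natCast] using integrable_rpow_mul_gauss (s := a)
    (by have : (0 : ℝ) ≤ a := by positivity
        linarith)

theorem tendsto_pow_mul_gauss (a : ℕ) :
    Filter.Tendsto (fun r : ℝ => r ^ a * exp (-r ^ 2 / 2)) Filter.atTop (nhds 0) := by
  have h := (tendsto_rpow_abs_mul_exp_neg_mul_sq_cocompact (a := 1 / 2) (by norm_num) a).mono_left
    atTop_le_cocompact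
  refine h.congr' ?_
  filter_upwards [Filter.eventually_ge_atTop 0] with r hr
  rw [abs_of_nonneg hr, rpow_natCast]
  congr 2; ring

theorem hasDerivAt_gauss (r : ℝ) :
    HasDerivAt (fun r : ℝ => exp (-r ^ 2 / 2)) (-r * exp (-r ^ 2 / 2)) r := by
  have h := (((hasDerivAt_pow 2 r).neg.div_const 2).exp)
  refine HasDerivAt.congr_deriv (f := fun r : ℝ => exp (-r ^ 2 / 2)) h ?_
  simp only [Pi.neg_apply]
  push_cast
  ring

theorem gaussMoment_pos (a : ℕ) : 0 < gaussMoment a := by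
  rw [gaussMoment, setIntegral_pos_iff_support_of_nonneg_ae _ (integrable_pow_mul_gauss a)]
  · have : Set.Ioi (0 : ℝ) ⊆ Function.support (fun r : ℝ => r ^ a * exp (-r ^ 2 / 2)) := by
      intro r hr
      have : (0 : ℝ) < r := hr
      simp [this.ne', exp_ne_zero]
    rw [Set.inter_eq_right.2 this]
    simp
  · filter_upwards [ae_restrict_mem measurableSet_Ioi] with r hr
    have : (0 : ℝ) < r := hr
    simp only [Pi.zero_apply]
    positivity

theorem gaussMoment_zero : gaussMoment 0 = √(2 * π) / 2 := by
  have h := integral_gaussian_Ioi (1 / 2)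
  rw [gaussMoment]
  rw [show √(2 * π) = √(π / (1 / 2)) by congr 1; ring, ← h]
  congr 1 with r
  rw [pow_zero, one_mul]
  congr 1; ring

theorem gaussMoment_one : gaussMoment 1 = 1 := by
  have hd : ∀ r ∈ Set.Ioi (0 : ℝ), HasDerivAt (fun r : ℝ => -exp (-r ^ 2 / 2))
      (r ^ 1 * exp (-r ^ 2 / 2)) r := by
    intro r _
    refine (hasDerivAt_gauss r).neg.congr_deriv ?_
    ring
  have h := integral_Ioi_of_hasDerivAt_of_tendsto (m := 0) (by fun_prop) hd
    (integrable_pow_mul_gauss 1) (by simpa using (tendsto_pow_mul_gauss 0).neg)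
  rw [gaussMoment, h]
  simp

theorem gaussMoment_add_two (a : ℕ) : gaussMoment (a + 2) = (a + 1) * gaussMoment a := by
  have hd : ∀ r ∈ Set.Ioi (0 : ℝ), HasDerivAt (fun r : ℝ => r ^ (a + 1) * exp (-r ^ 2 / 2))
      ((a + 1) * (r ^ a * exp (-r ^ 2 / 2)) - r ^ (a + 2) * exp (-r ^ 2 / 2)) r := by
    intro r _
    refine ((hasDerivAt_pow (a + 1) r).mul (hasDerivAt_gauss r)).congr_deriv ?_
    rw [Nat.add_sub_cancel]
    push_cast
    ring
  have i1 := (integrable_pow_mul_gauss a).const_mul ((a : ℝ) + 1)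
  have i2 := integrable_pow_mul_gauss (a + 2)
  have h := integral_Ioi_of_hasDerivAt_of_tendsto (m := 0) (by fun_prop) hd
    (Integrable.sub i1 i2) (tendsto_pow_mul_gauss (a + 1))
  rw [integral_sub i1 i2, integral_const_mul] at h
  simp only [ne_eq, Nat.add_eq_zero_iff, one_ne_zero, and_false, not_false_eq_true, zero_pow,
    zero_mul, sub_zero] at h
  simp only [gaussMoment]
  linarith

/-- The constant `c_{a+1} / (√(2π) c_a)` in terms of Gaussian moments. -/
def momentRatio (a : ℕ) : ℝ := gaussMoment (a + 1) / (√(2 * π) * gaussMoment a)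

theorem exists_momentRatio (a : ℕ) : ∃ g : ℚ, momentRatio a * π ^ ((a + 1) % 2) = g := by
  have hs : √(2 * π) * √(2 * π) = 2 * π := mul_self_sqrt (by have := pi_pos; positivity)
  have hs0 : 0 < √(2 * π) := sqrt_pos.2 (by have := pi_pos; positivity)
  have hpi := pi_pos
  induction a using Nat.twoStepInduction with
  | zero =>
    refine ⟨1, ?_⟩
    rw [momentRatio, zero_add, gaussMoment_one, gaussMoment_zero]
    rw [← mul_div_assoc, hs]
    simp
  | one =>
    refine ⟨1 / 2, ?_⟩
    rw [momentRatio, gaussMoment_one, show 1 + 1 = 0 + 2 from rfl, gaussMoment_add_two,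
      gaussMoment_zero]
    simp
    field_simp
  | more a ih _ =>
    obtain ⟨g, hg⟩ := ih
    refine ⟨g * ((a + 2) / (a + 1)), ?_⟩
    rw [show (a + 2 + 1) % 2 = (a + 1) % 2 by omega]
    push_cast
    rw [← hg, momentRatio, momentRatio, show a + 2 + 1 = (a + 1) + 2 by omega,
      gaussMoment_add_two, gaussMoment_add_two]
    have := gaussMoment_pos a
    push_cast
    field_simp
    ring

/-- The Fourier transform of the half-line Gaussian. -/
def halfGauss (s : ℝ) : ℂ :=
  ∫ g in Set.Ioi (0 : ℝ), (exp (-g ^ 2 / 2) : ℂ) * Complex.exp ((s * g : ℝ) * Complex.I)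

theorem hasDerivAt_wave (c s : ℝ) :
    HasDerivAt (fun s : ℝ => Complex.exp ((s * c : ℝ) * Complex.I))
      (c * Complex.I * Complex.exp ((s * c : ℝ) * Complex.I)) s := by
  have h := (((hasDerivAt_mul_const (x := s) c).ofReal_comp.mul_const Complex.I).cexp)
  exact h.congr_deriv (by ring)

theorem integrable_pow_mul_gauss_mul_wave (a : ℕ) (s : ℝ) :
    IntegrableOn (fun g : ℝ => ((g ^ a * exp (-g ^ 2 / 2) : ℝ) : ℂ) *
      Complex.exp ((s * g : ℝ) * Complex.I)) (Set.Ioi 0) := by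
  refine ((integrable_pow_mul_gauss a).ofReal (𝕜 := ℂ)).mul_bdd (c := 1) ?_ ?_
  · exact (by fun_prop : Continuous fun g : ℝ =>
      Complex.exp ((s * g : ℝ) * Complex.I)).aestronglyMeasurable
  · exact Filter.Eventually.of_forall fun g => (Complex.norm_exp_ofReal_mul_I _).le

theorem norm_integral_pow_mul_gauss_mul_wave_le (a : ℕ) (s : ℝ) :
    ‖∫ g in Set.Ioi (0 : ℝ), ((g ^ a * exp (-g ^ 2 / 2) : ℝ) : ℂ) *
      Complex.exp ((s * g : ℝ) * Complex.I)‖ ≤ gaussMoment a := by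
  refine (norm_integral_le_integral_norm _).trans (le_of_eq ?_)
  refine setIntegral_congr_fun measurableSet_Ioi fun g hg => ?_
  have : (0 : ℝ) < g := hg
  rw [norm_mul, Complex.norm_exp_ofReal_mul_I, mul_one, Complex.norm_real, norm_of_nonneg]
  positivity

theorem hasDerivAt_halfGauss_aux (s : ℝ) : HasDerivAt halfGauss
    (∫ g in Set.Ioi (0 : ℝ), ((g ^ 1 * exp (-g ^ 2 / 2) : ℝ) : ℂ) *
      Complex.exp ((s * g : ℝ) * Complex.I) * Complex.I) s := by
  have hint := integrable_pow_mul_gauss_mul_wave 0 s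
  simp only [pow_zero, one_mul] at hint
  refine (hasDerivAt_integral_of_dominated_loc_of_deriv_le (μ := volume.restrict (Set.Ioi (0 : ℝ)))
    (F := fun s g => (exp (-g ^ 2 / 2) : ℂ) * Complex.exp ((s * g : ℝ) * Complex.I))
    (F' := fun s g => ((g ^ 1 * exp (-g ^ 2 / 2) : ℝ) : ℂ) *
      Complex.exp ((s * g : ℝ) * Complex.I) * Complex.I)
    (bound := fun g => g ^ 1 * exp (-g ^ 2 / 2)) (Filter.univ_mem) ?_ hint ?_ ?_
    (integrable_pow_mul_gauss 1) ?_).2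
  · exact Filter.Eventually.of_forall fun s => (by fun_prop : Continuous _).aestronglyMeasurable
  · exact (by fun_prop : Continuous _).aestronglyMeasurable
  · filter_upwards [ae_restrict_mem measurableSet_Ioi] with g hg s _
    have : (0 : ℝ) < g := hg
    rw [norm_mul, norm_mul, Complex.norm_exp_ofReal_mul_I, mul_one, Complex.norm_I, mul_one,
      Complex.norm_real, norm_of_nonneg (by positivity)]
  · refine Filter.Eventually.of_forall fun g s _ => ?_
    refine ((hasDerivAt_wave g s).const_mul _).congr_deriv ?_
    push_cast
    ring

theorem integral_mul_gauss_mul_wave (s : ℝ) :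
    ∫ g in Set.Ioi (0 : ℝ), ((g ^ 1 * exp (-g ^ 2 / 2) : ℝ) : ℂ) *
      Complex.exp ((s * g : ℝ) * Complex.I) = 1 + Complex.I * s * halfGauss s := by
  have hd : ∀ g ∈ Set.Ioi (0 : ℝ), HasDerivAt
      (fun g : ℝ => (exp (-g ^ 2 / 2) : ℂ) * Complex.exp ((g * s : ℝ) * Complex.I))
      (Complex.I * s * ((exp (-g ^ 2 / 2) : ℂ) * Complex.exp ((s * g : ℝ) * Complex.I)) -
        ((g ^ 1 * exp (-g ^ 2 / 2) : ℝ) : ℂ) * Complex.exp ((s * g : ℝ) * Complex.I)) g := by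
    intro g _
    refine ((hasDerivAt_gauss g).ofReal_comp.mul (hasDerivAt_wave s g)).congr_deriv ?_
    rw [mul_comm g s]
    push_cast
    ring
  have i0 := integrable_pow_mul_gauss_mul_wave 0 s
  simp only [pow_zero, one_mul] at i0
  have i1 := i0.const_mul (Complex.I * s)
  have i2 := integrable_pow_mul_gauss_mul_wave 1 s
  have ht : Filter.Tendsto (fun g : ℝ => (exp (-g ^ 2 / 2) : ℂ) *
      Complex.exp ((g * s : ℝ) * Complex.I)) Filter.atTop (nhds 0) := by
    rw [tendsto_zero_iff_norm_tendsto_zero]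
    have := tendsto_pow_mul_gauss 0
    refine this.congr fun g => ?_
    rw [norm_mul, Complex.norm_exp_ofReal_mul_I, mul_one, Complex.norm_real,
      norm_of_nonneg (exp_pos _).le, pow_zero, one_mul]
  have h := integral_Ioi_of_hasDerivAt_of_tendsto (m := 0)
    (by fun_prop) hd (Integrable.sub i1 i2) ht
  rw [integral_sub i1 i2, integral_const_mul] at h
  simp only [ne_eq, OfNat.ofNat_ne_zero, not_false_eq_true, zero_pow, neg_zero, zero_div, exp_zero,
    Complex.ofReal_one, zero_mul, Complex.ofReal_zero, Complex.exp_zero, mul_one, zero_sub] at h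
  rw [halfGauss]
  linear_combination -h

theorem hasDerivAt_halfGauss (s : ℝ) :
    HasDerivAt halfGauss (Complex.I - s * halfGauss s) s := by
  refine (hasDerivAt_halfGauss_aux s).congr_deriv ?_
  rw [integral_mul_const, integral_mul_gauss_mul_wave]
  linear_combination (s * halfGauss s) * Complex.I_sq

theorem norm_halfGauss_le (s : ℝ) : ‖halfGauss s‖ ≤ gaussMoment 0 := by
  simpa [halfGauss] using norm_integral_pow_mul_gauss_mul_wave_le 0 s

theorem norm_halfGauss_deriv_le (s : ℝ) : ‖Complex.I - s * halfGauss s‖ ≤ 1 := by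
  have h : Complex.I - s * halfGauss s = Complex.I * (1 + Complex.I * s * halfGauss s) := by
    linear_combination (-(s * halfGauss s)) * Complex.I_sq
  rw [h, norm_mul, Complex.norm_I, one_mul, ← integral_mul_gauss_mul_wave, ← gaussMoment_one]
  exact norm_integral_pow_mul_gauss_mul_wave_le 1 s

theorem abs_mul_norm_halfGauss_le (s : ℝ) : |s| * ‖halfGauss s‖ ≤ 2 := by
  have h : (s : ℂ) * halfGauss s = Complex.I - (Complex.I - s * halfGauss s) := by ring
  have := norm_sub_le Complex.I (Complex.I - s * halfGauss s)
  rw [← h, Complex.norm_I, norm_mul, Complex.norm_real, Real.norm_eq_abs] at this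
  linarith [norm_halfGauss_deriv_le s]

theorem continuous_halfGauss : Continuous halfGauss :=
  continuous_iff_continuousAt.2 fun s => (hasDerivAt_halfGauss s).continuousAt

theorem halfGauss_zero : halfGauss 0 = gaussMoment 0 := by
  simp only [halfGauss, zero_mul, Complex.ofReal_zero, Complex.exp_zero, mul_one]
  rw [integral_complex_ofReal, gaussMoment]
  simp

/-- The transform `y ↦ ∫_0^∞ r^a e^{-r²/2} φ(y r) dr` of the half-line Gaussian transform `φ`. -/
def halfGaussMoment (a : ℕ) (y : ℝ) : ℂ :=
  ∫ r in Set.Ioi (0 : ℝ), ((r ^ a * exp (-r ^ 2 / 2) : ℝ) : ℂ) * halfGauss (y * r)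

theorem integrable_pow_mul_gauss_mul_bdd (a : ℕ) {f : ℝ → ℂ} (hf : Continuous f) {C : ℝ}
    (hC : ∀ r, ‖f r‖ ≤ C) :
    IntegrableOn (fun r : ℝ => ((r ^ a * exp (-r ^ 2 / 2) : ℝ) : ℂ) * f r) (Set.Ioi 0) :=
  ((integrable_pow_mul_gauss a).ofReal (𝕜 := ℂ)).mul_bdd (c := C) hf.aestronglyMeasurable
    (Filter.Eventually.of_forall hC)

theorem hasDerivAt_halfGaussMoment_aux (a : ℕ) (y : ℝ) : HasDerivAt (halfGaussMoment a)
    (∫ r in Set.Ioi (0 : ℝ), ((r ^ (a + 1) * exp (-r ^ 2 / 2) : ℝ) : ℂ) *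
      (Complex.I - (y * r : ℝ) * halfGauss (y * r))) y := by
  have hc := continuous_halfGauss
  refine (hasDerivAt_integral_of_dominated_loc_of_deriv_le (μ := volume.restrict (Set.Ioi (0 : ℝ)))
    (F := fun y r => ((r ^ a * exp (-r ^ 2 / 2) : ℝ) : ℂ) * halfGauss (y * r))
    (F' := fun y r => ((r ^ (a + 1) * exp (-r ^ 2 / 2) : ℝ) : ℂ) *
      (Complex.I - (y * r : ℝ) * halfGauss (y * r)))
    (bound := fun r => r ^ (a + 1) * exp (-r ^ 2 / 2)) (Filter.univ_mem) ?_
    (integrable_pow_mul_gauss_mul_bdd a (by fun_prop) fun r => norm_halfGauss_le _) ?_ ?_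
    (integrable_pow_mul_gauss (a + 1)) ?_).2
  · exact Filter.Eventually.of_forall fun s => (by fun_prop : Continuous _).aestronglyMeasurable
  · exact (by fun_prop : Continuous _).aestronglyMeasurable
  · filter_upwards [ae_restrict_mem measurableSet_Ioi] with r hr y _
    have : (0 : ℝ) < r := hr
    rw [norm_mul, Complex.norm_real, norm_of_nonneg (by positivity)]
    exact mul_le_of_le_one_right (by positivity) (norm_halfGauss_deriv_le _)
  · refine Filter.Eventually.of_forall fun r y _ => ?_
    have h := ((hasDerivAt_halfGauss (y * r)).scomp y (hasDerivAt_mul_const (x := y) r)).const_mul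
      ((r ^ a * exp (-r ^ 2 / 2) : ℝ) : ℂ)
    refine HasDerivAt.congr_deriv h ?_
    rw [Complex.real_smul]
    push_cast
    ring

theorem halfGaussMoment_byParts (a : ℕ) (y : ℝ) :
    ∫ r in Set.Ioi (0 : ℝ), ((r ^ (a + 2) * exp (-r ^ 2 / 2) : ℝ) : ℂ) * halfGauss (y * r) =
      (a + 1) * halfGaussMoment a y + y * ∫ r in Set.Ioi (0 : ℝ),
        ((r ^ (a + 1) * exp (-r ^ 2 / 2) : ℝ) : ℂ) *
          (Complex.I - (y * r : ℝ) * halfGauss (y * r)) := by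
  have hc := continuous_halfGauss
  have hd : ∀ r ∈ Set.Ioi (0 : ℝ), HasDerivAt
      (fun r : ℝ => ((r ^ (a + 1) * exp (-r ^ 2 / 2) : ℝ) : ℂ) * halfGauss (y * r))
      ((a + 1) * (((r ^ a * exp (-r ^ 2 / 2) : ℝ) : ℂ) * halfGauss (y * r)) +
        y * (((r ^ (a + 1) * exp (-r ^ 2 / 2) : ℝ) : ℂ) *
          (Complex.I - (y * r : ℝ) * halfGauss (y * r))) -
        ((r ^ (a + 2) * exp (-r ^ 2 / 2) : ℝ) : ℂ) * halfGauss (y * r)) r := by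
    intro r _
    have h := (((hasDerivAt_pow (a + 1) r).mul (hasDerivAt_gauss r)).ofReal_comp).mul
      ((hasDerivAt_halfGauss (y * r)).scomp r (hasDerivAt_const_mul (x := r) y))
    refine HasDerivAt.congr_deriv h ?_
    rw [Complex.real_smul, Nat.add_sub_cancel]
    simp only [Pi.mul_apply, Function.comp_apply]
    push_cast
    ring
  have i0 := (integrable_pow_mul_gauss_mul_bdd a (f := fun r => halfGauss (y * r)) (by fun_prop)
    fun r => norm_halfGauss_le _)
  have i1 := (integrable_pow_mul_gauss_mul_bdd (a + 1)
    (f := fun r => Complex.I - (y * r : ℝ) * halfGauss (y * r)) (by fun_prop)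
    fun r => norm_halfGauss_deriv_le _)
  have i2 := (integrable_pow_mul_gauss_mul_bdd (a + 2) (f := fun r => halfGauss (y * r))
    (by fun_prop) fun r => norm_halfGauss_le _)
  have i0' := i0.const_mul ((a : ℂ) + 1)
  have i1' := i1.const_mul (y : ℂ)
  have ht : Filter.Tendsto (fun r : ℝ => ((r ^ (a + 1) * exp (-r ^ 2 / 2) : ℝ) : ℂ) *
      halfGauss (y * r)) Filter.atTop (nhds 0) := by
    have h := (tendsto_pow_mul_gauss (a + 1)).mul_const (gaussMoment 0)
    rw [zero_mul] at h
    refine squeeze_zero_norm' ?_ h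
    filter_upwards [Filter.eventually_ge_atTop 0] with r hr
    rw [norm_mul, Complex.norm_real, norm_of_nonneg (by positivity)]
    gcongr
    exact norm_halfGauss_le _
  have h := integral_Ioi_of_hasDerivAt_of_tendsto (m := 0)
    (by fun_prop) hd ((Integrable.add i0' i1').sub i2) ht
  have e1 := integral_sub (Integrable.add i0' i1') i2
  have e2 := integral_add i0' i1'
  simp only [Pi.add_apply] at e1 e2
  rw [e1, e2, integral_const_mul, integral_const_mul] at h
  simp only [ne_eq, Nat.add_eq_zero_iff, one_ne_zero, and_false, not_false_eq_true, zero_pow,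
    zero_mul, sub_zero, Complex.ofReal_zero] at h
  rw [halfGaussMoment]
  linear_combination -h

theorem exists_hasDerivAt_halfGaussMoment (a : ℕ) (y : ℝ) :
    ∃ d : ℂ, HasDerivAt (halfGaussMoment a) d y ∧
      (1 + y ^ 2) * d + (a + 1) * y * halfGaussMoment a y = Complex.I * gaussMoment (a + 1) := by
  refine ⟨_, hasDerivAt_halfGaussMoment_aux a y, ?_⟩
  have hc := continuous_halfGauss
  have h1 := halfGaussMoment_byParts a y
  have i0 := (integrable_pow_mul_gauss (a + 1)).ofReal (𝕜 := ℂ)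
  have i2 := (integrable_pow_mul_gauss_mul_bdd (a + 2) (f := fun r => halfGauss (y * r))
    (by fun_prop) fun r => norm_halfGauss_le _)
  have h2 : ∫ r in Set.Ioi (0 : ℝ), ((r ^ (a + 1) * exp (-r ^ 2 / 2) : ℝ) : ℂ) *
          (Complex.I - (y * r : ℝ) * halfGauss (y * r)) =
      Complex.I * gaussMoment (a + 1) - y * ∫ r in Set.Ioi (0 : ℝ),
        ((r ^ (a + 2) * exp (-r ^ 2 / 2) : ℝ) : ℂ) * halfGauss (y * r) := by
    have e := integral_sub (i0.const_mul Complex.I) (Integrable.const_mul i2 (y : ℂ))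
    rw [integral_const_mul, integral_const_mul] at e
    rw [gaussMoment, ← integral_complex_ofReal]
    refine Eq.trans ?_ e
    congr 1 with r
    simp only [Complex.coe_algebraMap]
    push_cast
    ring
  rw [h1] at h2
  linear_combination h2

theorem halfGaussMoment_zero (a : ℕ) :
    halfGaussMoment a 0 = gaussMoment a * gaussMoment 0 := by
  simp only [halfGaussMoment, zero_mul, halfGauss_zero]
  rw [integral_mul_const, integral_complex_ofReal]
  rfl

theorem halfGaussMoment_sinh (a : ℕ) (x : ℝ) :
    halfGaussMoment a (sinh x) = (√(2 * π) * (gaussMoment a * (cosh x ^ (a + 1))⁻¹) : ℝ) *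
      (1 / 2 + Complex.I * (momentRatio a * coshPrimitive a x : ℝ)) := by
  have key : ∀ x : ℝ, HasDerivAt (fun x : ℝ => ((cosh x ^ (a + 1) : ℝ) : ℂ) *
      halfGaussMoment a (sinh x) - Complex.I * gaussMoment (a + 1) * (coshPrimitive a x : ℂ)) 0 x := by
    intro x
    obtain ⟨d, hd, he⟩ := exists_hasDerivAt_halfGaussMoment a (sinh x)
    have h := ((((hasDerivAt_cosh x).pow (a + 1)).ofReal_comp).mul
      (hd.scomp x (hasDerivAt_sinh x))).sub
      (((hasDerivAt_coshPrimitive a x).ofReal_comp).const_mul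
        (Complex.I * gaussMoment (a + 1)))
    refine HasDerivAt.congr_deriv h ?_
    rw [Complex.real_smul, Nat.add_sub_cancel]
    have hs : ((cosh x : ℝ) : ℂ) ^ 2 = 1 + ((sinh x : ℝ) : ℂ) ^ 2 := by
      rw [← Complex.ofReal_pow, cosh_sq]
      push_cast; ring
    simp only [Function.comp_apply, Pi.pow_apply, Complex.ofReal_pow, Complex.ofReal_mul,
      Complex.ofReal_natCast]
    push_cast only [Nat.cast_add, Nat.cast_one] at *
    linear_combination ((cosh x : ℝ) : ℂ) ^ a * he + ((cosh x : ℝ) : ℂ) ^ a * d * hs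
  have hconst := is_const_of_deriv_eq_zero (fun x => (key x).differentiableAt)
    (fun x => (key x).deriv) x 0
  simp only [cosh_zero, sinh_zero, one_pow, halfGaussMoment_zero, coshPrimitive_zero,
    Complex.ofReal_one, Complex.ofReal_zero, one_mul, mul_zero, sub_zero] at hconst
  have hpi := pi_pos
  have hs0 : (√(2 * π) : ℂ) ≠ 0 := by exact_mod_cast (sqrt_pos.2 (by positivity)).ne'
  have hc : ((cosh x : ℝ) : ℂ) ≠ 0 := by exact_mod_cast (cosh_pos x).ne'
  have hg : ((gaussMoment a : ℝ) : ℂ) ≠ 0 := by exact_mod_cast (gaussMoment_pos a).ne'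
  have h3 : halfGaussMoment a (sinh x) = ((cosh x ^ (a + 1) : ℝ) : ℂ)⁻¹ *
      (Complex.I * gaussMoment (a + 1) * (coshPrimitive a x : ℂ) +
        gaussMoment a * gaussMoment 0) := by
    rw [← hconst]
    have : ((cosh x ^ (a + 1) : ℝ) : ℂ) ≠ 0 := by
      exact_mod_cast (pow_pos (cosh_pos x) _).ne'
    rw [add_sub_cancel, inv_mul_cancel_left₀ this]
  rw [h3, momentRatio, gaussMoment_zero]
  simp only [Complex.ofReal_mul, Complex.ofReal_div, Complex.ofReal_inv, Complex.ofReal_pow, Complex.ofReal_ofNat]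
  have hc1 : ((cosh x : ℝ) : ℂ) ^ (a + 1) ≠ 0 := pow_ne_zero _ hc
  generalize ((cosh x : ℝ) : ℂ) ^ (a + 1) = c at *
  field_simp
  ring

theorem integral_gauss_mul_wave {b : ℝ} (hb : 0 < b) (s : ℝ) :
    ∫ y : ℝ, (exp (-(y * b) ^ 2 / 2) : ℂ) * Complex.exp ((y * s : ℝ) * Complex.I) =
      (√(2 * π) * b⁻¹ * exp (-s ^ 2 / (2 * b ^ 2)) : ℝ) := by
  have hpi := pi_pos
  have h := fourierIntegral_gaussian (b := ((b ^ 2 / 2 : ℝ) : ℂ)) (by rw [Complex.ofReal_re]; positivity) s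
  have e1 : ∀ y : ℝ, Complex.exp (Complex.I * s * y) * Complex.exp (-((b ^ 2 / 2 : ℝ) : ℂ) * y ^ 2) =
      (exp (-(y * b) ^ 2 / 2) : ℂ) * Complex.exp ((y * s : ℝ) * Complex.I) := by
    intro y
    rw [mul_comm, Complex.ofReal_exp]
    congr 2
    · push_cast; ring
    · push_cast; ring
  simp only [e1] at h
  rw [h, ← Complex.ofReal_div, show (1 / 2 : ℂ) = ((1 / 2 : ℝ) : ℂ) by push_cast; rfl,
    ← Complex.ofReal_cpow (by positivity), ← Real.sqrt_eq_rpow,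
    show π / (b ^ 2 / 2) = 2 * π / b ^ 2 by field_simp, Real.sqrt_div (by positivity),
    Real.sqrt_sq hb.le]
  have : -(s : ℂ) ^ 2 / (4 * ((b ^ 2 / 2 : ℝ) : ℂ)) = ((-s ^ 2 / (2 * b ^ 2) : ℝ) : ℂ) := by
    push_cast
    have : (b : ℂ) ≠ 0 := by exact_mod_cast hb.ne'
    field_simp
    ring
  rw [this, ← Complex.ofReal_exp, ← Complex.ofReal_mul]
  congr 1

/-- The `j`-th factor of the cone of directions at the face spanned by the first `k` vertices. -/
def coneSide (k : ℕ) {m : ℕ} (j : Fin m) : Set ℝ := if k ≤ (j : ℕ) + 1 then Set.Ici 0 else Set.univ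

/-- The Fourier transform of the Gaussian on `coneSide k j`. -/
def sideGauss (k : ℕ) {m : ℕ} (j : Fin m) (s : ℝ) : ℂ :=
  if k ≤ (j : ℕ) + 1 then halfGauss s else (√(2 * π) * exp (-s ^ 2 / 2) : ℝ)

theorem integral_coneSide (k : ℕ) {m : ℕ} (j : Fin m) (s : ℝ) :
    ∫ g in coneSide k j, (exp (-g ^ 2 / 2) : ℂ) * Complex.exp ((s * g : ℝ) * Complex.I) =
      sideGauss k j s := by
  rw [coneSide, sideGauss]
  split_ifs
  · rw [integral_Ici_eq_integral_Ioi, halfGauss]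
  · rw [setIntegral_univ]
    have := integral_gauss_mul_wave one_pos s
    simpa [mul_comm s] using this

theorem continuous_sideGauss (k : ℕ) {m : ℕ} (j : Fin m) : Continuous (sideGauss k j) := by
  unfold sideGauss
  split_ifs
  · exact continuous_halfGauss
  · fun_prop

theorem exists_sideGauss_bound (k : ℕ) {m : ℕ} (j : Fin m) :
    ∃ B : ℝ, 0 ≤ B ∧ ∀ s, ‖sideGauss k j s‖ ≤ B ∧ |s| * ‖sideGauss k j s‖ ≤ B := by
  unfold sideGauss
  split_ifs
  · refine ⟨max (gaussMoment 0) 2, le_max_of_le_right two_pos.le, fun s => ⟨?_, ?_⟩⟩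
    · exact (norm_halfGauss_le s).trans (le_max_left _ _)
    · exact (abs_mul_norm_halfGauss_le s).trans (le_max_right _ _)
  · refine ⟨√(2 * π), by positivity, fun s => ?_⟩
    rw [Complex.norm_real, norm_of_nonneg (by positivity)]
    have h1 : exp (-s ^ 2 / 2) ≤ 1 := exp_le_one_iff.2 (by nlinarith [sq_nonneg s])
    have h2 : |s| * exp (-s ^ 2 / 2) ≤ 1 := by
      have h3 : |s| ≤ exp (s ^ 2 / 2) := by
        have := add_one_le_exp (s ^ 2 / 2)
        nlinarith [sq_nonneg (|s| - 1), sq_abs s]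
      calc |s| * exp (-s ^ 2 / 2) ≤ exp (s ^ 2 / 2) * exp (-s ^ 2 / 2) := by gcongr
        _ = 1 := by rw [← Real.exp_add]; ring_nf; simp
    have h4 : (0 : ℝ) ≤ √(2 * π) := by positivity
    exact ⟨mul_le_of_le_one_right h4 h1, by nlinarith⟩

theorem integrable_gauss (b : ℝ) (hb : 0 < b) : Integrable fun y : ℝ => exp (-(y * b) ^ 2 / 2) := by
  refine (integrable_exp_neg_mul_sq (b := b ^ 2 / 2) (by positivity)).congr
    (Filter.Eventually.of_forall fun y => ?_)
  simp only
  congr 1; ring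

theorem fixed_radius_fourier (k : ℕ) {m : ℕ} {b : ℝ} (hb : 0 < b) (t : Fin m → ℝ) :
    ((b⁻¹ * ∫ μ : Fin m → ℝ in Set.univ.pi (coneSide k),
      exp (-(∑ j, μ j ^ 2) / 2 - (∑ j, μ j * t j) ^ 2 / (2 * b ^ 2)) : ℝ) : ℂ) =
    (√(2 * π) : ℂ)⁻¹ * ∫ y : ℝ, (exp (-(y * b) ^ 2 / 2) : ℂ) * ∏ j, sideGauss k j (y * t j) := by
  have hpi := pi_pos
  set ν : Fin m → Measure ℝ := fun j => volume.restrict (coneSide k j) with hν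
  have hres : (volume : Measure (Fin m → ℝ)).restrict (Set.univ.pi (coneSide k)) = Measure.pi ν := by
    rw [volume_pi, Measure.restrict_pi_pi]
  rw [hres]
  set f : ℝ → (Fin m → ℝ) → ℂ := fun y μ => (exp (-(y * b) ^ 2 / 2) : ℂ) *
    ∏ j, ((exp (-(μ j) ^ 2 / 2) : ℂ) * Complex.exp ((y * t j * μ j : ℝ) * Complex.I)) with hf
  have h1 : ∀ y : ℝ, (exp (-(y * b) ^ 2 / 2) : ℂ) * ∏ j, sideGauss k j (y * t j) =
      ∫ μ, f y μ ∂Measure.pi ν := by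
    intro y
    rw [hf]
    simp only
    rw [integral_const_mul, integral_fintype_prod_eq_prod (𝕜 := ℂ) (fun j g =>
      (exp (-g ^ 2 / 2) : ℂ) * Complex.exp ((y * t j * g : ℝ) * Complex.I))]
    simp only [hν, integral_coneSide]
  have hcont : Continuous (Function.uncurry f) := by
    simp only [hf, Function.uncurry_def]
    fun_prop
  have hint : Integrable (Function.uncurry f) (volume.prod (Measure.pi ν)) := by
    have hg : ∀ j, Integrable (fun g : ℝ => exp (-g ^ 2 / 2)) (ν j) := fun j => by
      have := integrable_gauss 1 one_pos
      simp only [mul_one] at this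
      exact this.restrict
    have := (integrable_gauss b hb).mul_prod (Integrable.fintype_prod hg)
    refine this.mono' hcont.aestronglyMeasurable (Filter.Eventually.of_forall fun z => le_of_eq ?_)
    simp only [hf, Function.uncurry_def]
    rw [norm_mul, norm_prod, Complex.norm_real, norm_of_nonneg (exp_pos _).le]
    congr 1
    refine Finset.prod_congr rfl fun j _ => ?_
    rw [norm_mul, Complex.norm_exp_ofReal_mul_I, mul_one, Complex.norm_real,
      norm_of_nonneg (exp_pos _).le]
  simp only [h1]
  rw [integral_integral_swap hint, Complex.ofReal_mul, ← integral_complex_ofReal,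
    ← integral_const_mul, ← integral_const_mul]
  congr 1 with μ
  have h2 : ∀ y, f y μ = ((∏ j, exp (-(μ j) ^ 2 / 2) : ℝ) : ℂ) *
      ((exp (-(y * b) ^ 2 / 2) : ℂ) *
        Complex.exp ((y * (∑ j, μ j * t j) : ℝ) * Complex.I)) := by
    intro y
    simp only [hf]
    rw [Finset.prod_mul_distrib, ← Complex.exp_sum, ← Finset.sum_mul, ← Complex.ofReal_sum,
      Finset.mul_sum, Complex.ofReal_prod]
    have : ∑ j, y * t j * μ j = ∑ j, y * (μ j * t j) :=
      Finset.sum_congr rfl fun j _ => by ring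
    rw [this]
    ring
  simp only [h2]
  rw [integral_const_mul, integral_gauss_mul_wave hb, ← Complex.ofReal_inv, ← Complex.ofReal_mul,
    ← Complex.ofReal_mul, ← Complex.ofReal_mul, ← Real.exp_sum]
  congr 1
  have hs : √(2 * π) ≠ 0 := (sqrt_pos.2 (by positivity)).ne'
  rw [show ∀ A B C D : ℝ, C⁻¹ * (A * (C * B * D)) = (C⁻¹ * C) * (B * (A * D)) by intros; ring,
    inv_mul_cancel₀ hs, one_mul, ← Real.exp_add]
  congr 2
  rw [← Finset.sum_div, Finset.sum_neg_distrib]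
  ring

/-- The Gaussian integral over radii and the cone of directions that, up to a factor not
depending on `k`, is the expected internal angle. -/
def angleIntegral (m k a : ℕ) : ℝ :=
  ∫ r : Fin (m + 1) → ℝ, (∏ i, r i ^ a * exp (-r i ^ 2 / 2)) *
    ((r 0)⁻¹ * ∫ μ : Fin m → ℝ in Set.univ.pi (coneSide k),
      exp (-(∑ j, μ j ^ 2) / 2 - (∑ j, μ j * r j.succ) ^ 2 / (2 * r 0 ^ 2)))
    ∂(Measure.pi fun _ => volume.restrict (Set.Ioi 0))

/-- The transforms attached to all coordinates, the first one being a full Gaussian. -/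
def allGauss (k m : ℕ) : Fin (m + 1) → ℝ → ℂ :=
  Fin.cons (fun s => (exp (-s ^ 2 / 2) : ℂ)) (sideGauss k)

theorem continuous_allGauss (k m : ℕ) (i : Fin (m + 1)) : Continuous (allGauss k m i) := by
  refine Fin.cases ?_ (fun j => ?_) i
  · simp only [allGauss, Fin.cons_zero]
    fun_prop
  · simpa only [allGauss, Fin.cons_succ] using continuous_sideGauss k j

theorem exists_allGauss_bound (k m : ℕ) (i : Fin (m + 1)) : ∃ B, ∀ s, ‖allGauss k m i s‖ ≤ B := by
  refine Fin.cases ?_ (fun j => ?_) i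
  · refine ⟨1, fun s => ?_⟩
    simp only [allGauss, Fin.cons_zero]
    rw [Complex.norm_real, norm_of_nonneg (exp_pos _).le]
    exact exp_le_one_iff.2 (by nlinarith [sq_nonneg s])
  · obtain ⟨B, _, hB⟩ := exists_sideGauss_bound k j
    exact ⟨B, fun s => by simpa only [allGauss, Fin.cons_succ] using (hB s).1⟩

theorem integral_pow_mul_gauss_mul_gauss (a : ℕ) (y : ℝ) :
    ∫ r in Set.Ioi (0 : ℝ), r ^ a * exp (-r ^ 2 / 2) * exp (-(y * r) ^ 2 / 2) =
      gaussMoment a * (√(1 + y ^ 2) ^ (a + 1))⁻¹ := by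
  have hb : 0 < √(1 + y ^ 2) := sqrt_pos.2 (by positivity)
  have h := integral_comp_mul_left_Ioi (fun r : ℝ => r ^ a * exp (-r ^ 2 / 2)) 0 hb
  rw [mul_zero, smul_eq_mul] at h
  have e : ∀ r : ℝ, r ^ a * exp (-r ^ 2 / 2) * exp (-(y * r) ^ 2 / 2) =
      (√(1 + y ^ 2) ^ a)⁻¹ * ((√(1 + y ^ 2) * r) ^ a * exp (-(√(1 + y ^ 2) * r) ^ 2 / 2)) := by
    intro r
    have h2 : (√(1 + y ^ 2) * r) ^ 2 = r ^ 2 + (y * r) ^ 2 := by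
      rw [mul_pow, Real.sq_sqrt (by positivity)]
      ring
    rw [h2, mul_pow √(1 + y ^ 2) r a, ← mul_assoc, inv_mul_cancel_left₀ (pow_ne_zero _ hb.ne'),
      mul_assoc, ← Real.exp_add]
    congr 2
    ring
  simp only [e]
  rw [integral_const_mul, h, gaussMoment, pow_succ √(1 + y ^ 2) a, mul_inv]
  ring

theorem norm_integral_allGauss_zero_le (k m a : ℕ) (y : ℝ) :
    ∫ r in Set.Ioi (0 : ℝ), ‖((r ^ a * exp (-r ^ 2 / 2) : ℝ) : ℂ) * allGauss k m 0 (y * r)‖ ≤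
      gaussMoment a * (1 + y ^ 2) ^ (-(1 / 2) : ℝ) := by
  have h : ∫ r in Set.Ioi (0 : ℝ), ‖((r ^ a * exp (-r ^ 2 / 2) : ℝ) : ℂ) * allGauss k m 0 (y * r)‖ =
      ∫ r in Set.Ioi (0 : ℝ), r ^ a * exp (-r ^ 2 / 2) * exp (-(y * r) ^ 2 / 2) := by
    refine setIntegral_congr_fun measurableSet_Ioi fun r hr => ?_
    have : (0 : ℝ) < r := hr
    simp only [allGauss, Fin.cons_zero]
    rw [norm_mul, Complex.norm_real, Complex.norm_real, norm_of_nonneg (by positivity),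
      norm_of_nonneg (exp_pos _).le]
  rw [h, integral_pow_mul_gauss_mul_gauss]
  refine mul_le_mul_of_nonneg_left ?_ (gaussMoment_pos a).le
  rw [rpow_neg (by positivity), ← Real.sqrt_eq_rpow]
  have h1 : 1 ≤ √(1 + y ^ 2) := one_le_sqrt.2 (by nlinarith [sq_nonneg y])
  exact inv_anti₀ (by positivity) (le_self_pow₀ h1 (by omega))

theorem exists_norm_integral_sideGauss_le (k a : ℕ) {m : ℕ} (j : Fin m) :
    ∃ C, 0 ≤ C ∧ ∀ y : ℝ,
      ∫ r in Set.Ioi (0 : ℝ), ‖((r ^ a * exp (-r ^ 2 / 2) : ℝ) : ℂ) * sideGauss k j (y * r)‖ ≤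
        C * (1 + y ^ 2) ^ (-(1 / 4) : ℝ) := by
  obtain ⟨B, hB0, hB⟩ := exists_sideGauss_bound k j
  have hw : IntegrableOn (fun r : ℝ => r ^ a * exp (-r ^ 2 / 2) * (1 + r ^ (-(1 / 2) : ℝ)))
      (Set.Ioi 0) := by
    refine ((integrable_pow_mul_gauss a).add (integrable_rpow_mul_gauss
      (s := a + (-(1 / 2))) ?_)).congr_fun (fun r hr => ?_) measurableSet_Ioi
    · have : (0 : ℝ) ≤ a := by positivity
      linarith
    · have : (0 : ℝ) < r := hr
      simp only [Pi.add_apply]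
      rw [rpow_add this, rpow_natCast]
      ring
  refine ⟨B * ∫ r in Set.Ioi (0 : ℝ), r ^ a * exp (-r ^ 2 / 2) * (1 + r ^ (-(1 / 2) : ℝ)),
    mul_nonneg hB0 (setIntegral_nonneg measurableSet_Ioi fun r hr => ?_), fun y => ?_⟩
  · have : (0 : ℝ) < r := hr
    positivity
  · have hY : 0 < 1 + y ^ 2 := by positivity
    rw [rpow_neg hY.le, ← div_eq_mul_inv, le_div_iff₀ (by positivity), ← integral_mul_const,
      ← integral_const_mul]
    refine setIntegral_mono_on ?_ (hw.const_mul B) measurableSet_Ioi fun r hr => ?_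
    · exact ((integrable_pow_mul_gauss_mul_bdd a
        ((continuous_sideGauss k j).comp (continuous_const_mul y)) fun r => (hB _).1).norm).mul_const _
    · have hr' : (0 : ℝ) < r := hr
      rw [norm_mul, Complex.norm_real, norm_of_nonneg (by positivity)]
      have h1 : (1 + y ^ 2) ^ (1 / 4 : ℝ) ≤ 1 + |y| ^ (1 / 2 : ℝ) := by
        have := rpow_add_le_add_rpow (p := 1 / 4) zero_le_one (sq_nonneg y) (by norm_num) (by norm_num)
        rw [one_rpow] at this
        refine this.trans (le_of_eq ?_)
        rw [← sq_abs, ← rpow_natCast, ← rpow_mul (abs_nonneg y)]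
        norm_num
      have h2 : ‖sideGauss k j (y * r)‖ * |y * r| ^ (1 / 2 : ℝ) ≤ B := by
        refine le_of_sq_le_sq ?_ hB0
        rw [mul_pow, ← rpow_natCast (|y * r| ^ (1 / 2 : ℝ)), ← rpow_mul (abs_nonneg _)]
        norm_num
        nlinarith [hB (y * r), norm_nonneg (sideGauss k j (y * r)), abs_nonneg (y * r), abs_mul y r]
      have h3 : ‖sideGauss k j (y * r)‖ * |y| ^ (1 / 2 : ℝ) ≤ B * r ^ (-(1 / 2) : ℝ) := by
        rw [abs_mul, abs_of_pos hr', mul_rpow (abs_nonneg y) hr'.le] at h2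
        rw [rpow_neg hr'.le, ← div_eq_mul_inv, le_div_iff₀ (by positivity)]
        linarith
      calc r ^ a * exp (-r ^ 2 / 2) * ‖sideGauss k j (y * r)‖ * (1 + y ^ 2) ^ (1 / 4 : ℝ)
          ≤ r ^ a * exp (-r ^ 2 / 2) * ‖sideGauss k j (y * r)‖ * (1 + |y| ^ (1 / 2 : ℝ)) := by gcongr
        _ = r ^ a * exp (-r ^ 2 / 2) * (‖sideGauss k j (y * r)‖ +
            ‖sideGauss k j (y * r)‖ * |y| ^ (1 / 2 : ℝ)) := by ring
        _ ≤ r ^ a * exp (-r ^ 2 / 2) * (B + B * r ^ (-(1 / 2) : ℝ)) := by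
            gcongr
            exact (hB _).1
        _ = B * (r ^ a * exp (-r ^ 2 / 2) * (1 + r ^ (-(1 / 2) : ℝ))) := by ring

theorem exists_norm_integral_prod_le (k a : ℕ) {m : ℕ} (hm : 0 < m) : ∃ C, ∀ y : ℝ,
    ∏ i, ∫ r in Set.Ioi (0 : ℝ), ‖((r ^ a * exp (-r ^ 2 / 2) : ℝ) : ℂ) * allGauss k m i (y * r)‖ ≤
      C * (1 + y ^ 2) ^ (-(3 / 4) : ℝ) := by
  choose C hC0 hC using fun j : Fin m => exists_norm_integral_sideGauss_le k a j
  refine ⟨gaussMoment a * ∏ j, C j, fun y => ?_⟩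
  have hY : 1 ≤ 1 + y ^ 2 := by nlinarith [sq_nonneg y]
  rw [Fin.prod_univ_succ]
  have h1 : ∏ j : Fin m, ∫ r in Set.Ioi (0 : ℝ),
      ‖((r ^ a * exp (-r ^ 2 / 2) : ℝ) : ℂ) * allGauss k m j.succ (y * r)‖ ≤
      (∏ j, C j) * (1 + y ^ 2) ^ (-(1 / 4) : ℝ) := by
    calc _ ≤ ∏ j : Fin m, C j * (1 + y ^ 2) ^ (-(1 / 4) : ℝ) := by
          refine Finset.prod_le_prod (fun j _ => integral_nonneg fun r => norm_nonneg _) fun j _ => ?_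
          simpa only [allGauss, Fin.cons_succ] using hC j y
      _ = (∏ j, C j) * ((1 + y ^ 2) ^ (-(1 / 4) : ℝ)) ^ m := by
          rw [Finset.prod_mul_distrib, Finset.prod_const, Finset.card_univ, Fintype.card_fin]
      _ ≤ _ := by
          refine mul_le_mul_of_nonneg_left ?_ (Finset.prod_nonneg fun j _ => hC0 j)
          exact pow_le_of_le_one (by positivity) (rpow_le_one_of_one_le_of_nonpos hY (by norm_num))
            hm.ne'
  refine (mul_le_mul (norm_integral_allGauss_zero_le k m a y) h1
    (Finset.prod_nonneg fun j _ => integral_nonneg fun r => norm_nonneg _)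
    (mul_nonneg (gaussMoment_pos a).le (by positivity))).trans (le_of_eq ?_)
  rw [show (-(3 / 4) : ℝ) = -(1 / 2) + -(1 / 4) by norm_num, rpow_add (by positivity)]
  ring

theorem angleIntegral_eq_fourier (k a : ℕ) {m : ℕ} (hm : 0 < m) :
    (angleIntegral m k a : ℂ) = (√(2 * π) : ℂ)⁻¹ * ∫ y : ℝ,
      ∏ i, ∫ r in Set.Ioi (0 : ℝ), ((r ^ a * exp (-r ^ 2 / 2) : ℝ) : ℂ) * allGauss k m i (y * r) := by
  set ρ : Fin (m + 1) → Measure ℝ := fun _ => volume.restrict (Set.Ioi 0) with hρ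
  set f : (Fin (m + 1) → ℝ) → ℝ → ℂ := fun r y =>
    ∏ i, ((r i ^ a * exp (-r i ^ 2 / 2) : ℝ) : ℂ) * allGauss k m i (y * r i) with hf
  have hcs := continuous_allGauss k m
  have hcont : Continuous (Function.uncurry f) := by
    simp only [hf, Function.uncurry_def]
    refine continuous_finsetProd _ fun i _ => ?_
    exact (by fun_prop : Continuous fun z : (Fin (m + 1) → ℝ) × ℝ =>
      ((z.1 i ^ a * exp (-z.1 i ^ 2 / 2) : ℝ) : ℂ)).mul ((hcs i).comp (by fun_prop))
  have hone : ∀ y : ℝ, ∀ i, Integrable (fun r : ℝ => ((r ^ a * exp (-r ^ 2 / 2) : ℝ) : ℂ) *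
      allGauss k m i (y * r)) (ρ i) := by
    intro y i
    obtain ⟨B, hB⟩ := exists_allGauss_bound k m i
    exact integrable_pow_mul_gauss_mul_bdd a ((hcs i).comp (continuous_const_mul y))
      fun r => hB _
  have hint : Integrable (Function.uncurry f) ((Measure.pi ρ).prod volume) := by
    rw [integrable_prod_iff' hcont.aestronglyMeasurable]
    refine ⟨Filter.Eventually.of_forall fun y => Integrable.fintype_prod (hone y), ?_⟩
    obtain ⟨C, hC⟩ := exists_norm_integral_prod_le k a hm
    have hY : Integrable fun y : ℝ => C * (1 + y ^ 2) ^ (-(3 / 4) : ℝ) := by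
      have := integrable_rpow_neg_one_add_norm_sq (E := ℝ) (μ := volume) (r := 3 / 2) (by norm_num)
      refine (this.const_mul C).congr (Filter.Eventually.of_forall fun y => ?_)
      simp only [Real.norm_eq_abs, sq_abs]
      norm_num
    refine hY.mono' ?_ (Filter.Eventually.of_forall fun y => ?_)
    · exact (hcont.norm.aestronglyMeasurable (μ := (Measure.pi ρ).prod volume)).prod_swap.integral_prod_right'
    · rw [norm_of_nonneg (integral_nonneg fun r => norm_nonneg _)]
      refine le_trans (le_of_eq ?_) (hC y)
      simp only [hf, Function.uncurry_def, norm_prod]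
      rw [integral_fintype_prod_eq_prod (𝕜 := ℝ) (fun i (r : ℝ) =>
        ‖((r ^ a * exp (-r ^ 2 / 2) : ℝ) : ℂ) * allGauss k m i (y * r)‖)]
  have hprod : ∀ y : ℝ, ∏ i, ∫ r in Set.Ioi (0 : ℝ), ((r ^ a * exp (-r ^ 2 / 2) : ℝ) : ℂ) *
      allGauss k m i (y * r) = ∫ r, f r y ∂Measure.pi ρ := by
    intro y
    simp only [hf]
    rw [integral_fintype_prod_eq_prod (𝕜 := ℂ) (fun i (r : ℝ) =>
        ((r ^ a * exp (-r ^ 2 / 2) : ℝ) : ℂ) * allGauss k m i (y * r))]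
  simp only [hprod]
  rw [← integral_integral_swap hint, ← integral_const_mul, angleIntegral, ← integral_complex_ofReal]
  refine integral_congr_ae ?_
  have hpos : ∀ᵐ r ∂Measure.pi ρ, 0 < r 0 := by
    have : ∀ᵐ x ∂ρ 0, x ∈ Set.Ioi (0 : ℝ) := ae_restrict_mem measurableSet_Ioi
    exact Measure.tendsto_eval_ae_ae (μ := ρ) (i := 0) this
  filter_upwards [hpos] with r hr
  rw [Complex.ofReal_mul, fixed_radius_fourier k hr (fun j => r j.succ), mul_left_comm,
    ← integral_const_mul]
  congr 1
  refine integral_congr_ae (.of_forall fun y => ?_)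
  have e : f r y = (∏ i, ((r i ^ a * exp (-r i ^ 2 / 2) : ℝ) : ℂ)) *
    ∏ i, allGauss k m i (y * r i) := Finset.prod_mul_distrib
  simp only [e]
  rw [Complex.ofReal_prod, Fin.prod_univ_succ (fun i => allGauss k m i _)]
  simp only [allGauss, Fin.cons_zero, Fin.cons_succ]

theorem angleIntegral_eq (k a : ℕ) {m : ℕ} (hm : 0 < m) (hk : 1 ≤ k) (hkm : k ≤ m + 1) :
    (angleIntegral m k a : ℂ) =
      ((√(2 * π))⁻¹ * (√(2 * π) ^ m * gaussMoment a ^ (m + 1)) : ℝ) * ∫ x : ℝ,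
        (1 / 2 + Complex.I * (momentRatio a * coshPrimitive a x : ℝ)) ^ (m + 1 - k) *
          ((cosh x ^ ((a + 1) * (m + 1) - 1))⁻¹ : ℝ) := by
  rw [angleIntegral_eq_fourier k a hm]
  have hsub := integral_image_eq_integral_abs_deriv_smul (s := Set.univ) MeasurableSet.univ
    (fun x _ => (hasDerivAt_sinh x).hasDerivWithinAt) sinh_injective.injOn
    (fun y : ℝ => ∏ i, ∫ r in Set.Ioi (0 : ℝ), ((r ^ a * exp (-r ^ 2 / 2) : ℝ) : ℂ) *
      allGauss k m i (y * r))
  rw [Set.image_univ, sinh_surjective.range_eq, setIntegral_univ, setIntegral_univ] at hsub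
  rw [hsub, Complex.ofReal_mul, Complex.ofReal_inv, mul_assoc]
  refine congrArg _ ?_
  rw [← integral_const_mul]
  refine integral_congr_ae (.of_forall fun x => ?_)
  simp only
  have hc := cosh_pos x
  set F : ℂ := 1 / 2 + Complex.I * (momentRatio a * coshPrimitive a x : ℝ) with hF
  set c : ℝ := (cosh x ^ (a + 1))⁻¹ with hcdef
  have hsq : √(1 + sinh x ^ 2) = cosh x := by
    rw [add_comm, ← cosh_sq, Real.sqrt_sq hc.le]
  have h0 : ∫ r in Set.Ioi (0 : ℝ), ((r ^ a * exp (-r ^ 2 / 2) : ℝ) : ℂ) *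
      (exp (-(sinh x * r) ^ 2 / 2) : ℂ) = (gaussMoment a * c : ℝ) := by
    rw [hcdef, ← hsq, ← integral_pow_mul_gauss_mul_gauss, ← integral_complex_ofReal]
    congr 1 with r
    push_cast
    ring
  have hj : ∀ j : Fin m, ∫ r in Set.Ioi (0 : ℝ), ((r ^ a * exp (-r ^ 2 / 2) : ℝ) : ℂ) *
      sideGauss k j (sinh x * r) =
      (√(2 * π) * (gaussMoment a * c) : ℝ) * if k ≤ (j : ℕ) + 1 then F else 1 := by
    intro j
    simp only [sideGauss]
    split_ifs
    · exact halfGaussMoment_sinh a x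
    · rw [Complex.ofReal_mul, ← h0, mul_one, ← integral_const_mul]
      congr 1 with r
      push_cast
      ring
  have hcard : (Finset.univ.filter fun j : Fin m => k ≤ (j : ℕ) + 1).card = m + 1 - k := by
    rw [Finset.card_filter, Fin.sum_univ_eq_sum_range (fun j => if k ≤ j + 1 then 1 else 0) m,
      ← Finset.card_filter, show (Finset.range m).filter (fun j => k ≤ j + 1) =
        Finset.Ico (k - 1) m by ext; simp; omega, Nat.card_Ico]
    omega
  rw [Fin.prod_univ_succ]
  simp only [allGauss, Fin.cons_zero, Fin.cons_succ]
  simp only [h0, hj]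
  rw [Finset.prod_mul_distrib, Finset.prod_const, Finset.card_univ, Fintype.card_fin,
    Finset.prod_ite, Finset.prod_const_one, mul_one, Finset.prod_const, hcard,
    abs_of_pos hc, Complex.real_smul]
  have e : cosh x * (gaussMoment a * c * (√(2 * π) * (gaussMoment a * c)) ^ m) =
      √(2 * π) ^ m * gaussMoment a ^ (m + 1) * (cosh x ^ ((a + 1) * (m + 1) - 1))⁻¹ := by
    have : cosh x * c ^ (m + 1) = (cosh x ^ ((a + 1) * (m + 1) - 1))⁻¹ := by
      rw [hcdef, inv_pow, ← pow_mul]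
      obtain ⟨t, ht⟩ : ∃ t, (a + 1) * (m + 1) = t + 1 := ⟨a * m + a + m, by ring⟩
      rw [ht, Nat.add_sub_cancel, pow_succ]
      field_simp
    rw [← this]
    ring
  rw [show ((√(2 * π) ^ m * gaussMoment a ^ (m + 1) : ℝ) : ℂ) *
    (F ^ (m + 1 - k) * ((cosh x ^ ((a + 1) * (m + 1) - 1))⁻¹ : ℝ)) = ((√(2 * π) ^ m * gaussMoment a ^ (m + 1) *
      (cosh x ^ ((a + 1) * (m + 1) - 1))⁻¹ : ℝ) : ℂ) * F ^ (m + 1 - k) by push_cast; ring, ← e]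
  push_cast
  ring

theorem lintegral_comp_linearMap {E : Type*} [NormedAddCommGroup E] [NormedSpace ℝ E]
    [MeasurableSpace E] [BorelSpace E] [FiniteDimensional ℝ E] (μ : Measure E)
    [μ.IsAddHaarMeasure] {f : E →ₗ[ℝ] E} (hf : LinearMap.det f ≠ 0) (F : E → ENNReal) :
    ∫⁻ x, F (f x) ∂μ = ENNReal.ofReal |(LinearMap.det f)⁻¹| * ∫⁻ x, F x ∂μ := by
  have he : MeasurableEmbedding f := by
    have : (f : E → E) = ((LinearEquiv.ofIsUnitDet (f := f) (v := Module.finBasis ℝ E)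
      (v' := Module.finBasis ℝ E) (by
        rw [LinearMap.det_toMatrix]; exact isUnit_iff_ne_zero.2 hf)).toContinuousLinearEquiv.toHomeomorph : E → E) := by
      ext x; simp
    rw [this]
    exact (Homeomorph.measurableEmbedding _)
  rw [← he.lintegral_map, Measure.map_linearMap_addHaar_eq_smul_addHaar μ hf, lintegral_smul_measure,
    smul_eq_mul]

/-- Left multiplication by a square matrix, acting on rectangular arrays. -/
def mulArray {n m : ℕ} (U : Matrix (Fin n) (Fin n) ℝ) :
    (Fin n → Fin m → ℝ) →ₗ[ℝ] (Fin n → Fin m → ℝ) where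
  toFun Y i a := ∑ l, U i l * Y l a
  map_add' Y Z := by ext; simp [mul_add, Finset.sum_add_distrib]
  map_smul' c Y := by
    ext; simp [Finset.mul_sum, mul_left_comm]

theorem det_mulArray {n m : ℕ} (U : Matrix (Fin n) (Fin n) ℝ) :
    LinearMap.det (mulArray (m := m) U) = U.det ^ m := by
  let e : (Fin n → Fin m → ℝ) ≃ₗ[ℝ] (Fin m → Fin n → ℝ) :=
    { Equiv.piComm _ with
      map_add' := fun _ _ => rfl
      map_smul' := fun _ _ => rfl }
  rw [← LinearMap.det_conj (mulArray (m := m) U) e]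
  have h : (e : (Fin n → Fin m → ℝ) →ₗ[ℝ] (Fin m → Fin n → ℝ)) ∘ₗ mulArray U ∘ₗ
      (e.symm : (Fin m → Fin n → ℝ) →ₗ[ℝ] _) =
      LinearMap.pi fun a => (Matrix.toLin' U).comp (LinearMap.proj a) := by
    refine LinearMap.ext fun Z => ?_
    ext a i
    simp [e, mulArray, Matrix.mulVec, dotProduct]
  rw [h, LinearMap.det_pi, Finset.prod_const, LinearMap.det_toLin', Finset.card_univ, Fintype.card_fin]

theorem lintegral_comp_mulArray {n m : ℕ} {U : Matrix (Fin n) (Fin n) ℝ} (hU : U.det ≠ 0)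
    (F : (Fin n → Fin m → ℝ) → ENNReal) :
    ∫⁻ Y : Fin n → Fin m → ℝ, F (mulArray U Y) =
      ENNReal.ofReal (|U.det| ^ m)⁻¹ * ∫⁻ Y : Fin n → Fin m → ℝ, F Y := by
  have h := lintegral_comp_linearMap (volume : Measure (Fin n → Fin m → ℝ)) (f := mulArray U)
    (by rw [det_mulArray]; exact pow_ne_zero _ hU) F
  rw [h, det_mulArray, abs_inv, abs_pow]

theorem lintegral_comp_mulVec {m : ℕ} {U : Matrix (Fin m) (Fin m) ℝ} (hU : U.det ≠ 0)
    (F : (Fin m → ℝ) → ENNReal) :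
    ∫⁻ y : Fin m → ℝ, F (U.mulVec y) = ENNReal.ofReal |U.det|⁻¹ * ∫⁻ y : Fin m → ℝ, F y := by
  have h := lintegral_comp_linearMap (volume : Measure (Fin m → ℝ)) (f := Matrix.toLin' U)
    (by rwa [LinearMap.det_toLin']) F
  rwa [LinearMap.det_toLin', abs_inv] at h

theorem lintegral_comp_mul_pi {m : ℕ} {c : Fin m → ℝ} (hc : ∀ i, 0 < c i)
    (F : (Fin m → ℝ) → ENNReal) :
    ∫⁻ y : Fin m → ℝ, F (fun i => c i * y i) =
      ENNReal.ofReal (∏ i, c i)⁻¹ * ∫⁻ y : Fin m → ℝ, F y := by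
  have h0 : 0 < ∏ i, c i := Finset.prod_pos fun i _ => hc i
  have h := lintegral_comp_mulVec (U := Matrix.diagonal c) (by
    rw [Matrix.det_diagonal]; exact h0.ne') F
  rw [Matrix.det_diagonal, abs_of_pos h0] at h
  rw [← h]
  congr 1 with y
  congr 1 with i
  rw [Matrix.mulVec_diagonal]

theorem lintegral_Ioi_comp_mul {c : ℝ} (hc : 0 < c) (F : ℝ → ENNReal) :
    ∫⁻ s in Set.Ioi (0 : ℝ), F (c * s) = ENNReal.ofReal c⁻¹ * ∫⁻ s in Set.Ioi (0 : ℝ), F s := by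
  have h := lintegral_comp_linearMap (volume : Measure ℝ) (f := LinearMap.lsmul ℝ ℝ c)
    (by simpa using hc.ne') ((Set.Ioi (0 : ℝ)).indicator F)
  rw [lintegral_indicator measurableSet_Ioi] at h
  rw [← lintegral_indicator measurableSet_Ioi]
  simp only [LinearMap.det_ring, LinearMap.lsmul_apply, smul_eq_mul, mul_one, abs_inv, abs_of_pos hc] at h
  rw [← h]
  congr 1 with s
  simp only [Set.indicator, Set.mem_Ioi, mul_pos_iff_of_pos_left hc]

theorem lintegral_gaussMoment (a : ℕ) :
    ∫⁻ s in Set.Ioi (0 : ℝ), ENNReal.ofReal (s ^ a * exp (-s ^ 2 / 2)) =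
      ENNReal.ofReal (gaussMoment a) := by
  rw [gaussMoment, ofReal_integral_eq_lintegral_ofReal (integrable_pow_mul_gauss a)]
  filter_upwards [ae_restrict_mem measurableSet_Ioi] with s hs
  have : (0 : ℝ) < s := hs
  positivity

theorem lintegral_pow_mul_exp_sq (a : ℕ) {A : ℝ} (hA : 0 < A) :
    ∫⁻ s in Set.Ioi (0 : ℝ), ENNReal.ofReal (s ^ a * exp (-(s ^ 2 * A) / 2)) =
      ENNReal.ofReal (gaussMoment a * (√A ^ (a + 1))⁻¹) := by
  have hs : 0 < √A := sqrt_pos.2 hA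
  have h := lintegral_Ioi_comp_mul hs fun s => ENNReal.ofReal (s ^ a * exp (-s ^ 2 / 2))
  rw [lintegral_gaussMoment] at h
  have e : ∀ s : ℝ, ENNReal.ofReal (s ^ a * exp (-(s ^ 2 * A) / 2)) = ENNReal.ofReal (√A ^ a)⁻¹ *
      ENNReal.ofReal ((√A * s) ^ a * exp (-(√A * s) ^ 2 / 2)) := by
    intro s
    rw [← ENNReal.ofReal_mul (by positivity), mul_pow √A s a, mul_pow √A s 2, Real.sq_sqrt hA.le,
      mul_assoc, inv_mul_cancel_left₀ (pow_ne_zero _ hs.ne'), mul_comm A]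
  simp only [e]
  rw [lintegral_const_mul' _ _ ENNReal.ofReal_ne_top, h, ← ENNReal.ofReal_mul (by positivity),
    ← ENNReal.ofReal_mul (by positivity)]
  congr 1
  rw [pow_succ √A a, mul_inv]
  ring

/-- The absolute determinant of the square matrix with first column `u` and remaining columns
given by `Y`. -/
def borderedDet {m : ℕ} (u : Fin (m + 1) → ℝ) (Y : Fin (m + 1) → Fin m → ℝ) : ℝ :=
  |(Matrix.of fun i => (Fin.cons (u i) (Y i) : Fin (m + 1) → ℝ)).det|

theorem borderedDet_nonneg {m : ℕ} (u : Fin (m + 1) → ℝ) (Y : Fin (m + 1) → Fin m → ℝ) :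
    0 ≤ borderedDet u Y := abs_nonneg _

theorem borderedDet_mulArray {m : ℕ} (U : Matrix (Fin (m + 1)) (Fin (m + 1)) ℝ)
    (u : Fin (m + 1) → ℝ) (Y : Fin (m + 1) → Fin m → ℝ) :
    borderedDet (U.mulVec u) (mulArray U Y) = |U.det| * borderedDet u Y := by
  rw [borderedDet, borderedDet, ← abs_mul, ← Matrix.det_mul]
  congr 2
  ext i j
  refine Fin.cases ?_ (fun a => ?_) j
  · simp [Matrix.mulVec, dotProduct, Matrix.mul_apply]
  · simp [Matrix.mul_apply, mulArray]

theorem borderedDet_smul {m : ℕ} (c : ℝ) (u : Fin (m + 1) → ℝ) (Y : Fin (m + 1) → Fin m → ℝ) :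
    borderedDet (c • u) Y = |c| * borderedDet u Y := by
  have h := Matrix.det_mul_row (Fin.cons c fun _ => 1 : Fin (m + 1) → ℝ)
    (Matrix.of fun i => (Fin.cons (u i) (Y i) : Fin (m + 1) → ℝ))
  rw [Fin.prod_univ_succ] at h
  simp only [Fin.cons_zero, Fin.cons_succ, Finset.prod_const_one, mul_one] at h
  rw [borderedDet, borderedDet, ← abs_mul, ← h]
  congr 2
  ext i j
  refine Fin.cases ?_ (fun a => ?_) j <;> simp

theorem borderedDet_scale {m : ℕ} {r : Fin (m + 1) → ℝ} (hr : ∀ i, 0 < r i)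
    (Y : Fin (m + 1) → Fin m → ℝ) :
    borderedDet (fun _ => 1) (fun i a => (r i)⁻¹ * Y i a) = (∏ i, r i)⁻¹ * borderedDet r Y := by
  have h := borderedDet_mulArray (Matrix.diagonal fun i => (r i)⁻¹) r Y
  rw [Matrix.det_diagonal, Finset.prod_inv_distrib,
    abs_of_pos (inv_pos.2 (Finset.prod_pos fun i _ => hr i))] at h
  rw [← h]
  congr 1
  · ext i
    rw [Matrix.mulVec_diagonal, inv_mul_cancel₀ (hr i).ne']
  · ext i a
    simp [mulArray, Matrix.diagonal_apply]

theorem abs_det_sub_eq_borderedDet {m : ℕ} (X : Fin (m + 1) → Fin m → ℝ) :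
    |(Matrix.of fun a j : Fin m => X j.succ a - X 0 a).det| = borderedDet (fun _ => 1) X := by
  rw [borderedDet, ← Matrix.det_transpose]
  congr 1
  have h := Matrix.det_eq_of_forall_row_eq_smul_add_const
    (A := Matrix.of fun i => (Fin.cons 1 (X i) : Fin (m + 1) → ℝ))
    (B := Matrix.of (Fin.cons (Fin.cons 1 (X 0)) fun j => Fin.cons 0 (X j.succ - X 0) :
      Fin (m + 1) → Fin (m + 1) → ℝ)) (Fin.cons 0 fun _ => 1) 0 rfl ?_
  · rw [h, Matrix.det_succ_column_zero, Fin.sum_univ_succ]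
    simp only [Matrix.of_apply, Fin.cons_zero, Fin.cons_succ, mul_zero, zero_mul,
      Finset.sum_const_zero, add_zero, Fin.val_zero, pow_zero, one_mul]
    congr 1
  · intro i j
    refine Fin.cases ?_ (fun l => ?_) i
    · simp
    · refine Fin.cases ?_ (fun a => ?_) j <;> simp

def rankOne {n : ℕ} (c : ℝ) (v : Fin n → ℝ) : Matrix (Fin n) (Fin n) ℝ :=
  1 + c • Matrix.vecMulVec v v

theorem det_rankOne {n : ℕ} (c : ℝ) (v : Fin n → ℝ) : (rankOne c v).det = 1 + c * (v ⬝ᵥ v) := by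
  have := Matrix.det_one_add_replicateCol_mul_replicateRow (ι := Unit) (c • v) v
  rw [dotProduct_smul, smul_eq_mul] at this
  rw [← this, rankOne]
  congr 2
  ext i j
  simp [Matrix.vecMulVec_apply, Matrix.mul_apply, mul_assoc]

theorem rankOne_mulVec {n : ℕ} (c : ℝ) (v u : Fin n → ℝ) :
    (rankOne c v).mulVec u = u + (c * (v ⬝ᵥ u)) • v := by
  rw [rankOne, Matrix.add_mulVec, Matrix.one_mulVec, Matrix.smul_mulVec, Matrix.vecMulVec_mulVec]
  ext i
  simp
  ring

def sqNorm {n m : ℕ} (Y : Fin n → Fin m → ℝ) : ℝ := ∑ i, ∑ a, Y i a ^ 2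

def sqComb {n m : ℕ} (w : Fin n → ℝ) (Y : Fin n → Fin m → ℝ) : ℝ :=
  ∑ a, (∑ i, w i * Y i a) ^ 2

theorem sqNorm_rankOne {n m : ℕ} (c : ℝ) (v : Fin n → ℝ) (Y : Fin n → Fin m → ℝ) :
    sqNorm (mulArray (rankOne c v) Y) = sqNorm Y + (2 * c + c ^ 2 * (v ⬝ᵥ v)) * sqComb v Y := by
  have e : ∀ i a, mulArray (rankOne c v) Y i a = Y i a + c * (∑ l, v l * Y l a) * v i := by
    intro i a
    have := congrFun (rankOne_mulVec c v fun l => Y l a) i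
    simp only [Matrix.mulVec, dotProduct, Pi.add_apply, Pi.smul_apply, smul_eq_mul] at this
    exact this
  simp only [sqNorm, e]
  rw [Finset.sum_comm, Finset.sum_comm (f := fun i a => Y i a ^ 2), sqComb, Finset.mul_sum,
    ← Finset.sum_add_distrib]
  refine Finset.sum_congr rfl fun a _ => ?_
  set S := ∑ l, v l * Y l a with hS
  have : ∀ i, (Y i a + c * S * v i) ^ 2 = Y i a ^ 2 + 2 * c * S * (v i * Y i a) +
    c ^ 2 * S ^ 2 * (v i * v i) := fun i => by ring
  simp only [this]
  rw [Finset.sum_add_distrib, Finset.sum_add_distrib, ← Finset.mul_sum, ← Finset.mul_sum, ← hS,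
    dotProduct]
  ring

/-- The unnormalized Gaussian moment of the determinant bordered by `u`. -/
def gaussDet {m : ℕ} (u : Fin (m + 1) → ℝ) : ENNReal :=
  ∫⁻ Y : Fin (m + 1) → Fin m → ℝ, ENNReal.ofReal (borderedDet u Y * exp (-sqNorm Y / 2))

theorem lintegral_borderedDet_rankOne {m : ℕ} {c : ℝ} {v : Fin (m + 1) → ℝ}
    (h : 1 + c * (v ⬝ᵥ v) ≠ 0) (u : Fin (m + 1) → ℝ) :
    ∫⁻ Y, ENNReal.ofReal (borderedDet u Y *
      exp (-(sqNorm Y + (2 * c + c ^ 2 * (v ⬝ᵥ v)) * sqComb v Y) / 2)) =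
      ENNReal.ofReal (|1 + c * (v ⬝ᵥ v)| ^ (m + 1))⁻¹ * gaussDet ((rankOne c v).mulVec u) := by
  have h' : (rankOne c v).det ≠ 0 := by rwa [det_rankOne]
  have key := lintegral_comp_mulArray h' fun Y : Fin (m + 1) → Fin m → ℝ =>
    ENNReal.ofReal (borderedDet ((rankOne c v).mulVec u) Y * exp (-sqNorm Y / 2))
  simp only [borderedDet_mulArray, sqNorm_rankOne, mul_assoc] at key
  simp only [ENNReal.ofReal_mul (abs_nonneg (rankOne c v).det)] at key
  rw [lintegral_const_mul' _ _ ENNReal.ofReal_ne_top, det_rankOne] at key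
  have hp : 0 < |1 + c * (v ⬝ᵥ v)| := abs_pos.2 h
  rw [gaussDet, pow_succ |_| m, mul_inv, mul_comm _ (|_|⁻¹), ENNReal.ofReal_mul (by positivity), mul_assoc,
    ← key, ← mul_assoc, ← ENNReal.ofReal_mul (by positivity), inv_mul_cancel₀ hp.ne',
    ENNReal.ofReal_one, one_mul]

theorem lintegral_borderedDet_of_orthogonal {m : ℕ} {u w : Fin (m + 1) → ℝ} (h : w ⬝ᵥ u = 0) :
    ∫⁻ Y, ENNReal.ofReal (borderedDet u Y * exp (-(sqNorm Y + sqComb w Y) / 2)) =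
      ENNReal.ofReal (√(1 + w ⬝ᵥ w) ^ (m + 1))⁻¹ * gaussDet u := by
  have hw : 0 ≤ w ⬝ᵥ w := Finset.sum_nonneg fun i _ => mul_self_nonneg _
  set t := √(1 + w ⬝ᵥ w) with ht
  have ht2 : t ^ 2 = 1 + w ⬝ᵥ w := Real.sq_sqrt (by positivity)
  have ht0 : 0 < t := sqrt_pos.2 (by positivity)
  have e1 : 1 + (1 + t)⁻¹ * (w ⬝ᵥ w) = t := by
    rw [eq_sub_of_add_eq' ht2.symm]
    field_simp
    ring
  have e2 : 2 * (1 + t)⁻¹ + (1 + t)⁻¹ ^ 2 * (w ⬝ᵥ w) = 1 := by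
    rw [eq_sub_of_add_eq' ht2.symm]
    field_simp
    ring
  have key := lintegral_borderedDet_rankOne (c := (1 + t)⁻¹) (v := w) (by rw [e1]; exact ht0.ne') u
  rw [e1, e2, rankOne_mulVec, h, abs_of_pos ht0] at key
  simpa only [one_mul, mul_zero, zero_smul, add_zero] using key

theorem gaussDet_eq_of_norm_eq {m : ℕ} {u u' : Fin (m + 1) → ℝ} (h : u ⬝ᵥ u = u' ⬝ᵥ u') :
    gaussDet u = gaussDet u' := by
  rcases eq_or_ne u u' with rfl | hne
  · rfl
  set v := u - u' with hv
  have hv0 : v ⬝ᵥ v ≠ 0 := by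
    rw [Ne, dotProduct_self_eq_zero]
    exact sub_ne_zero.2 hne
  have e1 : 1 + (-2 / (v ⬝ᵥ v)) * (v ⬝ᵥ v) = -1 := by field_simp; norm_num
  have e2 : 2 * (-2 / (v ⬝ᵥ v)) + (-2 / (v ⬝ᵥ v)) ^ 2 * (v ⬝ᵥ v) = 0 := by field_simp; norm_num
  have e3 : -2 / (v ⬝ᵥ v) * (v ⬝ᵥ u) = -1 := by
    have : v ⬝ᵥ v = 2 * (v ⬝ᵥ u) := by
      simp only [hv, sub_dotProduct, dotProduct_sub, h, dotProduct_comm u' u]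
      ring
    rw [div_mul_eq_mul_div, div_eq_iff hv0, this]
    ring
  have key := lintegral_borderedDet_rankOne (c := -2 / (v ⬝ᵥ v)) (v := v)
    (by rw [e1]; norm_num) u
  rw [e1, e2, rankOne_mulVec, e3, hv] at key
  simpa [gaussDet] using key

theorem gaussDet_smul {m : ℕ} (c : ℝ) (u : Fin (m + 1) → ℝ) :
    gaussDet (c • u) = ENNReal.ofReal |c| * gaussDet u := by
  simp only [gaussDet, borderedDet_smul, mul_assoc, ENNReal.ofReal_mul (abs_nonneg c)]
  rw [lintegral_const_mul' _ _ ENNReal.ofReal_ne_top]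

theorem gaussDet_eq {m : ℕ} (u : Fin (m + 1) → ℝ) :
    gaussDet u = ENNReal.ofReal √(u ⬝ᵥ u) * gaussDet (Pi.single 0 1 : Fin (m + 1) → ℝ) := by
  have hu : 0 ≤ u ⬝ᵥ u := Finset.sum_nonneg fun i _ => mul_self_nonneg _
  have := gaussDet_smul √(u ⬝ᵥ u) (Pi.single 0 1 : Fin (m + 1) → ℝ)
  rw [abs_of_nonneg (sqrt_nonneg _)] at this
  rw [← this]
  refine gaussDet_eq_of_norm_eq ?_
  simp [Real.mul_self_sqrt hu]

theorem continuous_borderedDet {m : ℕ} (u : Fin (m + 1) → ℝ) :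
    Continuous (borderedDet u : (Fin (m + 1) → Fin m → ℝ) → ℝ) := by
  refine (Continuous.matrix_det (continuous_matrix fun i j => ?_)).abs
  refine Fin.cases ?_ (fun a => ?_) j
  · simpa using continuous_const
  · simp only [Matrix.of_apply, Fin.cons_succ]
    fun_prop

/-- The coefficients, orthogonal to `r`, of the rows of a point configuration. -/
def coneWeight {m : ℕ} (r : Fin (m + 1) → ℝ) (μ : Fin m → ℝ) : Fin (m + 1) → ℝ :=
  Fin.cons (-((∑ j, μ j * r j.succ) / r 0)) μ

theorem coneWeight_dotProduct {m : ℕ} {r : Fin (m + 1) → ℝ} (hr : r 0 ≠ 0) (μ : Fin m → ℝ) :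
    coneWeight r μ ⬝ᵥ r = 0 := by
  rw [coneWeight, dotProduct, Fin.sum_univ_succ]
  simp only [Fin.cons_zero, Fin.cons_succ]
  field_simp
  ring

/-- The quadratic form of the transformed cone integral. -/
def coneForm {m : ℕ} (r : Fin (m + 1) → ℝ) (μ : Fin m → ℝ) : ℝ :=
  ∑ j, μ j ^ 2 + (∑ j, μ j * r j.succ) ^ 2 / r 0 ^ 2

theorem coneForm_nonneg {m : ℕ} (r : Fin (m + 1) → ℝ) (μ : Fin m → ℝ) : 0 ≤ coneForm r μ := by
  unfold coneForm
  positivity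

theorem coneWeight_dotProduct_self {m : ℕ} (r : Fin (m + 1) → ℝ) (μ : Fin m → ℝ) :
    coneWeight r μ ⬝ᵥ coneWeight r μ = coneForm r μ := by
  rw [coneWeight, dotProduct, Fin.sum_univ_succ, coneForm]
  simp only [Fin.cons_zero, Fin.cons_succ, ← sq]
  ring

theorem coneForm_smul {m : ℕ} (r : Fin (m + 1) → ℝ) (s : ℝ) (μ : Fin m → ℝ) :
    coneForm r (fun j => s * μ j) = s ^ 2 * coneForm r μ := by
  simp only [coneForm, mul_pow, mul_assoc, ← Finset.mul_sum]
  ring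

theorem coneForm_smul_left {m : ℕ} (r : Fin (m + 1) → ℝ) {c : ℝ} (hc : c ≠ 0) (μ : Fin m → ℝ) :
    coneForm (fun i => c * r i) μ = coneForm r μ := by
  simp only [coneForm, mul_left_comm _ c, ← Finset.mul_sum, mul_pow]
  rw [mul_div_mul_left _ _ (pow_ne_zero 2 hc)]

/-- A set stable under positive rescaling of the coordinates. -/
def DiagStable {m : ℕ} (C : Set (Fin m → ℝ)) : Prop :=
  ∀ c : Fin m → ℝ, (∀ i, 0 < c i) → ∀ μ, (fun i => c i * μ i) ∈ C ↔ μ ∈ C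

theorem DiagStable.setLIntegral {m : ℕ} {C : Set (Fin m → ℝ)} (hC : DiagStable C)
    (hm : MeasurableSet C) {c : Fin m → ℝ} (hc : ∀ i, 0 < c i) (F : (Fin m → ℝ) → ENNReal) :
    ∫⁻ μ in C, F μ = ENNReal.ofReal (∏ i, c i) * ∫⁻ μ in C, F fun i => c i * μ i := by
  have h0 : 0 < ∏ i, c i := Finset.prod_pos fun i _ => hc i
  have h := lintegral_comp_mul_pi hc (C.indicator F)
  rw [lintegral_indicator hm] at h
  rw [← lintegral_indicator hm (fun μ => F fun i => c i * μ i)]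
  have e : (C.indicator fun μ => F fun i => c i * μ i) =
      fun μ => C.indicator F fun i => c i * μ i := by
    ext μ
    by_cases hμ : μ ∈ C
    · rw [Set.indicator_of_mem hμ, Set.indicator_of_mem ((hC c hc μ).2 hμ)]
    · rw [Set.indicator_of_notMem hμ, Set.indicator_of_notMem fun h => hμ ((hC c hc μ).1 h)]
  rw [e, h, ← mul_assoc, ← ENNReal.ofReal_mul h0.le, mul_inv_cancel₀ h0.ne', ENNReal.ofReal_one,
    one_mul]

/-- The Gaussian weight of a cone for the form attached to `r`. -/
def coneGauss {m : ℕ} (C : Set (Fin m → ℝ)) (r : Fin (m + 1) → ℝ) : ENNReal :=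
  ∫⁻ μ in C, ENNReal.ofReal (exp (-coneForm r μ / 2))

theorem setLIntegral_coneForm_pow {m : ℕ} {C : Set (Fin m → ℝ)} (hC : DiagStable C)
    (hm : MeasurableSet C) (r : Fin (m + 1) → ℝ) :
    ∫⁻ μ in C, ENNReal.ofReal (√(1 + coneForm r μ) ^ (m + 1))⁻¹ =
      ENNReal.ofReal (gaussMoment 0 / gaussMoment m) * coneGauss C r := by
  have hg := gaussMoment_pos m
  have hcf : Continuous (coneForm r) := by unfold coneForm; fun_prop
  have e : ∀ μ, ENNReal.ofReal (√(1 + coneForm r μ) ^ (m + 1))⁻¹ =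
      ENNReal.ofReal (gaussMoment m)⁻¹ *
        ∫⁻ s in Set.Ioi (0 : ℝ), ENNReal.ofReal (s ^ m * exp (-(s ^ 2 * (1 + coneForm r μ)) / 2)) := by
    intro μ
    have := coneForm_nonneg r μ
    rw [lintegral_pow_mul_exp_sq m (by positivity), ← ENNReal.ofReal_mul (by positivity),
      inv_mul_cancel_left₀ hg.ne']
  simp only [e]
  rw [lintegral_const_mul' _ _ ENNReal.ofReal_ne_top, lintegral_lintegral_swap]
  · have e2 : ∀ s ∈ Set.Ioi (0 : ℝ), ∫⁻ μ in C,
        ENNReal.ofReal (s ^ m * exp (-(s ^ 2 * (1 + coneForm r μ)) / 2)) =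
        ENNReal.ofReal (s ^ 0 * exp (-s ^ 2 / 2)) * coneGauss C r := by
      intro s hs
      have hs : (0 : ℝ) < s := hs
      rw [coneGauss, hC.setLIntegral hm (c := fun _ => s) (fun _ => hs)
        (fun μ => ENNReal.ofReal (exp (-coneForm r μ / 2))), Finset.prod_const, Finset.card_univ,
        Fintype.card_fin, ← mul_assoc, ← ENNReal.ofReal_mul (by positivity),
        ← lintegral_const_mul' _ _ ENNReal.ofReal_ne_top]
      refine lintegral_congr fun μ => ?_
      rw [← ENNReal.ofReal_mul (by positivity), coneForm_smul, pow_zero, one_mul,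
        mul_comm (exp _) (s ^ m), mul_assoc, ← Real.exp_add]
      congr 3
      ring
    rw [setLIntegral_congr_fun measurableSet_Ioi e2, lintegral_mul_const, lintegral_gaussMoment,
      ← mul_assoc, ← ENNReal.ofReal_mul (by positivity)]
    · congr 2
      ring
    · fun_prop
  · refine Measurable.aemeasurable ?_
    refine ENNReal.measurable_ofReal.comp (Continuous.measurable ?_)
    fun_prop

/-- The integral over point configurations of the cone integral for fixed radii. -/
def fixedRadius {m : ℕ} (C : Set (Fin m → ℝ)) (r : Fin (m + 1) → ℝ) : ENNReal :=
  ∫⁻ X : Fin (m + 1) → Fin m → ℝ, ENNReal.ofReal (exp (-(∑ i, r i ^ 2 * ∑ a, X i a ^ 2) / 2)) *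
    (ENNReal.ofReal (borderedDet (fun _ => 1) X) * ∫⁻ l in C,
      ENNReal.ofReal (exp (-(∑ a, (∑ j, l j * (X j.succ a - X 0 a)) ^ 2) / 2)))

theorem fixedRadius_eq {m : ℕ} {C : Set (Fin m → ℝ)} (hC : DiagStable C)
    (hm : MeasurableSet C) {r : Fin (m + 1) → ℝ} (hr : ∀ i, 0 < r i) :
    fixedRadius C r = ENNReal.ofReal (((∏ i, r i) ^ (m + 1))⁻¹ * ∏ j : Fin m, r j.succ) *
      (gaussDet r * (ENNReal.ofReal (gaussMoment 0 / gaussMoment m) * coneGauss C r)) := by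
  set R := ∏ i, r i with hR
  have hR0 : 0 < R := Finset.prod_pos fun i _ => hr i
  set S := ∏ j : Fin m, r j.succ with hS
  have hS0 : 0 < S := Finset.prod_pos fun i _ => hr _
  have hdet : (Matrix.diagonal fun i => (r i)⁻¹).det = R⁻¹ := by
    rw [Matrix.det_diagonal, Finset.prod_inv_distrib]
  set F : (Fin (m + 1) → Fin m → ℝ) → ENNReal := fun X =>
    ENNReal.ofReal (exp (-(∑ i, r i ^ 2 * ∑ a, X i a ^ 2) / 2)) *
    (ENNReal.ofReal (borderedDet (fun _ => 1) X) * ∫⁻ l in C,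
      ENNReal.ofReal (exp (-(∑ a, (∑ j, l j * (X j.succ a - X 0 a)) ^ 2) / 2))) with hF
  have h1 := lintegral_comp_mulArray (U := Matrix.diagonal fun i => (r i)⁻¹)
    (by rw [hdet]; exact (inv_pos.2 hR0).ne') F
  rw [hdet, abs_of_pos (inv_pos.2 hR0), inv_pow, inv_inv] at h1
  have harr : ∀ Y : Fin (m + 1) → Fin m → ℝ,
      mulArray (Matrix.diagonal fun i => (r i)⁻¹) Y = fun i a => (r i)⁻¹ * Y i a := by
    intro Y
    ext i a
    simp [mulArray, Matrix.diagonal_apply]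
  have hFY : ∀ Y : Fin (m + 1) → Fin m → ℝ, F (fun i a => (r i)⁻¹ * Y i a) =
      ENNReal.ofReal (R⁻¹ * S) * ∫⁻ μ in C, ENNReal.ofReal
        (borderedDet r Y * exp (-(sqNorm Y + sqComb (coneWeight r μ) Y) / 2)) := by
    intro Y
    simp only [hF]
    rw [borderedDet_scale hr, hC.setLIntegral hm (c := fun j => r j.succ) fun j => hr _, ← hR, ← hS,
      ← mul_assoc, ← mul_assoc, ← ENNReal.ofReal_mul (by positivity), ← ENNReal.ofReal_mul
      (mul_nonneg (exp_pos _).le (mul_nonneg (inv_pos.2 hR0).le (borderedDet_nonneg _ _))),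
      ← lintegral_const_mul' _ _ ENNReal.ofReal_ne_top,
      ← lintegral_const_mul' _ _ ENNReal.ofReal_ne_top]
    refine lintegral_congr fun μ => ?_
    have hb := borderedDet_nonneg r Y
    rw [← ENNReal.ofReal_mul (by positivity), ← ENNReal.ofReal_mul (by positivity)]
    congr 1
    have e1 : ∑ i, r i ^ 2 * ∑ a, ((r i)⁻¹ * Y i a) ^ 2 = sqNorm Y := by
      refine Finset.sum_congr rfl fun i _ => ?_
      rw [Finset.mul_sum]
      refine Finset.sum_congr rfl fun a _ => ?_
      have := (hr i).ne'
      field_simp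
    have e2 : ∑ a, (∑ j : Fin m, r j.succ * μ j * ((r j.succ)⁻¹ * Y j.succ a - (r 0)⁻¹ * Y 0 a)) ^ 2 =
        sqComb (coneWeight r μ) Y := by
      refine Finset.sum_congr rfl fun a _ => ?_
      congr 1
      rw [Fin.sum_univ_succ, coneWeight]
      simp only [Fin.cons_zero, Fin.cons_succ]
      have : ∀ j : Fin m, r j.succ * μ j * ((r j.succ)⁻¹ * Y j.succ a - (r 0)⁻¹ * Y 0 a) =
          μ j * Y j.succ a - (μ j * r j.succ) * ((r 0)⁻¹ * Y 0 a) := by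
        intro j
        have := (hr j.succ).ne'
        field_simp
      simp only [this]
      rw [Finset.sum_sub_distrib, ← Finset.sum_mul]
      ring
    rw [e1, e2, neg_add, add_div, Real.exp_add]
    ring
  have h2 : ∫⁻ Y : Fin (m + 1) → Fin m → ℝ, ∫⁻ μ in C, ENNReal.ofReal
        (borderedDet r Y * exp (-(sqNorm Y + sqComb (coneWeight r μ) Y) / 2)) =
      gaussDet r * (ENNReal.ofReal (gaussMoment 0 / gaussMoment m) * coneGauss C r) := by
    rw [lintegral_lintegral_swap]
    · simp only [lintegral_borderedDet_of_orthogonal (coneWeight_dotProduct (hr 0).ne' _),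
        coneWeight_dotProduct_self]
      rw [lintegral_mul_const, setLIntegral_coneForm_pow hC hm, mul_comm]
      have hcf : Continuous (coneForm r) := by unfold coneForm; fun_prop
      fun_prop
    · refine Measurable.aemeasurable ?_
      refine ENNReal.measurable_ofReal.comp (Continuous.measurable ?_)
      simp only [sqNorm, sqComb]
      refine ((continuous_borderedDet r).comp continuous_fst).mul ?_
      have : ∀ i, Continuous fun μ : Fin m → ℝ => coneWeight r μ i := by
        intro i
        refine Fin.cases ?_ (fun j => ?_) i <;> simp only [coneWeight, Fin.cons_zero, Fin.cons_succ] <;>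
          fun_prop
      have h' : ∀ i, Continuous fun z : (Fin (m + 1) → Fin m → ℝ) × (Fin m → ℝ) =>
        coneWeight r z.2 i := fun i => (this i).comp continuous_snd
      fun_prop
  simp only [harr, hFY] at h1
  rw [lintegral_const_mul' _ _ ENNReal.ofReal_ne_top, h2] at h1
  have h3 : fixedRadius C r = ENNReal.ofReal (R ^ m)⁻¹ * (ENNReal.ofReal (R ^ m) * ∫⁻ Y, F Y) := by
    rw [← mul_assoc, ← ENNReal.ofReal_mul (by positivity), inv_mul_cancel₀ (by positivity),
      ENNReal.ofReal_one, one_mul, fixedRadius]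
  rw [h3, ← h1, ← mul_assoc, ← ENNReal.ofReal_mul (by positivity)]
  congr 2
  rw [pow_succ, mul_inv]
  ring

/-- The open positive orthant. -/
def orthant (n : ℕ) : Set (Fin n → ℝ) := Set.univ.pi fun _ => Set.Ioi 0

theorem mem_orthant {n : ℕ} {r : Fin n → ℝ} : r ∈ orthant n ↔ ∀ i, 0 < r i := by
  simp [orthant]

theorem measurableSet_orthant (n : ℕ) : MeasurableSet (orthant n) :=
  MeasurableSet.univ_pi fun _ => measurableSet_Ioi

theorem diagStable_orthant (n : ℕ) : DiagStable (orthant n) := fun c hc μ => by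
  simp only [mem_orthant, mul_pos_iff_of_pos_left (hc _)]

theorem measurable_coneGauss {m : ℕ} (C : Set (Fin m → ℝ)) :
    Measurable (coneGauss C : (Fin (m + 1) → ℝ) → ENNReal) := by
  refine Measurable.lintegral_prod_right' (f := fun z : (Fin (m + 1) → ℝ) × (Fin m → ℝ) =>
    ENNReal.ofReal (exp (-coneForm z.1 z.2 / 2))) ?_
  unfold coneForm
  fun_prop

theorem coneGauss_smul {m : ℕ} (C : Set (Fin m → ℝ)) {c : ℝ} (hc : c ≠ 0) (r : Fin (m + 1) → ℝ) :
    coneGauss C (fun i => c * r i) = coneGauss C r := by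
  simp only [coneGauss, coneForm_smul_left r hc]

/-- The extended nonnegative version of `angleIntegral` for a general cone. -/
def coneAngle {m : ℕ} (a : ℕ) (C : Set (Fin m → ℝ)) : ENNReal :=
  ∫⁻ r in orthant (m + 1), ENNReal.ofReal (∏ i, r i ^ a * exp (-r i ^ 2 / 2)) *
    (ENNReal.ofReal (r 0)⁻¹ * coneGauss C r)

/-- A variant of `coneAngle` weighted by the norm of the radii. -/
def coneAngleNorm {m : ℕ} (a : ℕ) (C : Set (Fin m → ℝ)) : ENNReal :=
  ∫⁻ r in orthant (m + 1), ENNReal.ofReal (∏ i, r i ^ a * exp (-r i ^ 2 / 2)) *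
    (ENNReal.ofReal ((r 0)⁻¹ * √(r ⬝ᵥ r)) * coneGauss C r)

theorem dotProduct_self_pos_of_mem_orthant {n : ℕ} {r : Fin (n + 1) → ℝ} (hr : r ∈ orthant (n + 1)) :
    0 < r ⬝ᵥ r :=
  Finset.sum_pos (fun i _ => mul_pos (mem_orthant.1 hr i) (mem_orthant.1 hr i)) Finset.univ_nonempty

theorem prod_pow_mul_gauss {n : ℕ} (a : ℕ) (r : Fin n → ℝ) :
    ∏ i, r i ^ a * exp (-r i ^ 2 / 2) = (∏ i, r i) ^ a * exp (-(r ⬝ᵥ r) / 2) := by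
  rw [Finset.prod_mul_distrib, Finset.prod_pow, ← Real.exp_sum, ← Finset.sum_div,
    Finset.sum_neg_distrib, dotProduct]
  simp only [sq]

theorem exists_mul_coneAngle_eq (m a : ℕ) : ∃ K : ENNReal, ∀ C : Set (Fin m → ℝ),
    ENNReal.ofReal (gaussMoment 0) * coneAngle a C = K * coneAngleNorm a C := by
  set c : ℝ → ℝ := fun t => √(1 + t ^ 2) with hc
  have hc0 : ∀ t, 0 < c t := fun t => sqrt_pos.2 (by positivity)
  refine ⟨∫⁻ t in Set.Ioi (0 : ℝ), ENNReal.ofReal ((c t ^ ((m + 1) * a))⁻¹ * (c t ^ (m + 1))⁻¹),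
    fun C => ?_⟩
  have hmeas : Measurable (coneGauss C : (Fin (m + 1) → ℝ) → ENNReal) := measurable_coneGauss C
  rw [coneAngle, ← lintegral_const_mul' _ _ ENNReal.ofReal_ne_top]
  have e1 : ∀ r ∈ orthant (m + 1), ENNReal.ofReal (gaussMoment 0) *
      (ENNReal.ofReal (∏ i, r i ^ a * exp (-r i ^ 2 / 2)) *
        (ENNReal.ofReal (r 0)⁻¹ * coneGauss C r)) =
      ∫⁻ t in Set.Ioi (0 : ℝ), ENNReal.ofReal ((∏ i, r i) ^ a * exp (-((r ⬝ᵥ r) * (1 + t ^ 2)) / 2) *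
        ((r 0)⁻¹ * √(r ⬝ᵥ r))) * coneGauss C r := by
    intro r hr
    have hd := dotProduct_self_pos_of_mem_orthant hr
    have hr0 := mem_orthant.1 hr
    have hp : 0 < ∏ i, r i := Finset.prod_pos fun i _ => hr0 i
    have h0 := hr0 0
    have h := lintegral_pow_mul_exp_sq 0 hd
    have e : ∀ t : ℝ, ENNReal.ofReal ((∏ i, r i) ^ a * exp (-((r ⬝ᵥ r) * (1 + t ^ 2)) / 2) *
        ((r 0)⁻¹ * √(r ⬝ᵥ r))) * coneGauss C r =
        ENNReal.ofReal (t ^ 0 * exp (-(t ^ 2 * (r ⬝ᵥ r)) / 2)) *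
        (ENNReal.ofReal ((∏ i, r i) ^ a * exp (-(r ⬝ᵥ r) / 2) * ((r 0)⁻¹ * √(r ⬝ᵥ r))) *
          coneGauss C r) := by
      intro t
      rw [← mul_assoc (ENNReal.ofReal (t ^ 0 * _)), ← ENNReal.ofReal_mul (by positivity)]
      congr 2
      rw [show -((r ⬝ᵥ r) * (1 + t ^ 2)) / 2 = -(t ^ 2 * (r ⬝ᵥ r)) / 2 + -(r ⬝ᵥ r) / 2 by ring,
        Real.exp_add]
      ring
    simp only [e]
    rw [lintegral_mul_const _ (by fun_prop), h, prod_pow_mul_gauss, ← mul_assoc, ← mul_assoc,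
      ← mul_assoc, ← ENNReal.ofReal_mul (gaussMoment_pos 0).le, ← ENNReal.ofReal_mul
      (mul_nonneg (gaussMoment_pos 0).le (by positivity)), ← ENNReal.ofReal_mul
      (mul_nonneg (gaussMoment_pos 0).le (by positivity))]
    congr 2
    have := (sqrt_pos.2 hd).ne'
    field_simp
    ring
  rw [setLIntegral_congr_fun (measurableSet_orthant _) e1, lintegral_lintegral_swap]
  · rw [← lintegral_mul_const]
    · refine lintegral_congr fun t => ?_
      have ht := hc0 t
      have ht2 : c t ^ 2 = 1 + t ^ 2 := Real.sq_sqrt (by positivity)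
      rw [coneAngleNorm, (diagStable_orthant (m + 1)).setLIntegral (measurableSet_orthant _)
        (c := fun _ => c t) (fun _ => ht) fun r =>
          ENNReal.ofReal (∏ i, r i ^ a * exp (-r i ^ 2 / 2)) *
            (ENNReal.ofReal ((r 0)⁻¹ * √(r ⬝ᵥ r)) * coneGauss C r), Finset.prod_const, Finset.card_univ, Fintype.card_fin,
        ← mul_assoc, ← ENNReal.ofReal_mul (by positivity), mul_assoc, inv_mul_cancel₀ (by positivity),
        mul_one, ← lintegral_const_mul' _ _ ENNReal.ofReal_ne_top]
      refine setLIntegral_congr_fun (measurableSet_orthant _) fun r hr => ?_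
      have hr0 := mem_orthant.1 hr
      have hp : 0 < ∏ i, r i := Finset.prod_pos fun i _ => hr0 i
      have h0 := hr0 0
      have hdot : (fun i => c t * r i) ⬝ᵥ (fun i => c t * r i) = c t ^ 2 * (r ⬝ᵥ r) := by
        simp only [dotProduct, Finset.mul_sum]
        exact Finset.sum_congr rfl fun i _ => by ring
      simp only
      rw [coneGauss_smul C ht.ne', prod_pow_mul_gauss a (fun i => c t * r i), hdot,
        Finset.prod_mul_distrib, Finset.prod_const, Finset.card_univ, Fintype.card_fin,
        ← mul_assoc (ENNReal.ofReal (_ * _)) (ENNReal.ofReal _) (coneGauss C r),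
        ← ENNReal.ofReal_mul (by positivity),
        ← mul_assoc (ENNReal.ofReal _) (ENNReal.ofReal _) (coneGauss C r),
        ← ENNReal.ofReal_mul (by positivity)]
      congr 2
      rw [Real.sqrt_mul (by positivity), Real.sqrt_sq ht.le, mul_pow, ← pow_mul, ht2]
      have := ht.ne'
      field_simp
    · simp only [hc]
      fun_prop
  · refine Measurable.aemeasurable ?_
    simp only [dotProduct, Function.uncurry_def]
    refine Measurable.mul ?_ (hmeas.comp measurable_fst)
    fun_prop

theorem lintegral_fixedRadius_eq {m : ℕ} (a : ℕ) {C : Set (Fin m → ℝ)} (hC : DiagStable C)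
    (hm : MeasurableSet C) :
    ∫⁻ r in orthant (m + 1), ENNReal.ofReal (∏ i, r i ^ (a + m) * exp (-r i ^ 2 / 2)) *
      fixedRadius C r =
    gaussDet (Pi.single 0 1 : Fin (m + 1) → ℝ) * ENNReal.ofReal (gaussMoment 0 / gaussMoment m) *
      coneAngleNorm a C := by
  have hmeas : Measurable (coneGauss C : (Fin (m + 1) → ℝ) → ENNReal) := measurable_coneGauss C
  rw [coneAngleNorm, ← lintegral_const_mul]
  · refine setLIntegral_congr_fun (measurableSet_orthant _) fun r hr => ?_
    have hr0 := mem_orthant.1 hr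
    have hp : 0 < ∏ i, r i := Finset.prod_pos fun i _ => hr0 i
    have hq : 0 < ∏ j : Fin m, r j.succ := Finset.prod_pos fun i _ => hr0 _
    have h0 := hr0 0
    rw [fixedRadius_eq hC hm hr0, gaussDet_eq r]
    set κ := gaussDet (Pi.single 0 1 : Fin (m + 1) → ℝ)
    set G := ENNReal.ofReal (gaussMoment 0 / gaussMoment m)
    have e : ENNReal.ofReal (∏ i, r i ^ (a + m) * exp (-r i ^ 2 / 2)) *
        ENNReal.ofReal (((∏ i, r i) ^ (m + 1))⁻¹ * ∏ j : Fin m, r j.succ) =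
        ENNReal.ofReal (∏ i, r i ^ a * exp (-r i ^ 2 / 2)) * ENNReal.ofReal (r 0)⁻¹ := by
      rw [prod_pow_mul_gauss, prod_pow_mul_gauss, ← ENNReal.ofReal_mul (by positivity),
        ← ENNReal.ofReal_mul (by positivity)]
      congr 1
      rw [Fin.prod_univ_succ] at hp ⊢
      rw [pow_add, pow_succ _ m]
      field_simp
    rw [ENNReal.ofReal_mul (inv_pos.2 h0).le, ← mul_assoc, e]
    ring
  · simp only [dotProduct]
    fun_prop

theorem lintegral_fin_prod {α : Type*} [MeasurableSpace α] {n : ℕ} (μ : Fin n → Measure α)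
    [∀ i, SigmaFinite (μ i)] {f : Fin n → α → ENNReal} (hf : ∀ i, Measurable (f i)) :
    ∫⁻ x, ∏ i, f i (x i) ∂(Measure.pi μ) = ∏ i, ∫⁻ x, f i x ∂(μ i) := by
  induction n with
  | zero => simp [Measure.pi_of_empty μ]
  | succ n ih =>
    rw [← (measurePreserving_piFinSuccAbove μ 0).symm.lintegral_comp (by fun_prop)]
    have e : ∀ z : α × (Fin n → α),
        ∏ i, f i ((MeasurableEquiv.piFinSuccAbove (fun _ => α) 0).symm z i) =
        f 0 z.1 * ∏ i : Fin n, f i.succ (z.2 i) := by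
      intro z
      rw [Fin.prod_univ_succ]
      rfl
    simp only [e]
    rw [lintegral_prod_mul (f := f 0) (g := fun y : Fin n → α => ∏ i : Fin n, f i.succ (y i)) (hf 0).aemeasurable
      (Finset.measurable_prod _ fun i _ => (hf i.succ).comp (measurable_pi_apply i)).aemeasurable]
    have := ih (fun i => μ i.succ) (f := fun i => f i.succ) fun i => hf _
    simp only [Fin.zero_succAbove]
    rw [this, Fin.prod_univ_succ]

theorem pi_withDensity_eq {α : Type*} [MeasurableSpace α] {n : ℕ} (μ : Measure α)
    [SigmaFinite μ] {f : α → ENNReal} (hf : Measurable f) [SigmaFinite (μ.withDensity f)] :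
    Measure.pi (fun _ : Fin n => μ.withDensity f) =
      (Measure.pi fun _ : Fin n => μ).withDensity fun x => ∏ i, f (x i) := by
  refine Measure.pi_eq fun s hs => ?_
  rw [withDensity_apply _ (MeasurableSet.univ_pi hs), Measure.restrict_pi_pi,
    lintegral_fin_prod _ (f := fun _ => f) fun _ => hf]
  exact Finset.prod_congr rfl fun i _ => (withDensity_apply _ (hs i)).symm

theorem integral_gauss_radial {m : ℕ} (s : ℝ) (hs : 0 < s) :
    ∫⁻ x : Fin m → ℝ, ENNReal.ofReal (exp (-(s ^ 2 * ∑ a, x a ^ 2) / 2)) =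
      ENNReal.ofReal ((√(2 * π) / s) ^ m) := by
  have h1 : ∫⁻ x : ℝ, ENNReal.ofReal (exp (-(s ^ 2 * x ^ 2) / 2)) =
      ENNReal.ofReal (√(2 * π) / s) := by
    have e : ∀ x : ℝ, exp (-(s ^ 2 * x ^ 2) / 2) = exp (-(s ^ 2 / 2) * x ^ 2) := fun x => by
      ring_nf
    simp only [e]
    rw [← ofReal_integral_eq_lintegral_ofReal (integrable_exp_neg_mul_sq (by positivity))
      (.of_forall fun x => (exp_pos _).le), integral_gaussian]
    congr 1
    rw [show π / (s ^ 2 / 2) = 2 * π / s ^ 2 by field_simp, Real.sqrt_div (by positivity),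
      Real.sqrt_sq hs.le]
  have e : ∀ x : Fin m → ℝ, ENNReal.ofReal (exp (-(s ^ 2 * ∑ a, x a ^ 2) / 2)) =
      ∏ a, ENNReal.ofReal (exp (-(s ^ 2 * x a ^ 2) / 2)) := by
    intro x
    rw [← ENNReal.ofReal_prod_of_nonneg fun _ _ => (exp_pos _).le, ← Real.exp_sum,
      ← Finset.sum_div, Finset.sum_neg_distrib, Finset.mul_sum]
  simp only [e]
  rw [volume_pi, lintegral_fin_prod _ (f := fun _ x => ENNReal.ofReal (exp (-(s ^ 2 * x ^ 2) / 2)))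
    (fun _ => by fun_prop), Finset.prod_const, Finset.card_univ, Fintype.card_fin, h1,
    ENNReal.ofReal_pow (by positivity)]

theorem gaussMoment_eq_Gamma (a : ℕ) :
    gaussMoment a = (1 / 2 : ℝ) ^ (-((a : ℝ) + 1) / 2) * (1 / 2) * Gamma (((a : ℝ) + 1) / 2) := by
  rw [← integral_rpow_mul_exp_neg_mul_rpow (p := 2) (q := a) (b := 1 / 2) (by norm_num)
    (by have : (0 : ℝ) ≤ a := a.cast_nonneg
        linarith) (by norm_num), gaussMoment]
  refine setIntegral_congr_fun measurableSet_Ioi fun r hr => ?_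
  simp only [rpow_natCast, rpow_two]
  congr 2
  ring

/-- The normalizing constant of `betaPrimeDensity`. -/
def betaConst (m : ℕ) (β : ℝ) : ℝ :=
  Gamma β / (π ^ ((m : ℝ) / 2) * Gamma (β - (m : ℝ) / 2))

theorem betaConst_mul_gaussMoment {m a : ℕ} {β : ℝ} (h : 2 * β = a + m + 1) :
    betaConst m β * (√(2 * π) ^ m * gaussMoment a) = gaussMoment (a + m) := by
  have hβ : β = (((a + m : ℕ) : ℝ) + 1) / 2 := by push_cast; linarith
  have hβ' : β - m / 2 = ((a : ℝ) + 1) / 2 := by linarith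
  have hg : 0 < Gamma (((a : ℝ) + 1) / 2) := Gamma_pos_of_pos (by positivity)
  rw [gaussMoment_eq_Gamma, gaussMoment_eq_Gamma, betaConst, hβ', hβ]
  have e1 : (1 / 2 : ℝ) ^ (-(((a + m : ℕ) : ℝ) + 1) / 2) =
      (1 / 2 : ℝ) ^ (-((a : ℝ) + 1) / 2) * 2 ^ ((m : ℝ) / 2) := by
    rw [show (-(((a + m : ℕ) : ℝ) + 1) / 2) = -((a : ℝ) + 1) / 2 + -((m : ℝ) / 2) by
      push_cast; ring, rpow_add (by norm_num), rpow_neg (by norm_num) ((m : ℝ) / 2), one_div,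
      inv_rpow (by norm_num), inv_rpow (by norm_num), inv_inv]
  have e2 : √(2 * π) ^ m = 2 ^ ((m : ℝ) / 2) * π ^ ((m : ℝ) / 2) := by
    rw [← mul_rpow (by norm_num) pi_pos.le, sqrt_eq_rpow, ← rpow_natCast, ← rpow_mul (by positivity)]
    congr 1
    ring
  have hp : 0 < π ^ ((m : ℝ) / 2) := by positivity
  rw [e1, e2]
  field_simp

theorem betaPrimeDensity_toLp {m a : ℕ} {β : ℝ} (h : 2 * β = a + m + 1) (x : Fin m → ℝ) :
    ENNReal.ofReal (betaPrimeDensity m β (WithLp.toLp 2 x)) =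
      ENNReal.ofReal (betaConst m β / gaussMoment (a + m)) * ∫⁻ s in Set.Ioi (0 : ℝ),
        ENNReal.ofReal (s ^ (a + m) * exp (-s ^ 2 / 2)) *
          ENNReal.ofReal (exp (-(s ^ 2 * ∑ b, x b ^ 2) / 2)) := by
  have hA : 0 < 1 + ∑ b, x b ^ 2 := by positivity
  have e : ∀ s ∈ Set.Ioi (0 : ℝ), ENNReal.ofReal (s ^ (a + m) * exp (-s ^ 2 / 2)) *
      ENNReal.ofReal (exp (-(s ^ 2 * ∑ b, x b ^ 2) / 2)) =
      ENNReal.ofReal (s ^ (a + m) * exp (-(s ^ 2 * (1 + ∑ b, x b ^ 2)) / 2)) := by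
    intro s hs
    have hs : (0 : ℝ) < s := hs
    rw [← ENNReal.ofReal_mul (by positivity), mul_assoc, ← Real.exp_add]
    congr 3
    ring
  have hb : 0 < betaConst m β := by
    have := betaConst_mul_gaussMoment h
    have h1 := gaussMoment_pos a
    have h2 := gaussMoment_pos (a + m)
    rw [← this] at h2
    exact pos_of_mul_pos_left h2 (by positivity)
  have hg := gaussMoment_pos (a + m)
  rw [setLIntegral_congr_fun measurableSet_Ioi e, lintegral_pow_mul_exp_sq _ hA,
    ← ENNReal.ofReal_mul (by positivity), betaPrimeDensity, ← betaConst, EuclideanSpace.norm_sq_eq]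
  simp only [Real.norm_eq_abs, sq_abs]
  congr 1
  have : (√(1 + ∑ b, x b ^ 2) ^ (a + m + 1))⁻¹ = (1 + ∑ b, x b ^ 2) ^ (-β) := by
    rw [rpow_neg hA.le, sqrt_eq_rpow, ← rpow_natCast, ← rpow_mul hA.le]
    congr 2
    push_cast
    linarith
  rw [this]
  field_simp

theorem measurable_betaPrimeDensity (m : ℕ) (β : ℝ) :
    Measurable fun x => ENNReal.ofReal (betaPrimeDensity m β x) := by
  unfold betaPrimeDensity
  fun_prop

theorem isProbabilityMeasure_betaPrimeMeasure {m a : ℕ} {β : ℝ} (h : 2 * β = a + m + 1) :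
    IsProbabilityMeasure (betaPrimeMeasure m β) := by
  constructor
  have hg := gaussMoment_pos (a + m)
  rw [betaPrimeMeasure, withDensity_apply _ MeasurableSet.univ, Measure.restrict_univ,
    ← (PiLp.volume_preserving_toLp (Fin m)).lintegral_comp (measurable_betaPrimeDensity m β)]
  simp only [betaPrimeDensity_toLp h]
  rw [lintegral_const_mul' _ _ ENNReal.ofReal_ne_top, lintegral_lintegral_swap]
  · have e : ∀ s ∈ Set.Ioi (0 : ℝ), ∫⁻ x : Fin m → ℝ,
        ENNReal.ofReal (s ^ (a + m) * exp (-s ^ 2 / 2)) *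
          ENNReal.ofReal (exp (-(s ^ 2 * ∑ b, x b ^ 2) / 2)) =
        ENNReal.ofReal (√(2 * π) ^ m) * ENNReal.ofReal (s ^ a * exp (-s ^ 2 / 2)) := by
      intro s hs
      have hs : (0 : ℝ) < s := hs
      rw [lintegral_const_mul' _ _ ENNReal.ofReal_ne_top, integral_gauss_radial s hs,
        ← ENNReal.ofReal_mul (by positivity), ← ENNReal.ofReal_mul (by positivity)]
      congr 1
      rw [div_pow, pow_add]
      field_simp
    rw [setLIntegral_congr_fun measurableSet_Ioi e, lintegral_const_mul' _ _ ENNReal.ofReal_ne_top,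
      lintegral_gaussMoment, ← ENNReal.ofReal_mul (by positivity),
      ← ENNReal.ofReal_mul' (mul_nonneg (by positivity) (gaussMoment_pos a).le), div_mul_eq_mul_div,
      betaConst_mul_gaussMoment h, div_self hg.ne', ENNReal.ofReal_one]
  · fun_prop

theorem lintegral_betaPrime_eq {m a : ℕ} {β : ℝ} (h : 2 * β = a + m + 1)
    {H : (Fin (m + 1) → Fin m → ℝ) → ENNReal} (hH : Measurable H) :
    ∫⁻ X, H (fun i => WithLp.ofLp (X i)) ∂(Measure.pi fun _ : Fin (m + 1) => betaPrimeMeasure m β) =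
      ENNReal.ofReal (betaConst m β / gaussMoment (a + m)) ^ (m + 1) *
      ∫⁻ r in orthant (m + 1), ENNReal.ofReal (∏ i, r i ^ (a + m) * exp (-r i ^ 2 / 2)) *
        ∫⁻ X : Fin (m + 1) → Fin m → ℝ,
          ENNReal.ofReal (exp (-(∑ i, r i ^ 2 * ∑ a, X i a ^ 2) / 2)) * H X := by
  have hd := measurable_betaPrimeDensity m β
  have := isProbabilityMeasure_betaPrimeMeasure h
  have hfin : SigmaFinite (volume.withDensity fun x => ENNReal.ofReal (betaPrimeDensity m β x)) := by
    change SigmaFinite (betaPrimeMeasure m β)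
    infer_instance
  have hp : Measurable fun x : Fin (m + 1) → EuclideanSpace ℝ (Fin m) =>
      ∏ i, ENNReal.ofReal (betaPrimeDensity m β (x i)) :=
    Finset.measurable_prod _ fun i _ => hd.comp (measurable_pi_apply i)
  have hH' : Measurable fun X : Fin (m + 1) → EuclideanSpace ℝ (Fin m) =>
      H fun i => WithLp.ofLp (X i) := hH.comp (by fun_prop)
  simp only [betaPrimeMeasure]
  rw [pi_withDensity_eq _ hd, lintegral_withDensity_eq_lintegral_mul _ hp hH',
    ← volume_pi, ← (volume_preserving_pi fun _ : Fin (m + 1) =>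
      PiLp.volume_preserving_toLp (Fin m)).lintegral_comp (hp.mul hH')]
  have e : ∀ X : Fin (m + 1) → Fin m → ℝ,
      ((fun x : Fin (m + 1) → EuclideanSpace ℝ (Fin m) =>
        ∏ i, ENNReal.ofReal (betaPrimeDensity m β (x i))) *
        fun X : Fin (m + 1) → EuclideanSpace ℝ (Fin m) => H fun i => WithLp.ofLp (X i)) (fun i => WithLp.toLp 2 (X i)) =
      ENNReal.ofReal (betaConst m β / gaussMoment (a + m)) ^ (m + 1) *
        ∫⁻ r in orthant (m + 1), ENNReal.ofReal (∏ i, r i ^ (a + m) * exp (-r i ^ 2 / 2)) *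
          (ENNReal.ofReal (exp (-(∑ i, r i ^ 2 * ∑ a, X i a ^ 2) / 2)) * H X) := by
    intro X
    simp only [Pi.mul_apply, betaPrimeDensity_toLp h]
    rw [Finset.prod_mul_distrib, Finset.prod_const, Finset.card_univ, Fintype.card_fin, mul_assoc,
      ← lintegral_fin_prod (fun _ : Fin (m + 1) => volume.restrict (Set.Ioi (0 : ℝ)))
        (f := fun i s => ENNReal.ofReal (s ^ (a + m) * exp (-s ^ 2 / 2)) *
          ENNReal.ofReal (exp (-(s ^ 2 * ∑ b, X i b ^ 2) / 2))) (fun i => by fun_prop),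
      ← Measure.restrict_pi_pi, ← lintegral_mul_const _ (by fun_prop)]
    congr 1
    refine setLIntegral_congr_fun (measurableSet_orthant _) fun r hr => ?_
    have hr0 := mem_orthant.1 hr
    rw [Finset.prod_mul_distrib, ← ENNReal.ofReal_prod_of_nonneg, ← ENNReal.ofReal_prod_of_nonneg,
      ← Real.exp_sum, ← Finset.sum_div, Finset.sum_neg_distrib, mul_assoc]
    · exact fun i _ => (exp_pos _).le
    · intro i _
      have := hr0 i
      positivity
  refine (lintegral_congr e).trans ?_
  rw [lintegral_const_mul' _ _ (ENNReal.pow_ne_top ENNReal.ofReal_ne_top), lintegral_lintegral_swap]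
  · congr 1
    refine lintegral_congr fun r => ?_
    rw [lintegral_const_mul' _ _ ENNReal.ofReal_ne_top]
  · refine Measurable.aemeasurable ?_
    simp only [Function.uncurry_def]
    refine Measurable.mul (by fun_prop) (Measurable.mul (by fun_prop) (hH.comp measurable_fst))

theorem lintegral_cone_norm {E : Type*} [NormedAddCommGroup E] [NormedSpace ℝ E]
    [FiniteDimensional ℝ E] [MeasurableSpace E] [BorelSpace E] [Nontrivial E] (μ : Measure E)
    [μ.IsAddHaarMeasure] {S : Set E} (hS : MeasurableSet S)
    (hc : ∀ t : ℝ, 0 < t → ∀ v, t • v ∈ S ↔ v ∈ S) {f : ℝ → ENNReal} (hf : Measurable f) :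
    ∫⁻ v in S, f ‖v‖ ∂μ = μ.toSphere {u | (u : E) ∈ S} *
      ∫⁻ s : Set.Ioi (0 : ℝ), f s ∂(Measure.volumeIoiPow (Module.finrank ℝ E - 1)) := by
  have hmp := μ.measurePreserving_homeomorphUnitSphereProd
  have hA : MeasurableSet {u : Metric.sphere (0 : E) 1 | (u : E) ∈ S} :=
    measurable_subtype_coe hS
  set F : E → ENNReal := S.indicator fun v => f ‖v‖ with hF
  have h1 : ∫⁻ v, F v ∂μ = ∫⁻ v : ({0}ᶜ : Set E), F v ∂(μ.comap (↑)) := by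
    rw [lintegral_subtype_comap (measurableSet_singleton _).compl, restrict_compl_singleton]
  rw [← lintegral_indicator hS, ← hF, h1]
  set G : Metric.sphere (0 : E) 1 × Set.Ioi (0 : ℝ) → ENNReal := fun z =>
    ({u : Metric.sphere (0 : E) 1 | (u : E) ∈ S}.indicator (fun _ => 1) z.1) * f z.2 with hG
  have hGm : Measurable G := ((measurable_const.indicator hA).comp measurable_fst).mul (by fun_prop)
  have h2 : ∀ v : ({0}ᶜ : Set E), F v = G (homeomorphUnitSphereProd E v) := by
    rintro ⟨v, hv⟩
    have hv' : 0 < ‖v‖ := norm_pos_iff.2 hv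
    have hmem : (homeomorphUnitSphereProd E ⟨v, hv⟩).1 ∈
        {u : Metric.sphere (0 : E) 1 | (u : E) ∈ S} ↔ v ∈ S := by
      rw [Set.mem_ofPred_eq, homeomorphUnitSphereProd_apply_fst_coe]
      exact hc _ (inv_pos.2 hv') v
    by_cases h : v ∈ S
    · rw [hF, hG]
      simp only
      rw [Set.indicator_of_mem h, Set.indicator_of_mem (hmem.2 h),
        homeomorphUnitSphereProd_apply_snd_coe, one_mul]
    · rw [hF, hG]
      simp only
      rw [Set.indicator_of_notMem h, Set.indicator_of_notMem (mt hmem.1 h), zero_mul]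
  rw [lintegral_congr h2, hmp.lintegral_comp hGm]
  simp only [hG]
  rw [lintegral_prod_mul (f := {u : Metric.sphere (0 : E) 1 | (u : E) ∈ S}.indicator fun _ => 1)
    (g := fun s : Set.Ioi (0 : ℝ) => f s)
    (measurable_const.indicator hA).aemeasurable (by fun_prop), lintegral_indicator hA,
    setLIntegral_one]

theorem sphereUnif_univ {m : ℕ} (hm : 0 < m) : sphereUnif m Set.univ = 1 := by
  have : Nonempty (Fin m) := ⟨⟨0, hm⟩⟩
  have h0 : (volume : Measure (EuclideanSpace ℝ (Fin m))).toSphere Set.univ ≠ 0 :=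
    fun h => Measure.toSphere_ne_zero (volume : Measure (EuclideanSpace ℝ (Fin m)))
      (Measure.measure_univ_eq_zero.1 h)
  rw [sphereUnif, Measure.smul_apply, smul_eq_mul, ENNReal.inv_mul_cancel h0 (measure_ne_top _ _)]

theorem sphereUnif_mul_eq {m : ℕ} (hm : 0 < m) {S : Set (EuclideanSpace ℝ (Fin m))}
    (hS : MeasurableSet S) (hc : ∀ t : ℝ, 0 < t → ∀ v, t • v ∈ S ↔ v ∈ S) :
    sphereUnif m {u | (u : EuclideanSpace ℝ (Fin m)) ∈ S} *
      (∫⁻ v : EuclideanSpace ℝ (Fin m), ENNReal.ofReal (exp (-‖v‖ ^ 2 / 2))) =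
    ∫⁻ v in S, ENNReal.ofReal (exp (-‖v‖ ^ 2 / 2)) := by
  have : Nonempty (Fin m) := ⟨⟨0, hm⟩⟩
  have hf : Measurable fun s : ℝ => ENNReal.ofReal (exp (-s ^ 2 / 2)) := by fun_prop
  have h := lintegral_cone_norm (volume : Measure (EuclideanSpace ℝ (Fin m))) MeasurableSet.univ
    (fun _ _ _ => Iff.rfl) hf
  rw [Measure.restrict_univ] at h
  rw [h, lintegral_cone_norm _ hS hc hf]
  have := sphereUnif_univ hm
  simp only [sphereUnif, Measure.smul_apply, smul_eq_mul] at this ⊢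
  simp only [Set.mem_univ, Set.ofPred_true]
  rw [← mul_assoc, mul_right_comm _ _ (Measure.toSphere _ _), this, one_mul]

theorem mem_convexHull_range_iff {ι E : Type*} [Fintype ι] [AddCommGroup E] [Module ℝ E]
    (X : ι → E) (y : E) :
    y ∈ convexHull ℝ (Set.range X) ↔ ∃ w ∈ stdSimplex ℝ ι, ∑ i, w i • X i = y := by
  classical
  have h := LinearMap.image_convexHull (Fintype.linearCombination ℝ X)
    (Set.range fun i j : ι => if i = j then (1 : ℝ) else 0)
  rw [convexHull_basis_eq_stdSimplex, ← Set.range_comp] at h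
  have e : (Fintype.linearCombination ℝ X ∘ fun i j : ι => if i = j then (1 : ℝ) else 0) = X := by
    ext i
    simp [Fintype.linearCombination_apply]
  rw [e] at h
  rw [← h]
  simp [Fintype.linearCombination_apply]

/-- The matrix of edge vectors at the zeroth vertex. -/
def edgeMatrix {m : ℕ} (X : Fin (m + 1) → Fin m → ℝ) : Matrix (Fin m) (Fin m) ℝ :=
  Matrix.of fun a j => X j.succ a - X 0 a

theorem sum_smul_apply_eq {m : ℕ} (X : Fin (m + 1) → EuclideanSpace ℝ (Fin m))
    {w : Fin (m + 1) → ℝ} (hw : ∑ i, w i = 1) :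
    WithLp.ofLp (∑ i, w i • X i) =
      WithLp.ofLp (X 0) + (edgeMatrix fun i => WithLp.ofLp (X i)).mulVec fun j => w j.succ := by
  ext a
  rw [Fin.sum_univ_succ] at hw
  have h0 : w 0 = 1 - ∑ j : Fin m, w j.succ := by linarith
  simp only [Fin.sum_univ_succ, WithLp.ofLp_add, WithLp.ofLp_smul, WithLp.ofLp_sum, Pi.add_apply,
    Pi.smul_apply, smul_eq_mul, Finset.sum_apply, Matrix.mulVec, dotProduct, edgeMatrix,
    Matrix.of_apply, h0, sub_mul, Finset.sum_sub_distrib, one_mul, Finset.sum_mul]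
  have : ∀ j : Fin m, w j.succ * X j.succ a = X j.succ a * w j.succ := fun j => mul_comm _ _
  have : ∀ j : Fin m, w j.succ * X 0 a = X 0 a * w j.succ := fun j => mul_comm _ _
  simp only [*]
  ring

/-- The barycentric weights of the face spanned by the first `k` vertices. -/
def faceWeight (k : ℕ) {n : ℕ} (i : Fin n) : ℝ := if (i : ℕ) < k then (k : ℝ)⁻¹ else 0

theorem sum_faceWeight {n k : ℕ} (hk : 1 ≤ k) (hkn : k ≤ n) :
    ∑ i : Fin n, faceWeight k i = 1 := by
  have : (k : ℝ) ≠ 0 := by positivity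
  simp only [faceWeight]
  rw [← Finset.sum_filter, Finset.sum_const, Fin.card_filter_val_lt, min_eq_right hkn, nsmul_eq_mul,
    mul_inv_cancel₀ this]

theorem mem_internalCone_iff {m k : ℕ} (hk : 1 ≤ k) (hkm : k ≤ m + 1)
    {X : Fin (m + 1) → EuclideanSpace ℝ (Fin m)}
    (hX : (edgeMatrix fun i => WithLp.ofLp (X i)).det ≠ 0) (l : Fin m → ℝ) :
    (∃ ε : ℝ, 0 < ε ∧ ((k : ℝ)⁻¹ • ∑ i ∈ Finset.univ.filter (fun i : Fin (m + 1) => (i : ℕ) < k), X i) +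
      ε • WithLp.toLp 2 ((edgeMatrix fun i => WithLp.ofLp (X i)).mulVec l) ∈
        convexHull ℝ (Set.range X)) ↔ l ∈ Set.univ.pi (coneSide k) := by
  set D := edgeMatrix fun i => WithLp.ofLp (X i) with hD
  have hk0 : (0 : ℝ) < k := by exact_mod_cast hk
  have hg : (k : ℝ)⁻¹ • ∑ i ∈ Finset.univ.filter (fun i : Fin (m + 1) => (i : ℕ) < k), X i =
      ∑ i, faceWeight k i • X i := by
    rw [Finset.smul_sum, Finset.sum_filter]
    refine Finset.sum_congr rfl fun i _ => ?_
    rw [faceWeight]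
    split_ifs <;> simp
  have hs := sum_faceWeight hk hkm
  have key : ∀ (ε : ℝ) (w : Fin (m + 1) → ℝ), ∑ i, w i = 1 →
      (∑ i, w i • X i = ∑ i, faceWeight k i • X i + ε • WithLp.toLp 2 (D.mulVec l) ↔
        ∀ j : Fin m, w j.succ = faceWeight k j.succ + ε * l j) := by
    intro ε w hw
    rw [← (WithLp.ofLp_injective 2).eq_iff, WithLp.ofLp_add, WithLp.ofLp_smul,
      sum_smul_apply_eq X hw, sum_smul_apply_eq X hs, add_assoc, add_right_inj, ← hD,
      ← Matrix.mulVec_smul, ← Matrix.mulVec_add,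
      (Matrix.mulVec_injective_of_isUnit ((Matrix.isUnit_iff_isUnit_det D).2 hX.isUnit)).eq_iff,
      funext_iff]
    rfl
  have hmem : l ∈ Set.univ.pi (coneSide k) ↔ ∀ j : Fin m, k ≤ (j : ℕ) + 1 → 0 ≤ l j := by
    simp only [Set.mem_univ_pi, coneSide]
    refine forall_congr' fun j => ?_
    split_ifs with h <;> simp [h]
  rw [hmem, hg]
  simp only [mem_convexHull_range_iff]
  constructor
  · rintro ⟨ε, hε, w, hw, he⟩ j hj
    have h1 := (key ε w hw.2).1 he j
    have h2 := hw.1 j.succ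
    rw [h1, faceWeight, if_neg (by simpa using hj), zero_add] at h2
    exact nonneg_of_mul_nonneg_right h2 hε
  · intro h
    set A := ∑ j, |l j| with hA
    have hA0 : 0 ≤ A := Finset.sum_nonneg fun j _ => abs_nonneg _
    set ε := ((k : ℝ) * (1 + A))⁻¹ with hε
    have hε0 : 0 < ε := by positivity
    have hεA : ε * A ≤ (k : ℝ)⁻¹ := by
      rw [hε, mul_inv, mul_assoc]
      refine mul_le_of_le_one_right (by positivity) ?_
      rw [inv_mul_le_one₀ (by positivity)]
      linarith
    refine ⟨ε, hε0, Fin.cons (faceWeight k (0 : Fin (m + 1)) - ε * ∑ j, l j)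
      fun j => faceWeight k j.succ + ε * l j, ?_, ?_⟩
    · refine ⟨fun i => ?_, ?_⟩
      · refine Fin.cases ?_ (fun j => ?_) i
        · rw [Fin.cons_zero, faceWeight, if_pos (by simpa using Nat.lt_of_lt_of_le Nat.zero_lt_one hk)]
          have : ∑ j, l j ≤ A := Finset.sum_le_sum fun j _ => le_abs_self _
          have := mul_le_mul_of_nonneg_left this hε0.le
          linarith
        · rw [Fin.cons_succ, faceWeight]
          split_ifs with hj
          · have h1 : |l j| ≤ A := Finset.single_le_sum (f := fun j => |l j|)
              (fun _ _ => abs_nonneg _) (Finset.mem_univ j)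
            have h2 := mul_le_mul_of_nonneg_left ((neg_le_abs (l j)).trans h1) hε0.le
            linarith
          · rw [zero_add]
            exact mul_nonneg hε0.le (h j (by simpa using hj))
      · rw [Fin.sum_univ_succ] at hs ⊢
        simp only [Fin.cons_zero, Fin.cons_succ, Finset.sum_add_distrib, ← Finset.mul_sum]
        linarith
    · refine (key ε _ ?_).2 fun j => by rw [Fin.cons_succ]
      rw [Fin.sum_univ_succ] at hs ⊢
      simp only [Fin.cons_zero, Fin.cons_succ, Finset.sum_add_distrib, ← Finset.mul_sum]
      linarith

theorem measurableSet_coneSide (k m : ℕ) : MeasurableSet (Set.univ.pi (coneSide k (m := m))) := by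
  refine MeasurableSet.univ_pi fun j => ?_
  rw [coneSide]
  split_ifs
  exacts [measurableSet_Ici, MeasurableSet.univ]

theorem diagStable_coneSide (k m : ℕ) : DiagStable (Set.univ.pi (coneSide k (m := m))) := by
  intro c hc μ
  simp only [Set.mem_univ_pi, coneSide]
  refine forall_congr' fun j => ?_
  split_ifs
  · simp [hc j]
  · simp

/-- The Gaussian weight of the cone spanned by the edges of a simplex with coefficients in `C`. -/
def edgeGauss {m : ℕ} (C : Set (Fin m → ℝ)) (X : Fin (m + 1) → Fin m → ℝ) : ENNReal :=
  ENNReal.ofReal (borderedDet (fun _ => 1) X) * ∫⁻ l in C,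
    ENNReal.ofReal (exp (-(∑ a, (∑ j, l j * (X j.succ a - X 0 a)) ^ 2) / 2))

theorem sphereUnif_internal {m k : ℕ} (hm : 0 < m) (hk : 1 ≤ k) (hkm : k ≤ m + 1)
    {X : Fin (m + 1) → EuclideanSpace ℝ (Fin m)}
    (hX : (edgeMatrix fun i => WithLp.ofLp (X i)).det ≠ 0) :
    sphereUnif m {u | ∃ ε : ℝ, 0 < ε ∧ ((k : ℝ)⁻¹ •
      ∑ i ∈ Finset.univ.filter (fun i : Fin (m + 1) => (i : ℕ) < k), X i) +
      ε • (u : EuclideanSpace ℝ (Fin m)) ∈ convexHull ℝ (Set.range X)} *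
      (∫⁻ v : EuclideanSpace ℝ (Fin m), ENNReal.ofReal (exp (-‖v‖ ^ 2 / 2))) =
    edgeGauss (Set.univ.pi (coneSide k)) fun i => WithLp.ofLp (X i) := by
  set D := edgeMatrix fun i => WithLp.ofLp (X i) with hD
  set C := Set.univ.pi (coneSide k (m := m)) with hC
  have hu : IsUnit D.det := hX.isUnit
  set S : Set (EuclideanSpace ℝ (Fin m)) := {v | D⁻¹.mulVec (WithLp.ofLp v) ∈ C} with hS
  have hSm : MeasurableSet S := by
    refine measurableSet_preimage (f := fun v : EuclideanSpace ℝ (Fin m) =>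
      D⁻¹.mulVec (WithLp.ofLp v)) ?_ (measurableSet_coneSide k m)
    unfold Matrix.mulVec dotProduct
    fun_prop
  have hSc : ∀ t : ℝ, 0 < t → ∀ v, t • v ∈ S ↔ v ∈ S := by
    intro t ht v
    simp only [hS, Set.mem_ofPred_eq, WithLp.ofLp_smul, Matrix.mulVec_smul]
    exact diagStable_coneSide k m (fun _ => t) (fun _ => ht) _
  have hset : {u : Metric.sphere (0 : EuclideanSpace ℝ (Fin m)) 1 | ∃ ε : ℝ, 0 < ε ∧ ((k : ℝ)⁻¹ •
      ∑ i ∈ Finset.univ.filter (fun i : Fin (m + 1) => (i : ℕ) < k), X i) +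
      ε • (u : EuclideanSpace ℝ (Fin m)) ∈ convexHull ℝ (Set.range X)} =
      {u : Metric.sphere (0 : EuclideanSpace ℝ (Fin m)) 1 | (u : EuclideanSpace ℝ (Fin m)) ∈ S} := by
    ext u
    have h := mem_internalCone_iff hk hkm hX (D⁻¹.mulVec (WithLp.ofLp (u : EuclideanSpace ℝ (Fin m))))
    rw [← hD, Matrix.mulVec_mulVec, Matrix.mul_nonsing_inv _ hu, Matrix.one_mulVec] at h
    exact h
  rw [hset, sphereUnif_mul_eq hm hSm hSc, ← lintegral_indicator hSm,
    ← (PiLp.volume_preserving_toLp (Fin m)).lintegral_comp (Measurable.indicator (by fun_prop) hSm)]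
  have h := lintegral_comp_mulVec hX fun y => S.indicator
    (fun v => ENNReal.ofReal (exp (-‖v‖ ^ 2 / 2))) (WithLp.toLp 2 y)
  have h2 : ∀ y : Fin m → ℝ, S.indicator
      (fun v => ENNReal.ofReal (exp (-‖v‖ ^ 2 / 2))) (WithLp.toLp 2 (D.mulVec y)) =
      C.indicator (fun l => ENNReal.ofReal
        (exp (-(∑ a, (∑ j, l j * (X j.succ a - X 0 a)) ^ 2) / 2))) y := by
    intro y
    have hmem : WithLp.toLp 2 (D.mulVec y) ∈ S ↔ y ∈ C := by
      rw [hS, Set.mem_ofPred_eq, Matrix.mulVec_mulVec, Matrix.nonsing_inv_mul _ hu,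
        Matrix.one_mulVec]
    by_cases hy : y ∈ C
    · rw [Set.indicator_of_mem hy, Set.indicator_of_mem (hmem.2 hy), EuclideanSpace.norm_sq_eq]
      simp only [Real.norm_eq_abs, sq_abs, Matrix.mulVec, dotProduct, hD, edgeMatrix,
        Matrix.of_apply, mul_comm]
    · rw [Set.indicator_of_notMem hy, Set.indicator_of_notMem (mt hmem.1 hy)]
  simp only [h2] at h
  rw [lintegral_indicator (measurableSet_coneSide k m)] at h
  have hd : 0 < |D.det| := abs_pos.2 hX
  have hb := abs_det_sub_eq_borderedDet fun i => WithLp.ofLp (X i)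
  rw [edgeGauss, ← hb, h, ← mul_assoc, ← ENNReal.ofReal_mul (abs_nonneg _)]
  change _ = ENNReal.ofReal (|D.det| * |D.det|⁻¹) * _
  rw [mul_inv_cancel₀ hd.ne', ENNReal.ofReal_one, one_mul]

theorem measurable_edgeGauss {m : ℕ} (C : Set (Fin m → ℝ)) :
    Measurable (edgeGauss C : (Fin (m + 1) → Fin m → ℝ) → ENNReal) := by
  refine Measurable.mul (ENNReal.measurable_ofReal.comp (continuous_borderedDet _).measurable) ?_
  refine Measurable.lintegral_prod_right'
    (f := fun z : (Fin (m + 1) → Fin m → ℝ) × (Fin m → ℝ) => ENNReal.ofReal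
      (exp (-(∑ a, (∑ j, z.2 j * (z.1 j.succ a - z.1 0 a)) ^ 2) / 2))) ?_
  fun_prop

theorem ae_det_edgeMatrix_ne_zero (m : ℕ) :
    ∀ᵐ X : Fin (m + 1) → Fin m → ℝ, (edgeMatrix X).det ≠ 0 := by
  set Y : Fin (m + 1) → Fin m → ℝ := Fin.cons 0 fun j => Pi.single j 1 with hY
  have hcont : Continuous fun X : Fin (m + 1) → Fin m → ℝ => (edgeMatrix X).det :=
    Continuous.matrix_det (continuous_matrix fun i j => by
      simp only [edgeMatrix, Matrix.of_apply]
      fun_prop)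
  refine ae_mem_of_ae_add_linearMap_mem (LinearMap.toSpanSingleton ℝ _ Y) volume volume
    (s := {X | (edgeMatrix X).det ≠ 0}) (isOpen_ne.preimage hcont).measurableSet fun X => ?_
  have h : ∀ t : ℝ, (edgeMatrix (X + LinearMap.toSpanSingleton ℝ _ Y t)).det =
      (-edgeMatrix X).charpoly.eval t := by
    intro t
    rw [Matrix.eval_charpoly, sub_neg_eq_add]
    congr 1
    ext a j
    by_cases haj : a = j
    · subst haj
      simp [edgeMatrix, hY]
      ring
    · simp [edgeMatrix, hY, haj]
  simp only [Set.mem_ofPred_eq, h]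
  rw [ae_iff]
  simp only [not_not]
  refine ((Polynomial.finite_setOfPred_isRoot (Matrix.charpoly_monic _).ne_zero).subset
    fun t ht => ht).measure_zero _

theorem ae_betaPrime_of_ae {m : ℕ} (β : ℝ) [SigmaFinite (betaPrimeMeasure m β)]
    {p : (Fin (m + 1) → Fin m → ℝ) → Prop} (hp : ∀ᵐ X, p X) :
    ∀ᵐ X ∂(Measure.pi fun _ : Fin (m + 1) => betaPrimeMeasure m β),
      p fun i => WithLp.ofLp (X i) := by
  have h := (volume_preserving_pi fun _ : Fin (m + 1) =>
    PiLp.volume_preserving_ofLp (Fin m)).quasiMeasurePreserving.ae hp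
  have : SigmaFinite (volume.withDensity fun x => ENNReal.ofReal (betaPrimeDensity m β x)) := by
    change SigmaFinite (betaPrimeMeasure m β)
    infer_instance
  simp only [betaPrimeMeasure]
  rw [pi_withDensity_eq _ (measurable_betaPrimeDensity m β)]
  exact (withDensity_absolutelyContinuous _ _).ae_le h

/-- The expected internal angle as an extended nonnegative integral. -/
def angleLIntegral (m k : ℕ) (β : ℝ) : ENNReal :=
  ∫⁻ X : Fin (m + 1) → EuclideanSpace ℝ (Fin m), sphereUnif m
    {u | ∃ ε : ℝ, 0 < ε ∧ ((k : ℝ)⁻¹ •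
      ∑ i ∈ Finset.univ.filter (fun i : Fin (m + 1) => (i : ℕ) < k), X i) +
      ε • (u : EuclideanSpace ℝ (Fin m)) ∈ convexHull ℝ (Set.range X)}
    ∂(Measure.pi fun _ : Fin (m + 1) => betaPrimeMeasure m β)

theorem lintegral_gauss_norm_ne_zero (m : ℕ) :
    (∫⁻ v : EuclideanSpace ℝ (Fin m), ENNReal.ofReal (exp (-‖v‖ ^ 2 / 2))) ≠ 0 := by
  rw [Ne, lintegral_eq_zero_iff (by fun_prop)]
  intro h
  have : ∀ᵐ v : EuclideanSpace ℝ (Fin m), False := by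
    filter_upwards [h] with v hv
    simp only [Pi.zero_apply, ENNReal.ofReal_eq_zero] at hv
    exact (exp_pos _).not_ge hv
  rw [ae_iff] at this
  simp only [not_false_eq_true, Set.ofPred_true] at this
  exact NeZero.ne _ (Measure.measure_univ_eq_zero.1 this)

theorem lintegral_gauss_norm_ne_top (m : ℕ) :
    (∫⁻ v : EuclideanSpace ℝ (Fin m), ENNReal.ofReal (exp (-‖v‖ ^ 2 / 2))) ≠ ⊤ := by
  rw [← (PiLp.volume_preserving_toLp (Fin m)).lintegral_comp (by fun_prop)]
  have h := integral_gauss_radial (m := m) 1 one_pos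
  simp only [one_pow, one_mul] at h
  simp only [EuclideanSpace.norm_sq_eq, Real.norm_eq_abs, sq_abs]
  rw [h]
  exact ENNReal.ofReal_ne_top

theorem angleLIntegral_mul_eq {m k a : ℕ} {β : ℝ} (h : 2 * β = a + m + 1) (hm : 0 < m) (hk : 1 ≤ k)
    (hkm : k ≤ m + 1) :
    angleLIntegral m k β *
      (∫⁻ v : EuclideanSpace ℝ (Fin m), ENNReal.ofReal (exp (-‖v‖ ^ 2 / 2))) =
    ENNReal.ofReal (betaConst m β / gaussMoment (a + m)) ^ (m + 1) *
      (gaussDet (Pi.single 0 1 : Fin (m + 1) → ℝ) *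
        ENNReal.ofReal (gaussMoment 0 / gaussMoment m) *
          coneAngleNorm a (Set.univ.pi (coneSide k (m := m)))) := by
  have := isProbabilityMeasure_betaPrimeMeasure h
  rw [← lintegral_fixedRadius_eq a (diagStable_coneSide k m) (measurableSet_coneSide k m)]
  have h1 := lintegral_betaPrime_eq h (measurable_edgeGauss (Set.univ.pi (coneSide k (m := m))))
  refine Eq.trans ?_ h1
  rw [angleLIntegral, ← lintegral_mul_const' _ _ (lintegral_gauss_norm_ne_top m)]
  refine lintegral_congr_ae ?_
  filter_upwards [ae_betaPrime_of_ae β (ae_det_edgeMatrix_ne_zero m)] with X hX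
  exact sphereUnif_internal hm hk hkm hX

theorem angleLIntegral_self {m a : ℕ} {β : ℝ} (h : 2 * β = a + m + 1) (hm : 0 < m) :
    angleLIntegral m (m + 1) β = 1 := by
  have := isProbabilityMeasure_betaPrimeMeasure h
  have e : ∀ᵐ X : Fin (m + 1) → EuclideanSpace ℝ (Fin m)
      ∂(Measure.pi fun _ : Fin (m + 1) => betaPrimeMeasure m β), sphereUnif m
    {u | ∃ ε : ℝ, 0 < ε ∧ (((m + 1 : ℕ) : ℝ)⁻¹ •
      ∑ i ∈ Finset.univ.filter (fun i : Fin (m + 1) => (i : ℕ) < m + 1), X i) +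
      ε • (u : EuclideanSpace ℝ (Fin m)) ∈ convexHull ℝ (Set.range X)} = 1 := by
    filter_upwards [ae_betaPrime_of_ae β (ae_det_edgeMatrix_ne_zero m)] with X hX
    rw [← sphereUnif_univ hm]
    congr 1
    refine Set.eq_univ_of_forall fun u => ?_
    have hu := Matrix.isUnit_iff_isUnit_det _ |>.2 (isUnit_iff_ne_zero.2 hX)
    obtain ⟨l, hl⟩ := (Matrix.mulVec_surjective_iff_isUnit.2 hu)
      (WithLp.ofLp (u : EuclideanSpace ℝ (Fin m)))
    have h := (mem_internalCone_iff (Nat.le_add_left 1 m) le_rfl hX l).2 fun j _ => by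
      rw [coneSide, if_neg (by omega)]
      trivial
    rw [hl] at h
    exact h
  rw [angleLIntegral, lintegral_congr_ae e, lintegral_one, measure_univ]

theorem angleLIntegral_mul_coneAngle {m k a : ℕ} {β : ℝ} (h : 2 * β = a + m + 1) (hm : 0 < m)
    (hk : 1 ≤ k) (hkm : k ≤ m + 1) :
    angleLIntegral m k β * coneAngle a (Set.univ.pi (coneSide (m + 1) (m := m))) =
      coneAngle a (Set.univ.pi (coneSide k (m := m))) := by
  obtain ⟨K, hK⟩ := exists_mul_coneAngle_eq m a
  have h1 := angleLIntegral_mul_eq h hm hk hkm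
  have h2 := angleLIntegral_mul_eq h hm (Nat.le_add_left 1 m) le_rfl
  have h3 := hK (Set.univ.pi (coneSide (m + 1) (m := m)))
  have h4 := hK (Set.univ.pi (coneSide k (m := m)))
  rw [angleLIntegral_self h hm, one_mul] at h2
  set Z := ∫⁻ v : EuclideanSpace ℝ (Fin m), ENNReal.ofReal (exp (-‖v‖ ^ 2 / 2))
  have hg : ENNReal.ofReal (gaussMoment 0) ≠ 0 := (ENNReal.ofReal_pos.2 (gaussMoment_pos 0)).ne'
  have hZ : Z ≠ 0 := lintegral_gauss_norm_ne_zero m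
  refine (ENNReal.mul_right_inj (mul_ne_zero hg hZ)
    (ENNReal.mul_ne_top ENNReal.ofReal_ne_top (lintegral_gauss_norm_ne_top m))).1 ?_
  calc ENNReal.ofReal (gaussMoment 0) * Z * (angleLIntegral m k β *
        coneAngle a (Set.univ.pi (coneSide (m + 1) (m := m)))) =
      (angleLIntegral m k β * Z) * (ENNReal.ofReal (gaussMoment 0) *
        coneAngle a (Set.univ.pi (coneSide (m + 1) (m := m)))) := by ring
    _ = Z * (ENNReal.ofReal (gaussMoment 0) *
        coneAngle a (Set.univ.pi (coneSide k (m := m)))) := by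
      rw [h1, h3, h4, h2]
      ring
    _ = _ := by ring

theorem coneForm_half {m : ℕ} (r : Fin (m + 1) → ℝ) (μ : Fin m → ℝ) :
    -coneForm r μ / 2 = -(∑ j, μ j ^ 2) / 2 - (∑ j, μ j * r j.succ) ^ 2 / (2 * r 0 ^ 2) := by
  rw [coneForm, mul_comm (2 : ℝ), ← div_div]
  ring

theorem toReal_coneAngle (m k a : ℕ) :
    (coneAngle a (Set.univ.pi (coneSide k (m := m)))).toReal = angleIntegral m k a := by
  have hfin : ∀ r : Fin (m + 1) → ℝ, coneGauss (Set.univ.pi (coneSide k)) r ≠ ⊤ := by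
    intro r
    have h := integral_gauss_radial (m := m) 1 one_pos
    refine ne_top_of_le_ne_top (h ▸ ENNReal.ofReal_ne_top)
      ((setLIntegral_le_lintegral _ _).trans (lintegral_mono fun μ => ?_))
    refine ENNReal.ofReal_le_ofReal (exp_le_exp.2 ?_)
    have : 0 ≤ (∑ j, μ j * r j.succ) ^ 2 / r 0 ^ 2 := by positivity
    rw [coneForm]
    linarith
  have hin : ∀ r : Fin (m + 1) → ℝ, ∫ μ : Fin m → ℝ in Set.univ.pi (coneSide k),
      exp (-(∑ j, μ j ^ 2) / 2 - (∑ j, μ j * r j.succ) ^ 2 / (2 * r 0 ^ 2)) =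
      (coneGauss (Set.univ.pi (coneSide k)) r).toReal := by
    intro r
    rw [integral_eq_lintegral_of_nonneg_ae (.of_forall fun μ => (exp_pos _).le)
      (Measurable.aestronglyMeasurable (by fun_prop)), coneGauss]
    simp only [coneForm_half]
  rw [angleIntegral, ← Measure.restrict_pi_pi, ← volume_pi, ← orthant,
    integral_eq_lintegral_of_nonneg_ae]
  · rw [coneAngle]
    congr 1
    refine setLIntegral_congr_fun (measurableSet_orthant _) fun r hr => ?_
    have hr0 := mem_orthant.1 hr
    have hp : 0 ≤ ∏ i, r i ^ a * exp (-r i ^ 2 / 2) := Finset.prod_nonneg fun i _ => by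
      have := hr0 i
      positivity
    have h0 := hr0 0
    simp only [hin]
    rw [ENNReal.ofReal_mul hp, ENNReal.ofReal_mul (by positivity), ENNReal.ofReal_toReal (hfin r)]
  · filter_upwards [ae_restrict_mem (measurableSet_orthant _)] with r hr
    have hr0 := mem_orthant.1 hr
    have hp : 0 ≤ ∏ i, r i ^ a * exp (-r i ^ 2 / 2) := Finset.prod_nonneg fun i _ => by
      have := hr0 i
      positivity
    have h0 := hr0 0
    simp only [hin]
    positivity
  · simp only [hin]
    refine Measurable.aestronglyMeasurable ?_
    have := (measurable_coneGauss (Set.univ.pi (coneSide k (m := m)))).ennreal_toReal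
    fun_prop

theorem Jt_succ_mem_or {m k : ℕ} (hm : 0 < m) (β : ℝ) :
    Jt (m + 1) k β = 0 ∨ Jt (m + 1) k β = (angleLIntegral m k β).toReal := by
  by_cases hs : AEStronglyMeasurable (fun X : Fin (m + 1) → EuclideanSpace ℝ (Fin m) =>
      internalAngle ((k : ℝ)⁻¹ •
        ∑ i ∈ Finset.univ.filter (fun i : Fin (m + 1) => (i : ℕ) < k), X i)
        (convexHull ℝ (Set.range X)))
      (Measure.pi fun _ : Fin (m + 1) => betaPrimeMeasure m β)
  · right
    refine (integral_eq_lintegral_of_nonneg_ae (.of_forall fun X => ENNReal.toReal_nonneg) hs).trans ?_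
    congr 1
    refine lintegral_congr fun X => ENNReal.ofReal_toReal ?_
    exact ne_top_of_le_ne_top ENNReal.one_ne_top
      ((measure_mono (Set.subset_univ _)).trans (sphereUnif_univ hm).le)
  · exact .inl (integral_non_aestronglyMeasurable hs)

theorem Jt_mem_negPiSpan {m k a : ℕ} {β : ℝ} (h : 2 * β = a + m + 1) (hk : 1 ≤ k)
    (hkm : k ≤ m + 1) : Jt (m + 1) k β ∈ negPiSpan ((a + 1) % 2 * (m + 1 - k)) := by
  rcases Nat.eq_zero_or_pos m with rfl | hm
  · have : Jt (0 + 1) k β = 0 := by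
      refine integral_eq_zero_of_ae (.of_forall fun X => ?_)
      have he : IsEmpty (Metric.sphere (0 : EuclideanSpace ℝ (Fin 0)) 1) :=
        ⟨fun u => by simpa [Subsingleton.elim (u : EuclideanSpace ℝ (Fin 0)) 0] using u.2⟩
      exact (congrArg (fun s => (sphereUnif 0 s).toReal) (Set.eq_empty_of_isEmpty _)).trans
        (by simp)
    rw [this]
    exact Submodule.zero_mem _
  rcases Jt_succ_mem_or (k := k) hm β with h0 | hJ
  · rw [h0]
    exact Submodule.zero_mem _
  obtain ⟨g, hg⟩ := exists_momentRatio a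
  refine re_integral_mem (a := a) (n := m + 1) (by omega) (by omega) hg ?_
  have h1 := congrArg ENNReal.toReal (angleLIntegral_mul_coneAngle h hm hk hkm)
  rw [ENNReal.toReal_mul, toReal_coneAngle, toReal_coneAngle, ← hJ] at h1
  have h2 := congrArg (fun x : ℝ => (x : ℂ)) h1
  simp only [Complex.ofReal_mul] at h2
  rw [angleIntegral_eq k a hm hk hkm,
    angleIntegral_eq (m + 1) a hm (Nat.le_add_left 1 m) le_rfl] at h2
  have hD : (((√(2 * π))⁻¹ * (√(2 * π) ^ m * gaussMoment a ^ (m + 1)) : ℝ) : ℂ) ≠ 0 := by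
    have := gaussMoment_pos a
    exact_mod_cast (by positivity :
      (0 : ℝ) < (√(2 * π))⁻¹ * (√(2 * π) ^ m * gaussMoment a ^ (m + 1))).ne'
  rw [mul_left_comm] at h2
  have h3 := mul_left_cancel₀ hD h2
  simp only [Nat.sub_self, pow_zero, one_mul] at h3
  rw [integral_complex_ofReal] at h3
  exact h3

theorem Jtb_mem_negPiSpan {n k a : ℕ} {β : ℝ} (h : 2 * β - n = a) (hk : 1 ≤ k) (hkn : k ≤ n) :
    Jtb n k β ∈ negPiSpan ((a + 1) % 2 * (n - k)) := by
  obtain ⟨m, rfl⟩ : ∃ m, n = m + 1 := ⟨n - 1, by omega⟩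
  have := Submodule.smul_mem _ ((m + 1).choose k : ℚ)
    (Jt_mem_negPiSpan (a := a) (β := β) (by push_cast at h; linarith) hk hkn)
  rw [Rat.smul_def] at this
  exact_mod_cast this

theorem Jtb_arithmetic (n k : ℕ) (hk1 : 1 ≤ k) (hk2 : k ≤ n) (β : ℝ)
    (hβ : ((n : ℝ) - 1) / 2 < β) (hhalf : ∃ m : ℤ, 2 * β = (m : ℝ)) :
    ((∃ m : ℤ, 2 * β - n = 2 * (m : ℝ) + 1) → ∃ q : ℚ, Jtb n k β = (q : ℝ)) ∧
    ((∃ m : ℤ, 2 * β - n = 2 * (m : ℝ)) →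
      (¬ Even (n - k) → ∃ q : ℕ → ℚ,
        Jtb n k β =
          ∑ j ∈ Finset.range ((n - k - 1) / 2 + 1), (q j : ℝ) * Real.pi ^ (-(2 * (j : ℤ)))) ∧
      (Even (n - k) → ∃ q : ℕ → ℚ,
        Jtb n k β =
          ∑ j ∈ Finset.range ((n - k) / 2 + 1),
            (q j : ℝ) * Real.pi ^ (-(2 * (j : ℤ))))) := by
  obtain ⟨M, hM⟩ := hhalf
  have hMn : (n : ℤ) ≤ M := by
    have : (n : ℝ) - 1 < M := by linarith
    have : (n : ℤ) - 1 < M := by exact_mod_cast this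
    omega
  obtain ⟨a, ha⟩ := Int.eq_ofNat_of_zero_le (sub_nonneg.2 hMn)
  have haβ : 2 * β - n = a := by
    rw [hM]
    exact_mod_cast ha
  have hmem := Jtb_mem_negPiSpan haβ hk1 hk2
  rw [haβ]
  refine ⟨?_, ?_⟩
  · rintro ⟨l, hl⟩
    have hl' : (a : ℤ) = 2 * l + 1 := by exact_mod_cast hl
    rw [show (a + 1) % 2 = 0 by omega, zero_mul] at hmem
    obtain ⟨q, hq⟩ := exists_sum_of_mem_negPiSpan hmem
    exact ⟨q 0, by simpa using hq⟩
  · rintro ⟨l, hl⟩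
    have hl' : (a : ℤ) = 2 * l := by exact_mod_cast hl
    rw [show (a + 1) % 2 = 1 by omega, one_mul] at hmem
    obtain ⟨q, hq⟩ := exists_sum_of_mem_negPiSpan hmem
    refine ⟨fun ho => ⟨q, ?_⟩, fun _ => ⟨q, hq⟩⟩
    rw [Nat.not_even_iff] at ho
    rwa [show (n - k - 1) / 2 = (n - k) / 2 by omega]

end
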